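/- arXiv:1612.05246 — 2 statements merged into one kernel-verified Lean document; each statement's English description precedes it below -/
import Mathlib

section
/- Let q be a prime power. The number of ordered 9-arcs in the projective plane ℙ²(F_q) is C_9(q) = (q^2+q+1)(q^2+q)q^2(q-1)^2 · [ q^10 - 75q^9 + 2530q^8 - 50466q^7 + 657739q^6 - 5835825q^5 + 35563770q^4 - 146288034q^3 + 386490120q^2 - 588513120q + 389442480 - 1080(q^4 - 47q^3 + 807q^2 - 5921q + 15134)·a(q) + 840(9q^2 - 243q + 1684)·b(q) + 30240(-9c(q) + 9d(q) + 2e(q)) ]. -/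
/-- Three points of the Desarguesian projective plane `ℙ²(F)` are collinear
iff representative vectors are linearly dependent. -/
def P2Collinear (F : Type) [Field F]
    (x y z : Projectivization F (Fin 3 → F)) : Prop :=
  ¬ Projectivization.Independent ![x, y, z]

/-- The number of ordered `n`-arcs of `ℙ²(F)`: `n`-tuples of distinct points,
no three collinear. -/
noncomputable def P2nArcs (F : Type) [Field F] (n : ℕ) : ℕ :=
  Nat.card {p : Fin n → Projectivization F (Fin 3 → F) // Function.Injective p ∧
    ∀ i j k : Fin n, i ≠ j → i ≠ k → j ≠ k → ¬ P2Collinear F (p i) (p j) (p k)}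

namespace ArcCount

open Finset Configuration ProjectivePlane
open scoped LinearAlgebra.Projectivization

/-- A family `B` of bit masks, viewed as subsets of `ℕ`, relates three indices when they lie in a
common member of `B`. -/
def Rel (B : List ℕ) (i j k : ℕ) : Prop :=
  ∃ b ∈ B, b.testBit i ∧ b.testBit j ∧ b.testBit k

/-- Three points on a common line. -/
def Col {P : Type*} (L : Type*) [Membership P L] (x y z : P) : Prop :=
  ∃ l : L, x ∈ l ∧ y ∈ l ∧ z ∈ l

/-- `p` is a tuple of distinct points, whose collinear triples are exactly those prescribed
by `B`. -/
def IsRealization {P : Type*} (L : Type*) [Membership P L] (n : ℕ) (B : List ℕ)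
    (p : Fin n → P) : Prop :=
  Function.Injective p ∧ ∀ i j k : Fin n, i ≠ j → i ≠ k → j ≠ k →
    (Col L (p i) (p j) (p k) ↔ Rel B i j k)

/-- The number of realizations of a collinearity pattern. -/
noncomputable def numReal (P L : Type*) [Membership P L] (n : ℕ) (B : List ℕ) : ℕ :=
  Nat.card {p : Fin n → P // IsRealization L n B p}

/-- `Bs` is a linear space on `n` points whose lines with at least three points generate the
same collinearity pattern as `B`. -/
structure IsLinearSpace (n : ℕ) (B Bs : List ℕ) : Prop where
  nodup : Bs.Nodup
  lt : ∀ b ∈ Bs, ∀ k, b.testBit k → k < n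
  cover : ∀ i j, i < j → j < n → ∃ b ∈ Bs, b.testBit i ∧ b.testBit j
  unique : ∀ b ∈ Bs, ∀ b' ∈ Bs, ∀ i j, i ≠ j → b.testBit i → b.testBit j →
    b'.testBit i → b'.testBit j → b = b'
  two : ∀ b ∈ Bs, ∃ i j, i ≠ j ∧ b.testBit i ∧ b.testBit j
  rel : ∀ i j k, i ≠ j → i ≠ k → j ≠ k → (Rel Bs i j k ↔ Rel B i j k)

/-- The number of points of a mask. -/
def size (n b : ℕ) : ℕ := (List.range n).countP b.testBit

theorem land_eq_zero_iff {a b : ℕ} : a &&& b = 0 ↔ ∀ k, a.testBit k → ¬ b.testBit k := by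
  constructor
  · intro h k ha hb
    have : (a &&& b).testBit k = true := by rw [Nat.testBit_and, ha, hb]; rfl
    rw [h] at this
    simp at this
  · intro h
    apply Nat.eq_of_testBit_eq
    intro k
    have := h k
    rw [Nat.testBit_and, Nat.zero_testBit]
    cases ha : a.testBit k <;> cases hb : b.testBit k <;> simp_all

section Plane

variable {P L : Type*} [Membership P L]

theorem Rel.mono {B B' : List ℕ} (h : ∀ b ∈ B, ∃ b' ∈ B', b &&& b' = b) {i j k : ℕ}
    (hr : Rel B i j k) : Rel B' i j k := by
  obtain ⟨b, hb, hi, hj, hk⟩ := hr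
  obtain ⟨b', hb', e⟩ := h b hb
  have key : ∀ m, b.testBit m → b'.testBit m := by
    intro m hm
    rw [← e, Nat.testBit_and, Bool.and_eq_true] at hm
    exact hm.2
  exact ⟨b', hb', key _ hi, key _ hj, key _ hk⟩

theorem Rel.swap_left {B : List ℕ} {i j k : ℕ} (h : Rel B i j k) : Rel B j i k := by
  obtain ⟨b, hb, hi, hj, hk⟩ := h
  exact ⟨b, hb, hj, hi, hk⟩

theorem Rel.swap_right {B : List ℕ} {i j k : ℕ} (h : Rel B i j k) : Rel B i k j := by
  obtain ⟨b, hb, hi, hj, hk⟩ := h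
  exact ⟨b, hb, hi, hk, hj⟩

theorem Col.swap_left {x y z : P} (h : Col L x y z) : Col L y x z := by
  obtain ⟨l, hx, hy, hz⟩ := h
  exact ⟨l, hy, hx, hz⟩

theorem Col.swap_right {x y z : P} (h : Col L x y z) : Col L x z y := by
  obtain ⟨l, hx, hy, hz⟩ := h
  exact ⟨l, hx, hz, hy⟩

theorem isRealization_of_lt {n : ℕ} {B : List ℕ} {p : Fin n → P} (hp : Function.Injective p)
    (h : ∀ i j k : Fin n, i < j → j < k → (Col L (p i) (p j) (p k) ↔ Rel B i j k)) :
    IsRealization L n B p := by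
  refine ⟨hp, ?_⟩
  have sl : ∀ i j k : Fin n, (Col L (p i) (p j) (p k) ↔ Rel B i j k) →
      (Col L (p j) (p i) (p k) ↔ Rel B j i k) := fun i j k h =>
    ⟨fun c => (h.1 c.swap_left).swap_left, fun c => (h.2 c.swap_left).swap_left⟩
  have sr : ∀ i j k : Fin n, (Col L (p i) (p j) (p k) ↔ Rel B i j k) →
      (Col L (p i) (p k) (p j) ↔ Rel B i k j) := fun i j k h =>
    ⟨fun c => (h.1 c.swap_right).swap_right, fun c => (h.2 c.swap_right).swap_right⟩
  intro i j k hij hik hjk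
  rcases lt_or_gt_of_ne hij with h1 | h1 <;> rcases lt_or_gt_of_ne hik with h2 | h2 <;>
    rcases lt_or_gt_of_ne hjk with h3 | h3
  · exact h _ _ _ h1 h3
  · exact sr _ _ _ (h _ _ _ h2 h3)
  · exact absurd (h1.trans h3) h2.asymm
  · exact sr _ _ _ (sl _ _ _ (h _ _ _ h2 h1))
  · exact sl _ _ _ (h _ _ _ h1 h2)
  · exact absurd (h3.trans h1) h2.asymm
  · exact sl _ _ _ (sr _ _ _ (h _ _ _ h3 h2))
  · exact sl _ _ _ (sr _ _ _ (sl _ _ _ (h _ _ _ h3 h1)))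

theorem exists_lines [ProjectivePlane P L] {n : ℕ} {B Bs : List ℕ} (hB : IsLinearSpace n B Bs)
    {p : Fin n → P} (hp : IsRealization L n B p) :
    ∃ ℓ : ℕ → L, ∀ b ∈ Bs, ∀ k : Fin n, p k ∈ ℓ b ↔ b.testBit k := by
  have hL : Nonempty L := by
    obtain ⟨-, -, -, l, -⟩ := ProjectivePlane.exists_config (P := P) (L := L)
    exact ⟨l⟩
  suffices h : ∀ b, ∃ l : L, b ∈ Bs → ∀ k : Fin n, p k ∈ l ↔ b.testBit k by
    choose ℓ hℓ using h
    exact ⟨ℓ, hℓ⟩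
  intro b
  by_cases hb : b ∈ Bs
  swap
  · exact ⟨hL.some, fun h => absurd h hb⟩
  obtain ⟨i, j, hij, hi, hj⟩ := hB.two b hb
  set i' : Fin n := ⟨i, hB.lt b hb i hi⟩
  set j' : Fin n := ⟨j, hB.lt b hb j hj⟩
  have hij' : i' ≠ j' := fun h => hij (Fin.mk.inj_iff.1 h)
  have hne : p i' ≠ p j' := fun h => hij' (hp.1 h)
  obtain ⟨hli, hlj⟩ := HasLines.mkLine_ax (L := L) hne
  refine ⟨HasLines.mkLine hne, fun _ k => ?_⟩
  by_cases hki : k = i'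
  · subst hki; exact ⟨fun _ => hi, fun _ => hli⟩
  by_cases hkj : k = j'
  · rw [hkj]; exact ⟨fun _ => hj, fun _ => hlj⟩
  have hik : i ≠ k := fun h => hki (Fin.ext h.symm)
  have hjk : j ≠ k := fun h => hkj (Fin.ext h.symm)
  have h1 := hp.2 i' j' k hij' (Ne.symm hki) (Ne.symm hkj)
  have h2 := hB.rel i j k hij hik hjk
  constructor
  · intro hk
    obtain ⟨b', hb', hi', hj', hk'⟩ := h2.2 (h1.1 ⟨_, hli, hlj, hk⟩)
    rwa [hB.unique b hb b' hb' i j hij hi hj hi' hj']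
  · intro hk
    obtain ⟨l, h3, h4, h5⟩ := h1.2 (h2.1 ⟨b, hb, hi, hj, hk⟩)
    rcases Nondegenerate.eq_or_eq h3 h4 hli hlj with h | h
    · exact absurd h hne
    · rwa [← h]

theorem size_eq_card (n b : ℕ) : size n b = #{k : Fin n | b.testBit k} := by
  rw [size, card_filter]
  induction n with
  | zero => simp
  | succ n ih =>
    rw [List.range_succ, List.countP_append, ih, Fin.sum_univ_castSucc]
    simp [List.countP_cons]

open scoped Classical in
/-- The points off the image of `p`, on all the lines `ℓ b` with `b ∈ U`. -/
noncomputable def offPts [Fintype P] {n : ℕ} (p : Fin n → P) (ℓ : ℕ → L) (U : List ℕ) : Finset P :=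
  {x | (∀ k, p k ≠ x) ∧ ∀ b ∈ U, x ∈ ℓ b}

theorem card_offPts_nil [ProjectivePlane P L] [Fintype P] [Finite L] {n : ℕ} {p : Fin n → P}
    (hp : Function.Injective p) (ℓ : ℕ → L) :
    (#(offPts p ℓ []) : ℤ) = (order P L : ℤ) ^ 2 + order P L + 1 - n := by
  classical
  have h1 : offPts p ℓ [] = univ \ univ.image p := by
    ext x; simp [offPts]
  rw [h1, card_sdiff_of_subset (subset_univ _), Nat.cast_sub (card_le_card (subset_univ _)),
    card_image_of_injective _ hp, card_univ, card_points P L, card_univ, Fintype.card_fin]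
  push_cast
  ring

theorem card_offPts_single [ProjectivePlane P L] [Fintype P] [Finite L] {n : ℕ} {p : Fin n → P}
    (hp : Function.Injective p) {ℓ : ℕ → L} {b : ℕ}
    (hb : ∀ k : Fin n, p k ∈ ℓ b ↔ b.testBit k) :
    (#(offPts p ℓ [b]) : ℤ) = (order P L : ℤ) + 1 - size n b := by
  classical
  have h1 : offPts p ℓ [b] =
      ({x | x ∈ ℓ b} : Finset P) \ ({k : Fin n | b.testBit k} : Finset (Fin n)).image p := by
    ext x
    simp only [offPts, mem_filter, mem_univ, true_and, List.mem_singleton, forall_eq, mem_sdiff,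
      mem_image, not_exists, not_and]
    constructor
    · rintro ⟨h1, h2⟩
      exact ⟨h2, fun k _ => h1 k⟩
    · rintro ⟨h1, h2⟩
      exact ⟨fun k hk => h2 k ((hb k).1 (hk ▸ h1)) hk, h1⟩
  have h2 : ({k : Fin n | b.testBit k} : Finset (Fin n)).image p ⊆ ({x | x ∈ ℓ b} : Finset P) := by
    intro x hx
    simp only [mem_image, mem_filter, mem_univ, true_and] at hx ⊢
    obtain ⟨k, hk, rfl⟩ := hx
    exact (hb k).2 hk
  have h3 : #({x | x ∈ ℓ b} : Finset P) = order P L + 1 := by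
    rw [← pointCount_eq P (ℓ b), pointCount, Nat.card_eq_fintype_card, Fintype.card_subtype]
  rw [h1, card_sdiff_of_subset h2, Nat.cast_sub (card_le_card h2), card_image_of_injective _ hp, h3,
    size_eq_card]
  push_cast
  ring

theorem card_offPts_pair [ProjectivePlane P L] [Fintype P] {n : ℕ} {B Bs : List ℕ}
    (hB : IsLinearSpace n B Bs) {p : Fin n → P} {ℓ : ℕ → L}
    (hℓ : ∀ b ∈ Bs, ∀ k : Fin n, p k ∈ ℓ b ↔ b.testBit k) {b b' : ℕ} (hb : b ∈ Bs)
    (hb' : b' ∈ Bs) (hne : b ≠ b') :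
    #(offPts p ℓ [b, b']) = if b &&& b' = 0 then 1 else 0 := by
  have hl : ℓ b ≠ ℓ b' := by
    intro h
    obtain ⟨i, j, hij, hi, hj⟩ := hB.two b hb
    refine hne (hB.unique b hb b' hb' i j hij hi hj ?_ ?_)
    · exact (hℓ b' hb' ⟨i, hB.lt b hb i hi⟩).1 (h ▸ (hℓ b hb ⟨i, hB.lt b hb i hi⟩).2 hi)
    · exact (hℓ b' hb' ⟨j, hB.lt b hb j hj⟩).1 (h ▸ (hℓ b hb ⟨j, hB.lt b hb j hj⟩).2 hj)
  obtain ⟨z, ⟨hz, hz'⟩, hu⟩ := HasPoints.existsUnique_point P L _ _ hl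
  split_ifs with h
  · rw [card_eq_one]
    refine ⟨z, ?_⟩
    ext x
    simp only [offPts, mem_filter, mem_univ, true_and, List.mem_cons, List.not_mem_nil, or_false,
      forall_eq_or_imp, forall_eq, mem_singleton]
    constructor
    · exact fun hx => hu x hx.2
    · rintro rfl
      refine ⟨fun k hk => ?_, hz, hz'⟩
      subst hk
      exact land_eq_zero_iff.1 h k ((hℓ b hb k).1 hz) ((hℓ b' hb' k).1 hz')
  · rw [card_eq_zero, eq_empty_iff_forall_notMem]
    intro x hx
    simp only [offPts, mem_filter, mem_univ, true_and, List.mem_cons, List.not_mem_nil, or_false,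
      forall_eq_or_imp, forall_eq] at hx
    rw [land_eq_zero_iff] at h
    push Not at h
    obtain ⟨k, hk, hk'⟩ := h
    have e1 := hu (p ⟨k, hB.lt b hb k hk⟩) ⟨(hℓ b hb ⟨k, hB.lt b hb k hk⟩).2 hk,
      (hℓ b' hb' ⟨k, hB.lt b hb k hk⟩).2 hk'⟩
    exact hx.1 _ (e1.trans (hu x hx.2).symm)

open scoped Classical in
/-- The lines of `Bs` disjoint from `u` that pass through `x`. -/
noncomputable def through (ℓ : ℕ → L) (Bs : List ℕ) (u : ℕ) (x : P) : List ℕ :=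
  Bs.filter fun b => b &&& u = 0 ∧ x ∈ ℓ b

theorem sum_length_through [Fintype P] {n : ℕ} (p : Fin n → P) (ℓ : ℕ → L) (U : List ℕ)
    (Bs : List ℕ) (u : ℕ) :
    ∑ x ∈ offPts p ℓ U, ((through ℓ Bs u x).length : ℤ) =
      ((Bs.filter fun b => b &&& u = 0).map fun b => (#(offPts p ℓ (b :: U)) : ℤ)).sum := by
  classical
  induction Bs with
  | nil => simp [through]
  | cons b Bs ih =>
    have key : ∀ x, ((through ℓ (b :: Bs) u x).length : ℤ) =
        (if b &&& u = 0 ∧ x ∈ ℓ b then 1 else 0) + (through ℓ Bs u x).length := by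
      intro x
      simp only [through, List.filter_cons, decide_eq_true_eq]
      split_ifs <;> simp [add_comm]
    simp only [key, sum_add_distrib, ih, List.filter_cons, decide_eq_true_eq]
    by_cases h : b &&& u = 0
    · rw [if_pos h, List.map_cons, List.sum_cons]
      congr 1
      rw [sum_boole]
      congr 2
      ext x
      simp [offPts, h]
      tauto
    · simp [h]

theorem sum_length_through_sq [Fintype P] {n : ℕ} (p : Fin n → P) (ℓ : ℕ → L)
    (Bs : List ℕ) :
    ∑ x ∈ offPts p ℓ [], ((through ℓ Bs 0 x).length : ℤ) ^ 2 =
      (Bs.map fun b => (Bs.map fun b' => (#(offPts p ℓ [b', b]) : ℤ)).sum).sum := by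
  classical
  have h1 : ∀ Cs : List ℕ, ∑ x ∈ offPts p ℓ [], ((through ℓ Cs 0 x).length : ℤ) *
      (through ℓ Bs 0 x).length =
      (Cs.map fun b => (Bs.map fun b' => (#(offPts p ℓ [b', b]) : ℤ)).sum).sum := by
    intro Cs
    induction Cs with
    | nil => simp [through]
    | cons b Cs ih =>
      have key : ∀ x, ((through ℓ (b :: Cs) 0 x).length : ℤ) =
          (if x ∈ ℓ b then 1 else 0) + (through ℓ Cs 0 x).length := by
        intro x
        simp only [through, List.filter_cons, decide_eq_true_eq]
        split_ifs <;> simp_all [add_comm]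
      simp only [key, add_mul, sum_add_distrib, ih, List.map_cons, List.sum_cons]
      congr 1
      have h2 := sum_length_through p ℓ [b] Bs 0
      simp only [Nat.and_zero, decide_true, List.filter_true] at h2
      rw [← h2]
      simp only [ite_mul, one_mul, zero_mul]
      rw [← sum_filter]
      congr 1
      ext x
      simp [offPts]
  simpa [sq] using h1 Bs

theorem sum_weight_zero [ProjectivePlane P L] [Fintype P] [Finite L] {n : ℕ} {B Bs : List ℕ}
    (hB : IsLinearSpace n B Bs) {p : Fin n → P} (hp : IsRealization L n B p) {ℓ : ℕ → L}
    (hℓ : ∀ b ∈ Bs, ∀ k : Fin n, p k ∈ ℓ b ↔ b.testBit k) :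
    ∑ x ∈ offPts p ℓ [], (((through ℓ Bs 0 x).length : ℤ) - 1) *
        ((through ℓ Bs 0 x).length - 2) =
      (Bs.map fun b => ((Bs.countP fun b' => b' &&& b = 0 : ℕ) : ℤ) -
        2 * ((order P L : ℤ) + 1 - size n b)).sum +
      2 * ((order P L : ℤ) ^ 2 + order P L + 1 - n) := by
  have e1 : ∀ b ∈ Bs, (Bs.map fun b' => (#(offPts p ℓ [b', b]) : ℤ)).sum =
      ((Bs.countP fun b' => b' &&& b = 0 : ℕ) : ℤ) + ((order P L : ℤ) + 1 - size n b) := by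
    intro b hb
    have e2 : ∀ b' ∈ Bs, (#(offPts p ℓ [b', b]) : ℤ) =
        (if b' &&& b = 0 then 1 else 0) +
          if b' = b then (order P L : ℤ) + 1 - size n b else 0 := by
      intro b' hb'
      by_cases h : b' = b
      · subst h
        have h0 : ¬ b' &&& b' = 0 := by
          obtain ⟨i, j, -, hi, -⟩ := hB.two b' hb'
          exact fun h => land_eq_zero_iff.1 h i hi hi
        rw [if_neg h0, if_pos rfl, zero_add, ← card_offPts_single hp.1 (hℓ b' hb')]
        congr 2
        ext x
        simp [offPts]
      · rw [card_offPts_pair hB hℓ hb' hb h, if_neg h]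
        simp
    rw [List.map_congr_left e2, List.sum_map_add]
    congr 1
    · clear * -
      induction Bs with
      | nil => simp
      | cons a l ih =>
        rw [List.map_cons, List.sum_cons, ih, List.countP_cons]
        by_cases h : a &&& b = 0 <;> simp [h, add_comm]
    · have h3 := hB.nodup
      generalize (order P L : ℤ) + 1 - size n b = c
      clear * - h3 hb
      rw [List.sum_map_ite_eq]
      rw [List.count_eq_one_of_mem h3 hb]
      simp
  have e3 := sum_length_through_sq p ℓ Bs
  rw [List.map_congr_left e1] at e3
  have e4 := sum_length_through p ℓ [] Bs 0
  simp only [Nat.and_zero, decide_true, List.filter_true] at e4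
  rw [List.map_congr_left fun b hb => card_offPts_single hp.1 (hℓ b hb)] at e4
  have e5 := card_offPts_nil hp.1 ℓ
  have e6 : ∀ x, (((through ℓ Bs 0 x).length : ℤ) - 1) * ((through ℓ Bs 0 x).length - 2) =
      ((through ℓ Bs 0 x).length : ℤ) ^ 2 - 3 * (through ℓ Bs 0 x).length + 2 := by
    intro x; ring
  simp only [e6, sum_add_distrib, sum_sub_distrib, ← mul_sum, sum_const, nsmul_eq_mul]
  rw [e3, e4, e5]
  have e7 : ∀ l : List ℕ, (l.map fun b => ((Bs.countP fun b' => b' &&& b = 0 : ℕ) : ℤ) +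
      ((order P L : ℤ) + 1 - size n b)).sum -
      3 * (l.map fun b => (order P L : ℤ) + 1 - size n b).sum =
      (l.map fun b => ((Bs.countP fun b' => b' &&& b = 0 : ℕ) : ℤ) -
        2 * ((order P L : ℤ) + 1 - size n b)).sum := by
    intro l
    induction l with
    | nil => simp
    | cons b l ih =>
      simp only [List.map_cons, List.sum_cons, ← ih]
      ring
  rw [e7]
  ring

theorem sum_weight_one [ProjectivePlane P L] [Fintype P] [Finite L] {n : ℕ} {B Bs : List ℕ}
    (hB : IsLinearSpace n B Bs) {p : Fin n → P} (hp : IsRealization L n B p) {ℓ : ℕ → L}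
    (hℓ : ∀ b ∈ Bs, ∀ k : Fin n, p k ∈ ℓ b ↔ b.testBit k) {b : ℕ} (hb : b ∈ Bs) :
    ∑ x ∈ offPts p ℓ [b], (1 - ((through ℓ Bs b x).length : ℤ)) =
      (order P L : ℤ) + 1 - size n b - (Bs.countP fun b' => b' &&& b = 0 : ℕ) := by
  have e1 : ∀ b' ∈ Bs.filter fun b' => b' &&& b = 0, (#(offPts p ℓ [b', b]) : ℤ) = 1 := by
    intro b' hb'
    simp only [List.mem_filter, decide_eq_true_eq] at hb'
    have hne : b' ≠ b := by
      rintro rfl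
      obtain ⟨i, j, -, hi, -⟩ := hB.two b' hb
      exact land_eq_zero_iff.1 hb'.2 i hi hi
    rw [card_offPts_pair hB hℓ hb'.1 hb hne, if_pos hb'.2]
    rfl
  have e2 := sum_length_through p ℓ [b] Bs b
  rw [List.map_congr_left e1] at e2
  rw [sum_sub_distrib, e2, sum_const, nsmul_eq_mul, card_offPts_single hp.1 (hℓ b hb)]
  simp [List.countP_eq_length_filter]

theorem sum_weight_two [ProjectivePlane P L] [Fintype P] {n : ℕ} {B Bs : List ℕ}
    (hB : IsLinearSpace n B Bs) {p : Fin n → P} {ℓ : ℕ → L}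
    (hℓ : ∀ b ∈ Bs, ∀ k : Fin n, p k ∈ ℓ b ↔ b.testBit k) {b b' : ℕ} (hb : b ∈ Bs)
    (hb' : b' ∈ Bs) (h : b &&& b' = 0) :
    ∑ _x ∈ offPts p ℓ [b, b'], (1 : ℤ) = 1 := by
  have hne : b ≠ b' := by
    rintro rfl
    obtain ⟨i, j, -, hi, -⟩ := hB.two b hb
    exact land_eq_zero_iff.1 h i hi hi
  rw [sum_const, card_offPts_pair hB hℓ hb hb' hne, if_pos h]
  rfl

end Plane

/-- The sublists of `bs` whose members are pairwise disjoint and disjoint from `u`. -/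
def subs : List ℕ → ℕ → List (List ℕ)
  | [], _ => [[]]
  | b :: bs, u => subs bs u ++ if b &&& u = 0 then (subs bs (u ||| b)).map (b :: ·) else []

theorem mem_of_mem_subs {bs : List ℕ} {u : ℕ} {S : List ℕ} (hS : S ∈ subs bs u) :
    S.Sublist bs ∧ ∀ b ∈ S, b &&& u = 0 := by
  induction bs generalizing u S with
  | nil => simp_all [subs]
  | cons b bs ih =>
    rw [subs, List.mem_append] at hS
    rcases hS with hS | hS
    · exact ⟨(ih hS).1.cons b, (ih hS).2⟩
    · split_ifs at hS with h
      · rw [List.mem_map] at hS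
        obtain ⟨S', h1, rfl⟩ := hS
        refine ⟨(ih h1).1.cons_cons b, ?_⟩
        intro b' hb'
        rcases List.mem_cons.1 hb' with rfl | hb'
        · exact h
        · have h2 := land_eq_zero_iff.1 ((ih h1).2 b' hb')
          rw [land_eq_zero_iff]
          intro k hk hu
          exact h2 k hk (by rw [Nat.testBit_or, hu]; rfl)
      · simp at hS

theorem sum_subs {bs : List ℕ} (hn : bs.Nodup) (p : ℕ → Bool) (c : List ℕ → ℤ) :
    ∀ u, (∀ b ∈ bs.filter p, b &&& u = 0) → (bs.filter p).Pairwise (fun b b' => b' &&& b = 0) →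
    ((subs bs u).map fun S => if bs.filter p = S then c S else 0).sum = c (bs.filter p) := by
  induction bs generalizing c with
  | nil => simp [subs]
  | cons b bs ih =>
    intro u hu hp
    rw [List.nodup_cons] at hn
    rw [subs, List.map_append, List.sum_append]
    by_cases h : p b
    · rw [List.filter_cons_of_pos h] at hu hp ⊢
      have hb := hu b List.mem_cons_self
      rw [List.pairwise_cons] at hp
      rw [if_pos hb, List.map_map]
      have e1 : ((subs bs u).map fun S => if b :: bs.filter p = S then c S else 0) =
          (subs bs u).map fun _ => 0 := by
        apply List.map_congr_left
        intro S hS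
        rw [if_neg]
        rintro rfl
        exact hn.1 ((mem_of_mem_subs hS).1.subset List.mem_cons_self)
      have e2 := ih hn.2 (fun S => c (b :: S)) (u ||| b) (by
        intro b' hb'
        have h1 := land_eq_zero_iff.1 (hu b' (List.mem_cons_of_mem _ hb'))
        have h2 := land_eq_zero_iff.1 (hp.1 b' hb')
        rw [land_eq_zero_iff]
        intro k hk hk'
        rw [Nat.testBit_or, Bool.or_eq_true] at hk'
        exact hk'.elim (h1 k hk) (h2 k hk)) hp.2
      rw [e1, ← e2]
      simp [Function.comp_def]
    · rw [List.filter_cons_of_neg h] at hu hp ⊢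
      rw [ih hn.2 c u hu hp]
      have e1 : (((if b &&& u = 0 then (subs bs (u ||| b)).map (b :: ·) else []).map fun S =>
          if bs.filter p = S then c S else 0).sum) = 0 := by
        apply List.sum_eq_zero
        intro z hz
        rw [List.mem_map] at hz
        obtain ⟨S, hS, rfl⟩ := hz
        split_ifs at hS with h3
        · rw [List.mem_map] at hS
          obtain ⟨S', -, rfl⟩ := hS
          rw [if_neg]
          intro h4
          have : b ∈ bs.filter p := h4 ▸ List.mem_cons_self
          exact hn.1 (List.mem_filter.1 this).1
        · simp at hS
      rw [e1, add_zero]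

/-- Add the point `n` to all the lines in `X`. -/
def ext (n : ℕ) (B X : List ℕ) : List ℕ := B ++ X.map (· ||| 1 <<< n)

theorem testBit_lor_shift {b n k : ℕ} : (b ||| 1 <<< n).testBit k = true ↔
    b.testBit k = true ∨ k = n := by
  rw [Nat.testBit_or, Nat.one_shiftLeft, Nat.testBit_two_pow, Bool.or_eq_true, decide_eq_true_eq,
    eq_comm (a := n)]

theorem rel_ext_iff {n : ℕ} {B X : List ℕ} {i j k : ℕ} :
    Rel (ext n B X) i j k ↔ Rel B i j k ∨ ∃ b ∈ X, (b.testBit i ∨ i = n) ∧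
      (b.testBit j ∨ j = n) ∧ (b.testBit k ∨ k = n) := by
  simp only [Rel, ext, List.mem_append, List.mem_map]
  constructor
  · rintro ⟨b, hb | ⟨b, hb, rfl⟩, h⟩
    · exact Or.inl ⟨b, hb, h⟩
    · simp only [testBit_lor_shift] at h
      exact Or.inr ⟨b, hb, h⟩
  · rintro (⟨b, hb, h⟩ | ⟨b, hb, h⟩)
    · exact ⟨b, Or.inl hb, h⟩
    · refine ⟨_, Or.inr ⟨b, hb, rfl⟩, ?_⟩
      simp only [testBit_lor_shift]
      exact h

section Plane

variable {P L : Type*} [Membership P L]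

theorem isRealization_snoc_iff [ProjectivePlane P L] {n : ℕ} {B Bs : List ℕ}
    (hB : IsLinearSpace n B Bs) {X : List ℕ} (hX : ∀ b ∈ X, b ∈ Bs) {p : Fin n → P} {x : P}
    {ℓ : ℕ → L} (hℓ : ∀ b ∈ Bs, ∀ k : Fin n, p k ∈ ℓ b ↔ b.testBit k)
    (hp : IsRealization L n B p) :
    IsRealization L (n + 1) (ext n B X) (Fin.snoc p x : Fin (n + 1) → P) ↔
      (∀ k, p k ≠ x) ∧ ∀ b ∈ Bs, x ∈ ℓ b ↔ b ∈ X := by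
  have hcol : (∀ k, p k ≠ x) → ∀ i j : Fin n, i ≠ j → ∀ b ∈ Bs, b.testBit i → b.testBit j →
      (Col L (p i) (p j) x ↔ x ∈ ℓ b) := by
    intro hx i j hij b hb hi hj
    constructor
    · rintro ⟨l, h1, h2, h3⟩
      rcases Nondegenerate.eq_or_eq h1 h2 ((hℓ b hb i).2 hi) ((hℓ b hb j).2 hj) with h | h
      · exact absurd (hp.1 h) hij
      · rwa [← h]
    · exact fun h => ⟨ℓ b, (hℓ b hb i).2 hi, (hℓ b hb j).2 hj, h⟩
  have hrel : ∀ i j : Fin n, i ≠ j → ∀ b ∈ Bs, b.testBit i → b.testBit j →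
      (Rel (ext n B X) i j n ↔ b ∈ X) := by
    intro i j hij b hb hi hj
    have hij' : (i : ℕ) ≠ j := fun h => hij (Fin.ext h)
    rw [rel_ext_iff, ← hB.rel i j n hij' i.2.ne j.2.ne]
    constructor
    · rintro (⟨b', hb', -, -, h⟩ | ⟨b', hb', h1, h2, -⟩)
      · exact absurd (hB.lt b' hb' n h) (lt_irrefl n)
      · rw [hB.unique b hb b' (hX b' hb') i j hij' hi hj (h1.resolve_right i.2.ne)
          (h2.resolve_right j.2.ne)]
        exact hb'
    · exact fun h => Or.inr ⟨b, h, Or.inl hi, Or.inl hj, Or.inr rfl⟩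
  constructor
  · rintro ⟨h1, h2⟩
    have hx : ∀ k, p k ≠ x := by
      intro k hk
      have := @h1 (Fin.castSucc k) (Fin.last n) (by simpa using hk)
      exact absurd this (Fin.castSucc_lt_last k).ne
    refine ⟨hx, fun b hb => ?_⟩
    obtain ⟨i, j, hij, hi, hj⟩ := hB.two b hb
    have hij' : (⟨i, hB.lt b hb i hi⟩ : Fin n) ≠ ⟨j, hB.lt b hb j hj⟩ := by simpa using hij
    rw [← hcol hx _ _ hij' b hb hi hj, ← hrel _ _ hij' b hb hi hj]
    have := h2 (Fin.castSucc ⟨i, hB.lt b hb i hi⟩) (Fin.castSucc ⟨j, hB.lt b hb j hj⟩) (Fin.last n)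
      (by simpa using hij) (Fin.castSucc_lt_last _).ne (Fin.castSucc_lt_last _).ne
    rwa [Fin.snoc_castSucc, Fin.snoc_castSucc, Fin.snoc_last] at this
  · rintro ⟨hx, h⟩
    refine isRealization_of_lt ?_ ?_
    · rw [Fin.snoc_injective_iff]
      exact ⟨hp.1, fun ⟨k, hk⟩ => hx k hk⟩
    · intro i j k hij hjk
      obtain ⟨j, rfl⟩ := Fin.exists_castSucc_eq.2 (hjk.trans_le (Fin.le_last k)).ne
      obtain ⟨i, rfl⟩ := Fin.exists_castSucc_eq.2 ((hij.trans hjk).trans_le (Fin.le_last k)).ne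
      have hij' : i < j := by simpa using hij
      rcases Fin.eq_castSucc_or_eq_last k with ⟨k, rfl⟩ | rfl
      · have hjk' : j < k := by simpa using hjk
        simp only [Fin.snoc_castSucc, Fin.val_castSucc]
        rw [hp.2 i j k hij'.ne (hij'.trans hjk').ne hjk'.ne, rel_ext_iff]
        constructor
        · exact Or.inl
        · rintro (h | ⟨b, hb, h1, h2, h3⟩)
          · exact h
          · rw [← hB.rel i j k (by omega) (by omega) (by omega)]
            exact ⟨b, hX b hb, h1.resolve_right i.2.ne, h2.resolve_right j.2.ne,
              h3.resolve_right k.2.ne⟩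
      · simp only [Fin.snoc_castSucc, Fin.snoc_last, Fin.val_castSucc, Fin.val_last]
        obtain ⟨b, hb, hi, hj⟩ := hB.cover i j hij' j.2
        rw [hcol hx i j hij'.ne b hb hi hj, h b hb, hrel i j hij'.ne b hb hi hj]

theorem IsRealization.of_snoc [ProjectivePlane P L] {n : ℕ} {B Bs : List ℕ}
    (hB : IsLinearSpace n B Bs) {X : List ℕ} (hX : ∀ b ∈ X, b ∈ Bs) {r : Fin (n + 1) → P}
    (hr : IsRealization L (n + 1) (ext n B X) r) :
    IsRealization L n B (fun i => r (Fin.castSucc i)) := by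
  refine ⟨fun i j h => Fin.castSucc_injective _ (hr.1 h), ?_⟩
  intro i j k hij hik hjk
  rw [hr.2 _ _ _ (by simpa using hij) (by simpa using hik) (by simpa using hjk)]
  simp only [Fin.val_castSucc]
  rw [rel_ext_iff]
  constructor
  · rintro (h | ⟨b, hb, h1, h2, h3⟩)
    · exact h
    · rw [← hB.rel i j k (by omega) (by omega) (by omega)]
      exact ⟨b, hX b hb, h1.resolve_right i.2.ne, h2.resolve_right j.2.ne,
        h3.resolve_right k.2.ne⟩
  · exact Or.inl

theorem eq_of_mem_lines [ProjectivePlane P L] {n : ℕ} {B Bs : List ℕ}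
    (hB : IsLinearSpace n B Bs) {p : Fin n → P} {ℓ : ℕ → L}
    (hℓ : ∀ b ∈ Bs, ∀ k : Fin n, p k ∈ ℓ b ↔ b.testBit k) {x : P} (hx : ∀ k, p k ≠ x)
    {b b' : ℕ} (hb : b ∈ Bs) (hb' : b' ∈ Bs) (hxb : x ∈ ℓ b) (hxb' : x ∈ ℓ b') {k : ℕ}
    (hk : b.testBit k) (hk' : b'.testBit k) : b = b' := by
  have h1 := (hℓ b hb ⟨k, hB.lt b hb k hk⟩).2 hk
  have h2 := (hℓ b' hb' ⟨k, hB.lt b hb k hk⟩).2 hk'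
  have hl : ℓ b = ℓ b' := (Nondegenerate.eq_or_eq hxb h1 hxb' h2).resolve_left (hx _).symm
  obtain ⟨i, j, hij, hi, hj⟩ := hB.two b hb
  refine hB.unique b hb b' hb' i j hij hi hj ?_ ?_
  · exact (hℓ b' hb' ⟨i, hB.lt b hb i hi⟩).1 (hl ▸ (hℓ b hb ⟨i, hB.lt b hb i hi⟩).2 hi)
  · exact (hℓ b' hb' ⟨j, hB.lt b hb j hj⟩).1 (hl ▸ (hℓ b hb ⟨j, hB.lt b hb j hj⟩).2 hj)

theorem through_eq_iff [ProjectivePlane P L] {n : ℕ} {B Bs : List ℕ}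
    (hB : IsLinearSpace n B Bs) {p : Fin n → P} {ℓ : ℕ → L}
    (hℓ : ∀ b ∈ Bs, ∀ k : Fin n, p k ∈ ℓ b ↔ b.testBit k) {x : P} (hx : ∀ k, p k ≠ x)
    {T : List ℕ} (hT : ∀ b ∈ T, b ∈ Bs) {u : ℕ}
    (hu : ∀ k, u.testBit k ↔ ∃ b ∈ T, b.testBit k) {S : List ℕ} (hS : S ∈ subs Bs u) :
    (∀ b ∈ Bs, x ∈ ℓ b ↔ b ∈ T ++ S) ↔ (∀ b ∈ T, x ∈ ℓ b) ∧ through ℓ Bs u x = S := by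
  classical
  obtain ⟨hs, hSu⟩ := mem_of_mem_subs hS
  have hf : through ℓ Bs u x = S ↔ ∀ b ∈ Bs, (b &&& u = 0 ∧ x ∈ ℓ b) ↔ b ∈ S := by
    have e : S = Bs.filter (· ∈ S) := by
      have h2 : ∀ {S Bs : List ℕ}, S.Sublist Bs → Bs.Nodup → S = Bs.filter (· ∈ S) := by
        intro S Bs hs
        induction hs with
        | slnil => simp
        | cons a h ih =>
          intro hn
          rw [List.nodup_cons] at hn
          rw [List.filter_cons_of_neg]
          · exact ih hn.2
          · simpa using fun h' => hn.1 (h.subset h')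
        | cons_cons a h ih =>
          intro hn
          rw [List.nodup_cons] at hn
          rw [List.filter_cons_of_pos (by simp)]
          congr 1
          conv_lhs => rw [ih hn.2]
          apply List.filter_congr
          intro b hb
          have : b ≠ a := fun h => hn.1 (h ▸ hb)
          simp [this]
      exact h2 hs hB.nodup
    constructor
    · rintro rfl b hb
      simp [through, hb]
    · intro h
      rw [e, through]
      apply List.filter_congr
      intro b hb
      simp [h b hb]
  rw [hf]
  have hnz : ∀ b ∈ T, ¬ b &&& u = 0 := by
    intro b hb h
    obtain ⟨i, -, -, hi, -⟩ := hB.two b (hT b hb)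
    exact land_eq_zero_iff.1 h i hi ((hu i).2 ⟨b, hb, hi⟩)
  constructor
  · intro h
    refine ⟨fun b hb => (h b (hT b hb)).2 (List.mem_append_left _ hb), fun b hb => ?_⟩
    rw [h b hb, List.mem_append]
    exact ⟨fun ⟨h1, h2⟩ => h2.resolve_left fun h3 => hnz b h3 h1, fun h1 => ⟨hSu b h1, Or.inr h1⟩⟩
  · rintro ⟨h1, h2⟩ b hb
    rw [List.mem_append]
    constructor
    · intro hxb
      by_cases h3 : b &&& u = 0
      · exact Or.inr ((h2 b hb).1 ⟨h3, hxb⟩)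
      · left
        rw [land_eq_zero_iff] at h3
        push Not at h3
        obtain ⟨k, hk, hku⟩ := h3
        obtain ⟨b', hb', hk'⟩ := (hu k).1 hku
        rwa [eq_of_mem_lines hB hℓ hx hb (hT b' hb') hxb (h1 b' hb') hk hk']
    · rintro (h3 | h3)
      · exact h1 b h3
      · exact ((h2 b hb).2 h3).2

open scoped Classical in
theorem numReal_ext [ProjectivePlane P L] [Fintype P] {n : ℕ} {B Bs : List ℕ}
    (hB : IsLinearSpace n B Bs) {T : List ℕ} (hT : ∀ b ∈ T, b ∈ Bs) {u : ℕ}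
    (hu : ∀ k, u.testBit k ↔ ∃ b ∈ T, b.testBit k) {S : List ℕ} (hS : S ∈ subs Bs u)
    (ℓ : {p : Fin n → P // IsRealization L n B p} → ℕ → L)
    (hℓ : ∀ p, ∀ b ∈ Bs, ∀ k : Fin n, p.1 k ∈ ℓ p b ↔ b.testBit k) :
    numReal P L (n + 1) (ext n B (T ++ S)) =
      ∑ p : {p : Fin n → P // IsRealization L n B p},
        #{x ∈ offPts p.1 (ℓ p) T | through (ℓ p) Bs u x = S} := by
  have hX : ∀ b ∈ T ++ S, b ∈ Bs := by
    intro b hb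
    rcases List.mem_append.1 hb with h | h
    · exact hT b h
    · exact (mem_of_mem_subs hS).1.subset h
  have key : ∀ (p : {p : Fin n → P // IsRealization L n B p}) (x : P),
      IsRealization L (n + 1) (ext n B (T ++ S)) (Fin.snoc p.1 x : Fin (n + 1) → P) ↔
      x ∈ ({x ∈ offPts p.1 (ℓ p) T | through (ℓ p) Bs u x = S} : Finset P) := by
    intro p x
    rw [isRealization_snoc_iff hB hX (hℓ p) p.2]
    simp only [offPts, mem_filter, mem_univ, true_and, and_assoc]
    refine and_congr_right fun hx => ?_
    exact through_eq_iff hB (hℓ p) hx hT hu hS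
  let e : {r : Fin (n + 1) → P // IsRealization L (n + 1) (ext n B (T ++ S)) r} ≃
      Σ p : {p : Fin n → P // IsRealization L n B p},
        ({x ∈ offPts p.1 (ℓ p) T | through (ℓ p) Bs u x = S} : Finset P) :=
    { toFun := fun r => ⟨⟨fun i => r.1 (Fin.castSucc i), r.2.of_snoc hB hX⟩,
        ⟨r.1 (Fin.last n), (key _ _).1 (by
          convert r.2
          exact Fin.snoc_init_self (α := fun _ => P) r.1)⟩⟩
      invFun := fun y => ⟨Fin.snoc y.1.1 y.2.1, (key _ _).2 y.2.2⟩
      left_inv := fun r => Subtype.ext (Fin.snoc_init_self (α := fun _ => P) r.1)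
      right_inv := by
        rintro ⟨⟨p, hp⟩, ⟨x, hx⟩⟩
        have h1 : (fun i => (Fin.snoc p x : Fin (n + 1) → P) (Fin.castSucc i)) = p := by
          funext i; simp
        have h2 : (Fin.snoc p x : Fin (n + 1) → P) (Fin.last n) = x := by simp
        refine Sigma.ext (Subtype.ext h1) ?_
        dsimp only
        congr! }
  rw [numReal, Nat.card_congr e, Nat.card_eq_fintype_card, Fintype.card_sigma]
  exact sum_congr rfl fun p _ => Fintype.card_coe _

theorem sum_map_sum {ι κ : Type*} (l : List κ) (s : Finset ι) (f : κ → ι → ℤ) :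
    (l.map fun a => ∑ x ∈ s, f a x).sum = ∑ x ∈ s, (l.map fun a => f a x).sum := by
  induction l with
  | nil => simp
  | cons a l ih => simp [ih, sum_add_distrib]

theorem sum_subs_numReal [ProjectivePlane P L] [Fintype P] {n : ℕ} {B Bs : List ℕ}
    (hB : IsLinearSpace n B Bs) {T : List ℕ} (hT : ∀ b ∈ T, b ∈ Bs) {u : ℕ}
    (hu : ∀ k, u.testBit k ↔ ∃ b ∈ T, b.testBit k) (w : ℕ → ℤ) (c : ℤ)
    (hw : ∀ (p : Fin n → P) (ℓ : ℕ → L), IsRealization L n B p →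
      (∀ b ∈ Bs, ∀ k : Fin n, p k ∈ ℓ b ↔ b.testBit k) →
      ∑ x ∈ offPts p ℓ T, w (through ℓ Bs u x).length = c) :
    ((subs Bs u).map fun S => w S.length *
      (numReal P L (n + 1) (ext n B (T ++ S)) : ℤ)).sum = c * numReal P L n B := by
  classical
  have hex := fun p : {p : Fin n → P // IsRealization L n B p} => exists_lines hB p.2
  choose ℓ hℓ using hex
  have e1 : ∀ S ∈ subs Bs u, w S.length * (numReal P L (n + 1) (ext n B (T ++ S)) : ℤ) =
      ∑ p : {p : Fin n → P // IsRealization L n B p}, ∑ x ∈ offPts p.1 (ℓ p) T,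
        if through (ℓ p) Bs u x = S then w S.length else 0 := by
    intro S hS
    rw [numReal_ext hB hT hu hS ℓ hℓ]
    push_cast
    rw [mul_sum]
    refine sum_congr rfl fun p _ => ?_
    rw [← sum_filter, sum_const, nsmul_eq_mul, mul_comm]
  rw [List.map_congr_left e1, sum_map_sum]
  have e2 : ∀ p : {p : Fin n → P // IsRealization L n B p},
      ((subs Bs u).map fun S => ∑ x ∈ offPts p.1 (ℓ p) T,
        if through (ℓ p) Bs u x = S then w S.length else 0).sum = c := by
    intro p
    rw [sum_map_sum, ← hw p.1 (ℓ p) p.2 (hℓ p)]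
    refine sum_congr rfl fun x hx => ?_
    have hx' : ∀ k, p.1 k ≠ x := by
      simp only [offPts, mem_filter, mem_univ, true_and] at hx
      exact hx.1
    unfold through
    refine sum_subs hB.nodup _ (fun S => w S.length) u ?_ ?_
    · intro b hb
      simp only [List.mem_filter, decide_eq_true_eq] at hb
      exact hb.2.1
    · refine List.Pairwise.imp_of_mem ?_ (List.Pairwise.filter _ hB.nodup)
      intro b b' hb hb' hne
      simp only [List.mem_filter, decide_eq_true_eq] at hb hb'
      rw [land_eq_zero_iff]
      intro k hk hk'
      exact hne (eq_of_mem_lines hB (hℓ p) hx' hb.1 hb'.1 hb.2.2 hb'.2.2 hk' hk)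
  rw [sum_congr rfl fun p _ => e2 p, sum_const, nsmul_eq_mul, mul_comm, card_univ, numReal,
    Nat.card_eq_fintype_card]

end Plane

/-- The map on indices whose values are the hexadecimal digits of `code`. -/
def digit (code i : ℕ) : ℕ := (code >>> (4 * i)) % 16

/-- The preimage of the mask `b` under `digit code`, among the indices below `n`. -/
def pull (code b : ℕ) : ℕ → ℕ
  | 0 => 0
  | n + 1 => pull code b n ||| if b.testBit (digit code n) then 1 <<< n else 0

/-- The image of the indices below `n` under `digit code`. -/
def imageMask (code : ℕ) : ℕ → ℕ
  | 0 => 0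
  | n + 1 => imageMask code n ||| 1 <<< digit code n

/-- Every mask in `B` is contained in some mask in `B'`. -/
def covers (B B' : List ℕ) : Bool := B.all fun b => B'.any fun c => Nat.beq (b &&& c) b

/-- `code` describes an isomorphism from the collinearity pattern `C` to `E`. -/
def isoCheck (n : ℕ) (E C : List ℕ) (code : ℕ) : Bool :=
  Nat.beq (imageMask code n) (2 ^ n - 1) &&
    (covers (E.map fun b => pull code b n) C && covers C (E.map fun b => pull code b n))

theorem testBit_pull (code b : ℕ) (n i : ℕ) :
    (pull code b n).testBit i ↔ i < n ∧ b.testBit (digit code i) := by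
  induction n with
  | zero => simp [pull]
  | succ n ih =>
    rw [pull, Nat.testBit_or, Bool.or_eq_true, ih]
    split_ifs with h
    · rw [Nat.one_shiftLeft, Nat.testBit_two_pow, decide_eq_true_eq]
      constructor
      · rintro (h1 | rfl)
        · exact ⟨by omega, h1.2⟩
        · exact ⟨by omega, h⟩
      · rintro ⟨h1, h2⟩
        rcases Nat.lt_succ_iff_lt_or_eq.1 h1 with h3 | h3
        · exact Or.inl ⟨h3, h2⟩
        · exact Or.inr h3.symm
    · rw [Nat.zero_testBit]
      constructor
      · rintro (h1 | h1)
        · exact ⟨by omega, h1.2⟩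
        · simp at h1
      · rintro ⟨h1, h2⟩
        rcases Nat.lt_succ_iff_lt_or_eq.1 h1 with h3 | h3
        · exact Or.inl ⟨h3, h2⟩
        · exact absurd (h3 ▸ h2) h

theorem testBit_imageMask (code n j : ℕ) :
    (imageMask code n).testBit j ↔ ∃ i < n, digit code i = j := by
  induction n with
  | zero => simp [imageMask]
  | succ n ih =>
    rw [imageMask, Nat.testBit_or, Bool.or_eq_true, ih, Nat.one_shiftLeft, Nat.testBit_two_pow,
      decide_eq_true_eq]
    constructor
    · rintro (⟨i, hi, h⟩ | h)
      · exact ⟨i, by omega, h⟩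
      · exact ⟨n, by omega, h⟩
    · rintro ⟨i, hi, h⟩
      rcases Nat.lt_succ_iff_lt_or_eq.1 hi with h3 | h3
      · exact Or.inl ⟨i, h3, h⟩
      · exact Or.inr (h3 ▸ h)

theorem covers_iff {B B' : List ℕ} : covers B B' ↔ ∀ b ∈ B, ∃ b' ∈ B', b &&& b' = b := by
  simp [covers]

theorem rel_map_pull {code n : ℕ} {E : List ℕ} {i j k : ℕ} (hi : i < n) (hj : j < n)
    (hk : k < n) : Rel (E.map fun b => pull code b n) i j k ↔
      Rel E (digit code i) (digit code j) (digit code k) := by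
  simp only [Rel, List.mem_map]
  constructor
  · rintro ⟨_, ⟨b, hb, rfl⟩, h⟩
    simp only [testBit_pull] at h
    exact ⟨b, hb, h.1.2, h.2.1.2, h.2.2.2⟩
  · rintro ⟨b, hb, h1, h2, h3⟩
    refine ⟨_, ⟨b, hb, rfl⟩, ?_⟩
    simp only [testBit_pull]
    exact ⟨⟨hi, h1⟩, ⟨hj, h2⟩, ⟨hk, h3⟩⟩

theorem numReal_eq_of_isoCheck (P L : Type*) [Membership P L] {n : ℕ} {E C : List ℕ} {code : ℕ}
    (h : isoCheck n E C code) : numReal P L n E = numReal P L n C := by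
  simp only [isoCheck, Bool.and_eq_true, Nat.beq_eq, covers_iff] at h
  obtain ⟨h1, h2, h3⟩ := h
  have him : ∀ j, (∃ i < n, digit code i = j) ↔ j < n := by
    intro j
    rw [← testBit_imageMask, h1, Nat.testBit_two_pow_sub_one, decide_eq_true_eq]
  let f : Fin n → Fin n := fun i => ⟨digit code i, (him _).1 ⟨i, i.2, rfl⟩⟩
  have hf : Function.Surjective f := by
    intro j
    obtain ⟨i, hi, h⟩ := (him j).2 j.2
    exact ⟨⟨i, hi⟩, Fin.ext h⟩
  let e : Fin n ≃ Fin n := Equiv.ofBijective f (Finite.surjective_iff_bijective.1 hf)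
  have hrel : ∀ i j k : Fin n, Rel C i j k ↔ Rel E (e i) (e j) (e k) := by
    intro i j k
    have : Rel E (e i) (e j) (e k) ↔ _ := (rel_map_pull (E := E) i.2 j.2 k.2).symm
    rw [this]
    exact ⟨Rel.mono h3, Rel.mono h2⟩
  refine Nat.card_congr (Equiv.subtypeEquiv (Equiv.arrowCongr e.symm (Equiv.refl P)) ?_)
  intro p
  have hp : ∀ i, (Equiv.arrowCongr e.symm (Equiv.refl P)) p i = p (e i) := fun i => rfl
  constructor
  · rintro ⟨h4, h5⟩
    refine ⟨fun i j hij => e.injective (h4 hij), fun i j k hij hik hjk => ?_⟩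
    rw [hp, hp, hp, hrel]
    exact h5 _ _ _ (e.injective.ne hij) (e.injective.ne hik) (e.injective.ne hjk)
  · rintro ⟨h4, h5⟩
    refine ⟨fun i j hij => ?_, fun i j k hij hik hjk => ?_⟩
    · have := @h4 (e.symm i) (e.symm j) (by rw [hp, hp]; simpa using hij)
      exact e.symm.injective this
    · have := h5 (e.symm i) (e.symm j) (e.symm k) (e.symm.injective.ne hij)
        (e.symm.injective.ne hik) (e.symm.injective.ne hjk)
      rw [hp, hp, hp, hrel] at this
      simpa using this

/-- The pairs of indices below `n` that are not contained in a member of `B`. -/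
def pairs (n : ℕ) (B : List ℕ) : List ℕ :=
  ((List.range n).flatMap fun j => (List.range j).map fun i => 1 <<< i ||| 1 <<< j).filter
    fun m => B.all fun b => !Nat.beq (m &&& b) m

/-- The lines of the linear space on `n` points whose full lines are `B`. -/
def blocks (n : ℕ) (B : List ℕ) : List ℕ := B ++ pairs n B

/-- At most one bit of `m` is set. -/
def subsingletonMask (m : ℕ) : Bool := Nat.beq m 0 || Nat.beq m (1 <<< m.log2)

/-- Any two members of the list have at most one bit in common. -/
def interCheck : List ℕ → Bool
  | [] => true
  | b :: B => B.all (fun b' => subsingletonMask (b &&& b')) && interCheck B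

/-- The members of `B` are the full lines of a linear space on `n` points. -/
def linearCheck (n : ℕ) (B : List ℕ) : Bool :=
  (B.all fun b => Nat.ble (b + 1) (2 ^ n) && !subsingletonMask b) && interCheck (blocks n B)

theorem not_beq_eq_true {a b : ℕ} : (!Nat.beq a b) = true ↔ a ≠ b := by
  rw [Bool.not_eq_true', ← Bool.not_eq_true, Nat.beq_eq]

theorem mem_pairs {n : ℕ} {B : List ℕ} {m : ℕ} : m ∈ pairs n B ↔
    ∃ i j, i < j ∧ j < n ∧ 1 <<< i ||| 1 <<< j = m ∧ ∀ b ∈ B, m &&& b ≠ m := by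
  simp only [pairs, List.mem_filter, List.mem_flatMap, List.mem_range, List.mem_map,
    List.all_eq_true, not_beq_eq_true]
  constructor
  · rintro ⟨⟨j, hj, i, hi, rfl⟩, h⟩
    exact ⟨i, j, hi, hj, rfl, h⟩
  · rintro ⟨i, j, hi, hj, rfl, h⟩
    exact ⟨⟨j, hj, i, hi, rfl⟩, h⟩

theorem testBit_pair {i j k : ℕ} : (1 <<< i ||| 1 <<< j).testBit k ↔ k = i ∨ k = j := by
  rw [Nat.testBit_or, Bool.or_eq_true, Nat.one_shiftLeft, Nat.one_shiftLeft, Nat.testBit_two_pow,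
    Nat.testBit_two_pow, decide_eq_true_eq, decide_eq_true_eq, eq_comm, @eq_comm _ j]

theorem subsingletonMask_iff {m : ℕ} : subsingletonMask m ↔
    ∀ i j, m.testBit i → m.testBit j → i = j := by
  rw [subsingletonMask, Bool.or_eq_true, Nat.beq_eq, Nat.beq_eq, Nat.one_shiftLeft]
  constructor
  · rintro (h | h) i j hi hj
    · rw [h] at hi; simp at hi
    · rw [h, Nat.testBit_two_pow, decide_eq_true_eq] at hi hj
      rw [← hi, ← hj]
  · intro h
    by_cases h0 : m = 0
    · exact Or.inl h0
    · right
      apply Nat.eq_of_testBit_eq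
      intro i
      have hl := Nat.testBit_log2 h0
      rw [Nat.testBit_two_pow, Bool.eq_iff_iff, decide_eq_true_eq]
      exact ⟨fun hi => h _ _ hl hi, fun hi => hi ▸ hl⟩

theorem pairwise_of_interCheck {B : List ℕ} (h : interCheck B) :
    B.Pairwise fun b b' => ∀ i j, i ≠ j → b.testBit i → b.testBit j → b'.testBit i →
      b'.testBit j → False := by
  induction B with
  | nil => exact List.Pairwise.nil
  | cons b B ih =>
    rw [interCheck, Bool.and_eq_true, List.all_eq_true] at h
    refine List.Pairwise.cons ?_ (ih h.2)
    intro b' hb' i j hij h1 h2 h3 h4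
    refine hij (subsingletonMask_iff.1 (h.1 b' hb') i j ?_ ?_)
    · rw [Nat.testBit_and, h1, h3]; rfl
    · rw [Nat.testBit_and, h2, h4]; rfl

theorem isLinearSpace_of_linearCheck {n : ℕ} {B : List ℕ} (h : linearCheck n B) :
    IsLinearSpace n B (blocks n B) := by
  rw [linearCheck, Bool.and_eq_true, List.all_eq_true] at h
  obtain ⟨h1, h2⟩ := h
  have hB : ∀ b ∈ B, b < 2 ^ n ∧ ∃ i j, i ≠ j ∧ b.testBit i ∧ b.testBit j := by
    intro b hb
    have := h1 b hb
    rw [Bool.and_eq_true, Bool.not_eq_true', ← Bool.not_eq_true, subsingletonMask_iff] at this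
    refine ⟨Nat.le_of_ble_eq_true this.1, ?_⟩
    have h3 := this.2
    push Not at h3
    obtain ⟨i, j, hi, hj, hij⟩ := h3
    exact ⟨i, j, hij, hi, hj⟩
  have htwo : ∀ b ∈ blocks n B, ∃ i j, i ≠ j ∧ b.testBit i ∧ b.testBit j := by
    intro b hb
    rcases List.mem_append.1 hb with hb | hb
    · exact (hB b hb).2
    · obtain ⟨i, j, hij, -, rfl, -⟩ := mem_pairs.1 hb
      exact ⟨i, j, hij.ne, testBit_pair.2 (Or.inl rfl), testBit_pair.2 (Or.inr rfl)⟩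
  have hpw := pairwise_of_interCheck h2
  refine ⟨?_, ?_, ?_, ?_, htwo, ?_⟩
  · refine hpw.imp_of_mem ?_
    rintro b b' hb - h rfl
    obtain ⟨i, j, hij, hi, hj⟩ := htwo b hb
    exact h i j hij hi hj hi hj
  · intro b hb k hk
    rcases List.mem_append.1 hb with hb | hb
    · by_contra hn
      have := Nat.testBit_lt_two_pow ((hB b hb).1.trans_le
        (Nat.pow_le_pow_right two_pos (not_lt.1 hn)))
      rw [this] at hk
      simp at hk
    · obtain ⟨i, j, hij, hj, rfl, -⟩ := mem_pairs.1 hb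
      rcases testBit_pair.1 hk with rfl | rfl
      · exact hij.trans hj
      · exact hj
  · intro i j hij hj
    by_cases h : ∃ b ∈ B, (1 <<< i ||| 1 <<< j) &&& b = 1 <<< i ||| 1 <<< j
    · obtain ⟨b, hb, h⟩ := h
      refine ⟨b, List.mem_append_left _ hb, ?_⟩
      have : ∀ k, (1 <<< i ||| 1 <<< j).testBit k → b.testBit k := by
        intro k hk
        rw [← h, Nat.testBit_and, Bool.and_eq_true] at hk
        exact hk.2
      exact ⟨this i (testBit_pair.2 (Or.inl rfl)), this j (testBit_pair.2 (Or.inr rfl))⟩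
    · push Not at h
      exact ⟨_, List.mem_append_right _ (mem_pairs.2 ⟨i, j, hij, hj, rfl, h⟩),
        testBit_pair.2 (Or.inl rfl), testBit_pair.2 (Or.inr rfl)⟩
  · intro b hb b' hb' i j hij h3 h4 h5 h6
    by_contra hne
    let R : ℕ → ℕ → Prop := fun b b' => b ≠ b' → ∀ i j, i ≠ j → b.testBit i → b.testBit j →
      b'.testBit i → b'.testBit j → False
    have hR : (blocks n B).Pairwise R := by
      refine hpw.imp ?_
      exact fun h _ => h
    have hR' : (blocks n B).Pairwise (flip R) := by
      refine hpw.imp ?_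
      exact fun h _ i j hij h3 h4 h5 h6 => h i j hij h5 h6 h3 h4
    exact hR.forall_of_forall_of_flip (fun x _ hx => absurd rfl hx) hR' hb hb' hne i j hij h3 h4
      h5 h6
  · intro i j k hij hik hjk
    constructor
    · rintro ⟨b, hb, h3, h4, h5⟩
      rcases List.mem_append.1 hb with hb | hb
      · exact ⟨b, hb, h3, h4, h5⟩
      · obtain ⟨i', j', -, -, rfl, -⟩ := mem_pairs.1 hb
        rw [testBit_pair] at h3 h4 h5
        omega
    · rintro ⟨b, hb, h⟩
      exact ⟨b, List.mem_append_left _ hb, h⟩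

/-- Sum of polynomials given by their lists of coefficients. -/
def padd : List ℤ → List ℤ → List ℤ
  | [], q => q
  | p, [] => p
  | a :: p, b :: q => (a + b) :: padd p q

/-- Product of polynomials given by their lists of coefficients. -/
def pmul : List ℤ → List ℤ → List ℤ
  | [], _ => []
  | a :: p, q => padd (q.map (a * ·)) (0 :: pmul p q)

/-- Value of the polynomial with a given list of coefficients. -/
def peval {R : Type*} [CommRing R] (x : R) : List ℤ → R
  | [] => 0
  | a :: p => a + x * peval x p

section peval

variable {R : Type*} [CommRing R] (x : R)

theorem peval_padd (p q : List ℤ) : peval x (padd p q) = peval x p + peval x q := by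
  induction p generalizing q with
  | nil => simp [padd, peval]
  | cons a p ih =>
    cases q with
    | nil => simp [padd, peval]
    | cons b q =>
      simp only [padd, peval, ih]
      push_cast
      ring

theorem peval_map_mul (a : ℤ) (p : List ℤ) : peval x (p.map (a * ·)) = a * peval x p := by
  induction p with
  | nil => simp [peval]
  | cons b p ih =>
    simp only [List.map_cons, peval, ih]
    push_cast
    ring

theorem peval_pmul (p q : List ℤ) : peval x (pmul p q) = peval x p * peval x q := by
  induction p with
  | nil => simp [pmul, peval]
  | cons a p ih =>
    simp only [pmul, peval_padd, peval_map_mul, peval, ih]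
    push_cast
    ring

theorem peval_eq_zero {p : List ℤ} (h : p.all fun a => decide (a = 0)) : peval x p = 0 := by
  induction p with
  | nil => rfl
  | cons a p ih =>
    rw [List.all_cons, Bool.and_eq_true, decide_eq_true_eq] at h
    simp [peval, ih h.2, h.1]

end peval

/-- Sum of tuples of polynomials. -/
def vadd : List (List ℤ) → List (List ℤ) → List (List ℤ)
  | [], w => w
  | v, [] => v
  | p :: v, q :: w => padd p q :: vadd v w

/-- The combination of the numbers `N` whose coefficients are the values at `x` of the
polynomials `v`. -/
def veval (x : ℤ) : List ℤ → List (List ℤ) → ℤ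
  | a :: N, p :: v => peval x p * a + veval x N v
  | _, _ => 0

theorem veval_nil (x : ℤ) (N : List ℤ) : veval x N [] = 0 := by
  cases N <;> rfl

theorem veval_vadd (x : ℤ) (N : List ℤ) (v w : List (List ℤ)) :
    veval x N (vadd v w) = veval x N v + veval x N w := by
  induction N generalizing v w with
  | nil => simp [veval]
  | cons a N ih =>
    cases v with
    | nil => simp [vadd, veval]
    | cons p v =>
      cases w with
      | nil => simp [vadd, veval]
      | cons q w =>
        simp only [vadd, veval, ih, peval_padd]
        ring

theorem veval_map_pmul (x : ℤ) (N : List ℤ) (p : List ℤ) (v : List (List ℤ)) :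
    veval x N (v.map (pmul p)) = peval x p * veval x N v := by
  induction N generalizing v with
  | nil => simp [veval]
  | cons a N ih =>
    cases v with
    | nil => simp [veval]
    | cons q v =>
      simp only [List.map_cons, veval, ih, peval_pmul]
      ring

theorem veval_eq_zero (x : ℤ) (N : List ℤ) {v : List (List ℤ)}
    (h : v.all fun p => p.all fun a => decide (a = 0)) : veval x N v = 0 := by
  induction N generalizing v with
  | nil => rfl
  | cons a N ih =>
    cases v with
    | nil => rfl
    | cons p v =>
      rw [List.all_cons, Bool.and_eq_true] at h
      rw [veval, peval_eq_zero x h.1, ih h.2, zero_mul, zero_add]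

/-- The number of members of `Bs` disjoint from `b`. -/
def disjCount (Bs : List ℕ) (b : ℕ) : ℕ := Bs.countP fun b' => b' &&& b = 0

/-- The weight of an extension through `r` further lines, when a point is added on the
lines `T`. -/
def weight : List ℕ → ℕ → ℤ
  | [], r => ((r : ℤ) - 1) * (r - 2)
  | [_], r => 1 - r
  | _, _ => 1

/-- The polynomial in the order of the plane giving the weighted number of extensions. -/
def factor (n : ℕ) (Bs : List ℕ) : List ℕ → List ℤ
  | [] => padd [2 - 2 * n, 2, 2] [(Bs.map fun b => (disjCount Bs b : ℤ) - 2 * (1 - size n b)).sum,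
      -2 * Bs.length]
  | [b] => [1 - size n b - disjCount Bs b, 1]
  | _ => [1]

/-- The list has at most two members, and they are disjoint. -/
def pairDisjoint : List ℕ → Bool
  | [] => true
  | [_] => true
  | [b, b'] => Nat.beq (b &&& b') 0
  | _ => false

/-- The list `T` can be prescribed as the set of lines through a further point. -/
def admissible (Bs T : List ℕ) : Bool :=
  (T.all fun b => Bs.any (Nat.beq b)) && pairDisjoint T

/-- The union of a list of masks. -/
def union : List ℕ → ℕ
  | [] => 0
  | b :: T => b ||| union T

theorem testBit_union {T : List ℕ} {k : ℕ} :
    (union T).testBit k ↔ ∃ b ∈ T, b.testBit k := by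
  induction T with
  | nil => simp [union]
  | cons b T ih => simp [union, Nat.testBit_or, ih]

theorem sum_weight_numReal (P L : Type*) [Membership P L] [ProjectivePlane P L] [Fintype P]
    [Finite L] {n : ℕ} {B T : List ℕ} (hB : linearCheck n B) (hT : admissible (blocks n B) T) :
    ((subs (blocks n B) (union T)).map fun S => weight T S.length *
      (numReal P L (n + 1) (ext n B (T ++ S)) : ℤ)).sum =
    peval (order P L : ℤ) (factor n (blocks n B) T) * numReal P L n B := by
  have h := isLinearSpace_of_linearCheck hB
  rw [admissible, Bool.and_eq_true, List.all_eq_true] at hT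
  obtain ⟨hT1, hT2⟩ := hT
  have hT : ∀ b ∈ T, b ∈ blocks n B := by
    intro b hb
    have := hT1 b hb
    rw [List.any_eq_true] at this
    obtain ⟨b', hb', e⟩ := this
    rwa [Nat.eq_of_beq_eq_true e]
  refine sum_subs_numReal h hT (fun k => testBit_union) (weight T) _ ?_
  intro p ℓ hp hℓ
  rcases T with - | ⟨b, - | ⟨b', - | ⟨b'', T⟩⟩⟩
  · clear hT2
    have := sum_weight_zero h hp hℓ
    simp only [weight, union]
    rw [this]
    simp only [factor, peval_padd, peval]
    have e : ∀ l : List ℕ, (l.map fun b => ((((blocks n B).countP fun b' => b' &&& b = 0) : ℕ) : ℤ)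
        - 2 * ((order P L : ℤ) + 1 - size n b)).sum =
        (l.map fun b => (disjCount (blocks n B) b : ℤ) - 2 * (1 - size n b)).sum -
          2 * l.length * order P L := by
      intro l
      induction l with
      | nil => simp
      | cons b l ih =>
        simp only [List.map_cons, List.sum_cons, ih, List.length_cons, disjCount]
        push_cast
        ring
    rw [e]
    simp only [Int.cast_id]
    ring
  · clear hT2
    have := sum_weight_one h hp hℓ (hT b (by simp))
    simp only [weight, union, Nat.or_zero]
    rw [this]
    simp only [factor, peval, disjCount]
    push_cast
    ring
  · have := sum_weight_two h hℓ (hT b (by simp)) (hT b' (by simp)) (Nat.eq_of_beq_eq_true hT2)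
    simp only [weight, factor, peval]
    rw [this]
    simp
  · exact absurd hT2 Bool.false_ne_true

/-- An entry of a table of collinearity patterns. The pattern `lines` on `n` points is obtained
from the entry with index `par` by adding a point on the lines `T`; the other extensions of
that entry are identified by `certs`, and `vec` expresses the number of realizations. -/
structure Row where
  n : ℕ
  lines : List ℕ
  par : ℕ
  T : List ℕ
  certs : List (ℕ × ℕ)
  vec : List (List ℤ)

/-- The weighted sum of the numbers of realizations of the extensions of `B` listed, by means of
the entries of `tab` with index less than `i`. -/
def childSum (tab : List Row) (i n : ℕ) (B T : List ℕ) :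
    List (List ℕ) → List (ℕ × ℕ) → Option (List (List ℤ))
  | [], _ => some []
  | S :: Ss, certs =>
    if weight T S.length = 0 then childSum tab i n B T Ss certs else
    match certs with
    | [] => none
    | (j, code) :: certs =>
      match tab[j]? with
      | none => none
      | some r =>
        if Nat.ble (j + 1) i && (Nat.beq r.n (n + 1) &&
          isoCheck (n + 1) (ext n B (T ++ S)) r.lines code) then
          (childSum tab i n B T Ss certs).map (vadd (r.vec.map (pmul [weight T S.length])))
        else none

/-- The entry `r` with index `i` is a consequence of entries with smaller index. -/
def rowCheck (tab : List Row) (i : ℕ) (r : Row) : Bool :=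
  match tab[r.par]? with
  | none => false
  | some p =>
    Nat.ble (r.par + 1) i && (Nat.beq r.n (p.n + 1) && (linearCheck p.n p.lines &&
      (admissible (blocks p.n p.lines) r.T &&
      (isoCheck r.n (ext p.n p.lines r.T) r.lines 18364758544493064720 &&
      match subs (blocks p.n p.lines) (union r.T) with
      | [] :: Ss =>
        match childSum tab i p.n p.lines r.T Ss r.certs with
        | none => false
        | some v => decide (weight r.T 0 ≠ 0) &&
          (vadd (vadd (r.vec.map (pmul [weight r.T 0])) v)
            (p.vec.map (pmul (pmul [-1] (factor p.n (blocks p.n p.lines) r.T))))).all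
            fun p => p.all fun a => decide (a = 0)
      | _ => false))))

theorem childSum_sound (P L : Type*) [Membership P L] {tab : List Row} {x : ℤ} {N : List ℤ}
    {i : ℕ} (ih : ∀ j < i, ∀ r, tab[j]? = some r →
      (numReal P L r.n r.lines : ℤ) = veval x N r.vec) {n : ℕ} {B T : List ℕ}
    (Ss : List (List ℕ)) (certs : List (ℕ × ℕ)) (v : List (List ℤ))
    (h : childSum tab i n B T Ss certs = some v) :
    (Ss.map fun S => weight T S.length *
      (numReal P L (n + 1) (ext n B (T ++ S)) : ℤ)).sum = veval x N v := by
  induction Ss generalizing certs v with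
  | nil =>
    simp only [childSum, Option.some.injEq] at h
    subst h
    simp [veval_nil]
  | cons S Ss ih2 =>
    rw [childSum.eq_def] at h
    dsimp only at h
    split_ifs at h with h0
    · rw [List.map_cons, List.sum_cons, h0, zero_mul, zero_add]
      exact ih2 _ _ h
    · cases certs with
      | nil => simp at h
      | cons c certs =>
        obtain ⟨j, code⟩ := c
        dsimp only at h
        cases hr : tab[j]? with
        | none => simp [hr] at h
        | some r =>
          rw [hr] at h
          dsimp only at h
          split_ifs at h with h1
          simp only [Bool.and_eq_true, Nat.beq_eq] at h1
          obtain ⟨h2, h3, h4⟩ := h1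
          rw [Option.map_eq_some_iff] at h
          obtain ⟨w, hw, rfl⟩ := h
          rw [List.map_cons, List.sum_cons, ih2 _ _ hw, veval_vadd, veval_map_pmul,
            numReal_eq_of_isoCheck P L h4, ← h3, ih j (Nat.le_of_ble_eq_true h2) r hr]
          simp [peval]

theorem rowCheck_sound (P L : Type*) [Membership P L] [ProjectivePlane P L] [Fintype P] [Finite L]
    {tab : List Row} {N : List ℤ} {i : ℕ} (ih : ∀ j < i, ∀ r, tab[j]? = some r →
      (numReal P L r.n r.lines : ℤ) = veval (order P L : ℤ) N r.vec) {r : Row}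
    (h : rowCheck tab i r) :
    (numReal P L r.n r.lines : ℤ) = veval (order P L : ℤ) N r.vec := by
  rw [rowCheck] at h
  cases hp : tab[r.par]? with
  | none => simp [hp] at h
  | some p =>
    rw [hp] at h
    simp only [Bool.and_eq_true, Nat.beq_eq] at h
    obtain ⟨h1, h2, h3, h4, h5, h6⟩ := h
    have key := sum_weight_numReal P L h3 h4
    rw [ih r.par (Nat.le_of_ble_eq_true h1) p hp] at key
    split at h6
    swap
    · simp at h6
    rename_i Ss hSs
    rw [hSs] at key
    split at h6
    · simp at h6
    rename_i v hv
    rw [Bool.and_eq_true, decide_eq_true_eq] at h6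
    obtain ⟨h7, h8⟩ := h6
    have h9 := veval_eq_zero (order P L : ℤ) N h8
    rw [veval_vadd, veval_vadd, veval_map_pmul, veval_map_pmul, peval_pmul] at h9
    rw [List.map_cons, List.sum_cons, childSum_sound P L ih _ _ _ hv, List.append_nil, ← h2,
      numReal_eq_of_isoCheck P L h5] at key
    simp only [peval, List.length_nil, mul_zero, add_zero, Int.cast_id] at key h9
    have : weight r.T 0 * (numReal P L r.n r.lines - veval (order P L : ℤ) N r.vec) = 0 := by
      linear_combination key - h9
    rcases mul_eq_zero.1 this with h | h
    · exact absurd h h7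
    · linarith

/-- The first `k` entries of the table are taken as known, the other ones are consequences. -/
def tableCheck (k : ℕ) (tab : List Row) : Bool :=
  (List.range tab.length).all fun i =>
    match tab[i]? with
    | none => true
    | some r => if i < k then decide (r.vec = List.replicate i [] ++ [[1]]) else rowCheck tab i r

theorem veval_replicate (x : ℤ) (N : List ℤ) (i : ℕ) :
    veval x N (List.replicate i [] ++ [[1]]) = N.getD i 0 := by
  induction i generalizing N with
  | zero => cases N <;> simp [veval, peval]
  | succ i ih =>
    cases N with
    | nil => simp [veval]
    | cons a N => simp [List.replicate_succ, veval, peval, ih]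

theorem tableCheck_sound (P L : Type*) [Membership P L] [ProjectivePlane P L] [Fintype P]
    [Finite L] {k : ℕ} {tab : List Row} (h : tableCheck k tab) (i : ℕ) (r : Row)
    (hr : tab[i]? = some r) :
    (numReal P L r.n r.lines : ℤ) = veval (order P L : ℤ)
      ((tab.take k).map fun r => (numReal P L r.n r.lines : ℤ)) r.vec := by
  induction i using Nat.strong_induction_on generalizing r with
  | _ i ih =>
    rw [tableCheck, List.all_eq_true] at h
    have hi : i < tab.length := (List.getElem?_eq_some_iff.1 hr).1
    have := h i (List.mem_range.2 hi)
    rw [hr] at this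
    dsimp only at this
    split_ifs at this with hk
    · rw [decide_eq_true_eq] at this
      rw [this, veval_replicate]
      simp [List.getD_eq_getElem?_getD, hk, hr]
    · exact rowCheck_sound P L ih this

/-- Collinearity patterns on at most nine points that occur in the recursion for nine-arcs. -/
def table : List Row := [
  ⟨0, [], 0, [], [], [[1]]⟩,
  ⟨7, [19, 28, 37, 42, 70, 73, 112], 0, [], [], [[], [1]]⟩,
  ⟨8, [28, 37, 42, 67, 112, 134, 145, 200], 0, [], [], [[], [], [1]]⟩,
  ⟨9, [21, 26, 41, 67, 166, 200, 268, 368, 385], 0, [], [], [[], [], [], [1]]⟩,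
  ⟨9, [21, 35, 73, 112, 138, 196, 300, 322, 400], 0, [], [], [[], [], [], [], [1]]⟩,
  ⟨9, [22, 41, 69, 88, 131, 176, 266, 292, 448], 0, [], [], [[], [], [], [], [], [1]]⟩,
  ⟨9, [28, 41, 70, 81, 131, 164, 266, 304, 448], 0, [], [], [[], [], [], [], [], [], [1]]⟩,
  ⟨9, [19, 44, 70, 73, 133, 176, 280, 352, 386], 0, [], [], [[], [], [], [], [], [], [], [1]]⟩,
  ⟨9, [67, 84, 104, 133, 152, 162, 265, 274, 292, 448], 0, [], [], [[], [], [], [], [], [], [],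
    [], [1]]⟩,
  ⟨9, [19, 37, 42, 73, 112, 140, 194, 280, 324, 416], 0, [], [], [[], [], [], [], [], [], [],
    [], [], [1]]⟩,
  ⟨9, [70, 73, 112, 131, 152, 164, 261, 274, 296, 448], 0, [], [], [[], [], [], [], [], [], [],
    [], [], [], [1]]⟩,
  ⟨9, [25, 42, 76, 112, 148, 161, 194, 274, 292, 321, 392], 0, [], [], [[], [], [], [], [], [],
    [], [], [], [], [], [1]]⟩,
  ⟨9, [25, 35, 44, 70, 112, 133, 146, 200, 266, 276, 321, 416], 0, [], [], [[], [], [], [], [],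
    [], [], [], [], [], [], [], [1]]⟩,
  ⟨1, [], 0, [], [], [[1, 1, 1]]⟩,
  ⟨2, [], 13, [], [], [[0, 1, 2, 2, 1]]⟩,
  ⟨3, [], 14, [], [], [[0, 0, 0, 1, 2, 2, 1]]⟩,
  ⟨4, [], 15, [], [], [[0, 0, 0, 1, 0, -1, -1, 0, 1]]⟩,
  ⟨5, [], 16, [], [], [[0, 0, 0, 6, -5, -5, -1, 4, 5, -5, 1]]⟩,
  ⟨6, [], 17, [], [], [[0, 0, 0, 126, -159, -54, 19, 88, 68, -146, 71, -14, 1]]⟩,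
  ⟨3, [7], 14, [3], [], [[0, -1, -1, 0, 1, 1]]⟩,
  ⟨4, [7], 19, [], [], [[0, 0, 0, -1, -1, 0, 1, 1]]⟩,
  ⟨5, [7, 28], 20, [12], [], [[0, 0, 0, 1, 0, -1, -1, 0, 1]]⟩,
  ⟨6, [7, 28], 21, [], [], [[0, 0, 0, 6, -5, -5, -1, 4, 5, -5, 1]]⟩,
  ⟨6, [7, 28, 41, 50], 21, [9, 18], [], [[0, 0, 0, 1, 0, -1, -1, 0, 1]]⟩,
  ⟨7, [7, 28, 41, 50, 100], 23, [36], [(1, 106054416)], [[0, 0, 0, -3, 1, 3, 2, -1, -3, 1],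
    [1]]⟩,
  ⟨7, [7, 28, 100], 22, [36], [(24, 90391056), (24, 90452496)], [[0, 0, 0, -36, 33, 26, 4,
    -23, -27, 32, -10, 1], [2]]⟩,
  ⟨7, [], 18, [], [(25, 52696656), (25, 52762176), (25, 69408336), (25, 86185536), (25,
    69539376), (25, 86251056), (25, 70391376), (25, 87168576), (25, 88217136), (25,
    70587936), (25, 87299616), (25, 88282656), (25, 70592016), (25, 87303696), (25,
    88286736)], [[0, 0, 0, 7470, -11004, -1008, 1582, 4865, 2932, -9374, 6167, -1925, 322, -28,
    1], [-30]]⟩,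
  ⟨6, [7, 28, 50], 21, [18], [], [[0, 0, 0, -2, 1, 2, 1, -1, -2, 1]]⟩,
  ⟨7, [7, 28, 50, 104], 27, [40], [], [[0, 0, 0, 6, -5, -5, -1, 4, 5, -5, 1]]⟩,
  ⟨7, [7, 28, 50, 73, 100], 27, [9, 36], [], [[0, 0, 0, -2, 1, 2, 1, -1, -2, 1]]⟩,
  ⟨8, [7, 28, 50, 73, 100, 168, 194], 29, [66, 40], [(2, 1648580368)], [[0, 0, 0, -2, 1, 2, 1,
    -1, -2, 1], [], [-1]]⟩,
  ⟨8, [7, 28, 50, 104, 161, 196], 28, [33, 68], [(30, 1731481888)], [[0, 0, 0, 8, -6, -7, -2, 5,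
    7, -6, 1], [], [1]]⟩,
  ⟨8, [19, 28, 37, 42, 70, 73, 240], 1, [112], [], [[], [-2, 1]]⟩,
  ⟨8, [7, 28, 41, 50, 228], 24, [100], [(32, 1733444368)], [[0, 0, 0, 12, -7, -11, -5, 6, 11,
    -7, 1], [-6, 2]]⟩,
  ⟨8, [7, 28, 100], 25, [], [(31, 1702113808), (31, 1450455568), (31, 1131827728), (31,
    1131766288), (31, 1702052368), (31, 1450394128), (31, 880169488), (31, 880108048), (33,
    1702052368), (33, 1702113808), (33, 1131766288), (33, 1131827728), (33, 276128323), (33,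
    276189763)], [[0, 0, 0, -2080, 2376, 1028, -69, -1348, -1254, 2173, -1029, 226, -24, 1],
    [144, -40, 2], [-8]]⟩,
  ⟨8, [], 26, [], [(34, 70592353), (34, 339027808), (34, 70657873), (34, 607459168), (34,
    339093328), (34, 607524688), (34, 87304033), (34, 355739488), (34, 104081233), (34,
    874846048), (34, 372516688), (34, 874911568), (34, 87435073), (34, 624170848), (34,
    104146753), (34, 891557728), (34, 640948048), (34, 908334928), (34, 355870528), (34,
    624301888), (34, 372582208), (34, 891688768), (34, 641013568), (34, 908400448), (34,
    88287073), (34, 356722528), (34, 105064273), (34, 1126504288), (34, 373499728), (34,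
    1126569808), (34, 106112833), (34, 1394874208), (34, 1663309648), (34, 374548288), (34,
    1395005248), (34, 1663375168), (34, 88483633), (34, 625153888), (34, 105195313), (34,
    1159927648), (34, 641931088), (34, 1176704848), (34, 106178353), (34, 1411585888), (34,
    1680021328), (34, 642979648), (34, 1445140288), (34, 1696798528), (34, 356919088), (34,
    625350448), (34, 373630768), (34, 1160124208), (34, 642062128), (34, 1176835888), (34,
    374613808), (34, 1411782448), (34, 1680152368), (34, 643045168), (34, 1445205808), (34,
    1696864048), (34, 88487713), (34, 893523808), (34, 105199393), (34, 1160910688), (34,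
    910301008), (34, 1177687888), (34, 106182433), (34, 1412568928), (34, 1681004368), (34,
    911349568), (34, 1446123328), (34, 1697781568), (34, 1179785008), (34, 1447171888), (34,
    1698830128), (34, 356923168), (34, 893785888), (34, 373634848), (34, 1161172768), (34,
    910497568), (34, 1177884448), (34, 374617888), (34, 1412831008), (34, 1681200928), (34,
    911480608), (34, 1446254368), (34, 1697912608), (34, 1179850528), (34, 1447237408), (34,
    1698895648), (34, 625358608), (34, 893789968), (34, 642070288), (34, 1161176848), (34,
    910501648), (34, 1177888528), (34, 643053328), (34, 1412835088), (34, 1681205008), (34,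
    911484688), (34, 1446258448), (34, 1697916688), (34, 1179854608), (34, 1447241488), (34,
    1698899728)], [[0, 0, 0, 1114800, -1719360, -1350, 206241, 692692, 387792, -1406820,
    1038497, -387444, 85827, -11830, 1002, -48, 1], [-18720, 4800, -240], [840]]⟩,
  ⟨8, [7, 28, 41, 50, 100], 24, [], [(32, 1733444368)], [[0, 0, 0, -75, 55, 62, 21, -42, -63,
    54, -13, 1], [27, -11, 1]]⟩,
  ⟨8, [7, 28, 41, 50, 100, 138, 208], 24, [80, 10], [], [[0, 0, 0, -3, 1, 3, 2, -1, -3, 1],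
    [1]]⟩,
  ⟨7, [7, 28, 41, 50, 74, 100], 23, [10, 36], [(1, 106054416)], [[0, 0, 0, 1, 0, -1, -1, 0, 1],
    [-1]]⟩,
  ⟨8, [7, 28, 41, 50, 74, 145, 228], 38, [17, 100], [], [[0, 0, 0, 1, 0, -1, -1, 0, 1], [-1]]⟩,
  ⟨9, [7, 28, 41, 50, 74, 145, 228, 336, 392], 39, [136, 80], [(3, 26124699651)], [[0, 0, 0, 1,
    0, -1, -1, 0, 1], [-1], [], [-1]]⟩,
  ⟨9, [37, 42, 67, 112, 134, 145, 200, 284, 416], 2, [160, 28], [(3, 13195572741)], [[], [],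
    [1], [-1]]⟩,
  ⟨9, [7, 28, 41, 50, 100, 138, 208, 328], 37, [72], [(9, 27703531536), (10, 13495665936), (40,
    1367487606), (4, 18842343456), (41, 1462862436)], [[0, 0, 0, 22, -10, -21, -12, 9, 21, -10,
    1], [-8, 1], [1], [-2], [1], [], [], [], [], [1], [1]]⟩,
  ⟨8, [7, 28, 41, 50, 74, 100, 208], 38, [80], [], [[0, 0, 0, -3, 1, 3, 2, -1, -3, 1], [3, -1]]⟩,
  ⟨9, [7, 28, 41, 50, 74, 100, 208, 273], 43, [17], [(40, 32318435856), (40, 32315282736), (40,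
    32316346656), (40, 32314237776)], [[0, 0, 0, 25, -10, -24, -15, 9, 24, -10, 1], [-25, 10,
    -1], [], [-4]]⟩,
  ⟨8, [7, 41, 50, 100, 156, 194], 24, [66, 28], [], [[0, 0, 0, -3, 1, 3, 2, -1, -3, 1], [1]]⟩,
  ⟨9, [7, 41, 50, 74, 145, 228, 284, 386], 39, [130, 28], [(3, 31224895536)], [[0, 0, 0, 1, 0,
    -1, -1, 0, 1], [-1], [], [-1]]⟩,
  ⟨9, [19, 37, 42, 70, 73, 240, 284, 386], 32, [130, 28], [], [[], [-2, 1]]⟩,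
  ⟨9, [7, 41, 50, 100, 156, 194, 266], 45, [10], [(40, 594875526), (4, 18810939216), (41,
    18657538656), (40, 26427348096), (46, 27719651856), (47, 31814992656)], [[0, 0, 0, 24, -10,
    -23, -14, 9, 23, -10, 1], [-12, 2], [1], [-4], [1]]⟩,
  ⟨9, [7, 28, 41, 50, 100, 416], 36, [160], [(42, 31814012961), (42, 31809688611), (42,
    31813030176), (42, 31810671396), (44, 27786559746), (48, 30871421526), (48, 31155520086),
    (48, 30119395926), (48, 30403494486)], [[0, 0, 0, 884, -660, -703, -246, 480, 725, -639,
    180, -22, 1], [-348, 148, -21, 1], [8], [-28], [8], [], [], [], [], [4], [4]]⟩,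
  ⟨7, [7, 28, 41, 50], 23, [], [(1, 106054416)], [[0, 0, 0, 9, -6, -8, -3, 5, 8, -6, 1], [-1]]⟩,
  ⟨8, [7, 28, 41, 50, 208], 50, [80], [(43, 1733571088)], [[0, 0, 0, -48, 40, 37, 9, -29, -38,
    39, -11, 1], [8, -2]]⟩,
  ⟨8, [7, 28, 41, 50, 100, 208], 24, [80], [], [[0, 0, 0, 12, -7, -11, -5, 6, 11, -7, 1], [-4,
    1]]⟩,
  ⟨9, [7, 28, 41, 50, 100, 138, 208, 328, 385], 37, [129, 72], [(4, 18842343456)], [[0, 0, 0,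
    -3, 1, 3, 2, -1, -3, 1], [1], [], [], [-1]]⟩,
  ⟨9, [7, 28, 41, 50, 100, 208, 328, 386], 52, [130, 72], [(53, 32318374401)], [[0, 0, 0, 15,
    -8, -14, -7, 7, 14, -8, 1], [-5, 1], [], [], [1]]⟩,
  ⟨9, [7, 28, 41, 50, 74, 100, 208, 385], 43, [129], [], [[0, 0, 0, 15, -8, -14, -7, 7, 14, -8,
    1], [-15, 8, -1]]⟩,
  ⟨8, [7, 28, 50, 73, 100, 208], 29, [80], [(2, 844515088), (39, 24531523)], [[0, 0, 0, 11,
    -7, -10, -4, 6, 10, -7, 1], [-1], [1]]⟩,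
  ⟨9, [7, 41, 50, 100, 156, 194, 328, 416], 45, [72, 160], [(4, 31763542656), (46, 880284246)],
    [[0, 0, 0, -4, 1, 4, 3, -1, -4, 1], [2], [], [1], [-1]]⟩,
  ⟨9, [7, 28, 50, 73, 208, 356, 386], 56, [130, 100], [(57, 13426321431)], [[0, 0, 0, 15, -8,
    -14, -7, 7, 14, -8, 1], [-3], [1], [-1], [1]]⟩,
  ⟨9, [7, 28, 41, 50, 208, 385], 51, [129], [(54, 31811896641), (54, 31814910531), (54,
    31810978626), (54, 31812878661), (55, 27652531476), (58, 4904413191), (58, 22348457991),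
    (58, 8928978951), (58, 14296377351)], [[0, 0, 0, 567, -480, -419, -107, 333, 439, -461,
    147, -20, 1], [-119, 38, -3], [4], [-4], [8]]⟩,
  ⟨8, [7, 28, 50, 104, 196], 28, [68], [(30, 1731481888), (37, 1450394128), (45, 1445205808)],
    [[0, 0, 0, -44, 39, 33, 6, -28, -34, 38, -11, 1], [2], [-1]]⟩,
  ⟨7, [7, 28, 50, 100], 27, [36], [(38, 90391056)], [[0, 0, 0, 9, -6, -8, -3, 5, 8, -6, 1],
    [-1]]⟩,
  ⟨8, [7, 28, 50, 100, 137, 208], 61, [9, 80], [], [[0, 0, 0, 9, -6, -8, -3, 5, 8, -6, 1],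
    [-1]]⟩,
  ⟨9, [7, 28, 50, 100, 137, 208, 266, 416], 62, [160, 10], [(7, 23375258496), (53,
    27233107986)], [[0, 0, 0, 12, -7, -11, -5, 6, 11, -7, 1], [-2], [], [], [1], [], [], [-1]]⟩,
  ⟨9, [7, 28, 41, 50, 100, 138, 208, 321], 37, [65], [(4, 19098114096), (4, 19145308176)], [[0,
    0, 0, 18, -9, -17, -9, 8, 17, -9, 1], [-6, 1], [], [], [2]]⟩,
  ⟨9, [7, 28, 50, 73, 100, 168, 194, 336, 385], 30, [129, 80], [(9, 18573976176)], [[0, 0, 0,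
    -2, 1, 2, 1, -1, -2, 1], [], [-1], [], [], [], [], [], [], [-1]]⟩,
  ⟨9, [7, 28, 50, 73, 100, 208, 296, 386], 56, [130, 40], [(65, 32282923521)], [[0, 0, 0, 13,
    -8, -12, -5, 7, 12, -8, 1], [-1], [2], [], [], [], [], [], [], [1]]⟩,
  ⟨9, [7, 28, 50, 100, 137, 208, 296, 386], 62, [130, 40], [(6, 27153953601), (65,
    27187949586)], [[0, 0, 0, 11, -7, -10, -4, 6, 10, -7, 1], [-1], [1], [], [], [], [-1], [],
    [], [1]]⟩,
  ⟨9, [28, 37, 42, 67, 145, 200, 368, 390], 2, [134, 112], [(3, 19168309776)], [[], [], [1],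
    [-1]]⟩,
  ⟨9, [7, 41, 50, 100, 156, 194, 328], 45, [72], [(4, 31763542656), (68, 18563164176), (46,
    880284246)], [[0, 0, 0, 19, -9, -18, -10, 8, 18, -9, 1], [-7, 1], [1], [-2], [1]]⟩,
  ⟨8, [7, 41, 50, 100, 156], 24, [28], [], [[0, 0, 0, 12, -7, -11, -5, 6, 11, -7, 1], [-4, 1]]⟩,
  ⟨9, [7, 41, 50, 100, 156, 194, 273, 328], 45, [17, 72], [(4, 31763542656)], [[0, 0, 0, -3, 1,
    3, 2, -1, -3, 1], [1], [], [], [-1]]⟩,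
  ⟨9, [7, 41, 50, 100, 156, 328, 386], 70, [72, 130], [(71, 27783214101)], [[0, 0, 0, 15, -8,
    -14, -7, 7, 14, -8, 1], [-5, 1], [], [], [1]]⟩,
  ⟨9, [7, 28, 50, 73, 100, 194, 424], 30, [168], [(46, 928127076)], [[0, 0, 0, 11, -7, -10, -4,
    6, 10, -7, 1], [-1], [5, -1], [-1]]⟩,
  ⟨9, [7, 28, 50, 104, 196, 416], 60, [160], [(63, 13426059351), (64, 1916175441), (63,
    605250951), (54, 31763693856), (66, 4433597991), (67, 17839822896), (69, 1097017431), (72,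
    5375207511), (73, 344401491)], [[0, 0, 0, 522, -465, -375, -77, 319, 395, -446, 146, -20,
    1], [-48, 6], [18, -2], [-3], [7], [], [-1], [-2], [], [2]]⟩,
  ⟨8, [7, 28, 41, 50, 74, 228], 38, [100], [], [[0, 0, 0, -3, 1, 3, 2, -1, -3, 1], [3, -1]]⟩,
  ⟨8, [7, 28, 50, 100, 208], 61, [80], [(30, 1698918688), (75, 24531523)], [[0, 0, 0, -59, 47,
    47, 13, -35, -48, 46, -12, 1], [9, -2], [-1]]⟩,
  ⟨9, [28, 37, 42, 67, 112, 134, 145, 200, 324, 416], 2, [160, 68], [(11, 30674393136), (11,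
    22069774401), (12, 18646008336)], [[], [], [1], [], [], [], [], [], [], [], [], [-2], [-1]]⟩,
  ⟨9, [7, 28, 50, 73, 100, 168, 194, 336], 30, [80], [(8, 23126639376), (77, 1631089236), (9,
    18573976176), (77, 31427413536), (11, 15138428736), (46, 928127076)], [[0, 0, 0, 15, -9,
    -14, -6, 8, 14, -9, 1], [-1], [9, -1], [-1], [], [], [], [], [1], [1], [], [-2], [-2]]⟩,
  ⟨9, [7, 28, 41, 50, 100, 138, 208, 273, 328], 37, [72, 17], [(9, 27703531536), (10,
    13495665936)], [[0, 0, 0, -3, 1, 3, 2, -1, -3, 1], [1], [], [], [], [], [], [], [], [-1],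
    [-1]]⟩,
  ⟨9, [7, 28, 50, 73, 100, 208, 266, 388], 56, [10, 132], [(65, 31709475156), (79,
    23454819201)], [[0, 0, 0, 16, -9, -15, -7, 8, 15, -9, 1], [-2], [2], [], [], [], [], [], [],
    [2], [1]]⟩,
  ⟨9, [7, 28, 41, 50, 100, 208, 321, 416], 52, [65, 160], [(53, 31810671396), (57,
    32318374401)], [[0, 0, 0, 19, -9, -18, -10, 8, 18, -9, 1], [-7, 1], [], [-1], [2]]⟩,
  ⟨8, [7, 28, 41, 50, 100, 138], 24, [10], [(32, 1733444368)], [[0, 0, 0, 15, -8, -14, -7, 7,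
    14, -8, 1], [-7, 2]]⟩,
  ⟨9, [7, 41, 50, 100, 156, 194, 266, 416], 45, [10, 160], [(40, 594875526), (41, 18657538656),
    (40, 26427348096)], [[0, 0, 0, -5, 1, 5, 4, -1, -5, 1], [3], [-1], [3]]⟩,
  ⟨9, [7, 28, 41, 50, 100, 138, 328, 416], 82, [160, 72], [(79, 31814012961), (83,
    32318165556)], [[0, 0, 0, 23, -10, -22, -13, 9, 22, -10, 1], [-11, 2], [1], [-3], [], [],
    [], [], [], [1], [1]]⟩,
  ⟨9, [7, 28, 50, 73, 100, 168, 194, 266], 30, [10], [(77, 1631089236), (9, 18573976176), (9,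
    1631081076), (77, 18573980256), (77, 31427413536), (11, 15138428736), (9, 31427405376), (40,
    642979956), (40, 17806997616), (40, 31761569856)], [[0, 0, 0, 19, -10, -18, -9, 9, 18, -10,
    1], [-3], [11, -1], [-3], [], [], [], [], [], [3], [], [-4], [-3]]⟩,
  ⟨9, [7, 28, 50, 73, 100, 168, 194, 336, 388], 30, [80, 132], [(8, 23126639376), (77,
    1631089236), (11, 15138428736)], [[0, 0, 0, -2, 1, 2, 1, -1, -2, 1], [], [-2], [], [], [],
    [], [], [-1], [], [], [1], [1]]⟩,
  ⟨9, [7, 28, 50, 73, 100, 168, 194, 266, 336], 30, [80, 10], [(77, 1631089236), (9,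
    18573976176), (77, 31427413536), (11, 15138428736)], [[0, 0, 0, -2, 1, 2, 1, -1, -2, 1], [],
    [-3], [], [], [], [], [], [], [-1], [], [3], [2]]⟩,
  ⟨9, [7, 28, 50, 73, 100, 208, 322, 388], 56, [132, 66], [(86, 32318435856), (79, 14832510336),
    (87, 23429455971), (77, 31713351696)], [[0, 0, 0, 18, -10, -17, -8, 9, 17, -10, 1], [-2],
    [5], [], [], [], [], [], [1], [2], [1], [-2], [-2]]⟩,
  ⟨9, [7, 28, 50, 100, 137, 208, 289, 388], 62, [33, 132], [(53, 5640824676), (53,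
    14832510336), (53, 26935894071)], [[0, 0, 0, 18, -9, -17, -9, 8, 17, -9, 1], [-4], [], [],
    [3]]⟩,
  ⟨9, [7, 28, 50, 73, 100, 168, 194, 266, 400], 30, [144, 10], [(9, 1631081076), (40,
    642979956)], [[0, 0, 0, -3, 1, 3, 2, -1, -3, 1], [1], [-1], [1], [], [], [], [], [], [-1]]⟩,
  ⟨9, [7, 28, 50, 73, 100, 208, 322, 392], 56, [136, 66], [(53, 30938391816), (90,
    30904181061)], [[0, 0, 0, 17, -9, -16, -8, 8, 16, -9, 1], [-3], [2], [-1], [1], [], [], [],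
    [], [1]]⟩,
  ⟨9, [7, 28, 41, 50, 74, 228, 392], 75, [136], [(46, 32280814896), (46, 32213717556)], [[0, 0,
    0, 20, -9, -19, -11, 8, 19, -9, 1], [-20, 9, -1], [], [-2]]⟩,
  ⟨9, [7, 41, 50, 74, 228, 284, 386], 75, [130, 28], [(46, 32282923536)], [[0, 0, 0, -4, 1, 4,
    3, -1, -4, 1], [4, -1], [], [1]]⟩,
  ⟨9, [7, 41, 50, 100, 156, 328, 416], 70, [72, 160], [(57, 5374419846), (93, 17457164886)],
    [[0, 0, 0, 20, -9, -19, -11, 8, 19, -9, 1], [-10, 2], [], [-2], [1]]⟩,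
  ⟨9, [7, 28, 50, 100, 208, 388], 76, [132], [(78, 1918977411), (80, 4436939331), (81,
    4381488756), (42, 14832510336), (84, 5641807971), (85, 14904803616), (88, 31712416896),
    (87, 14904803616), (89, 14084887041), (91, 31709282691), (84, 27231537171), (91,
    12923799111), (92, 356984931), (48, 13159974951), (94, 27231602691)], [[0, 0, 0, 857, -659,
    -676, -220, 479, 698, -638, 180, -22, 1], [-187, 48, -3], [39, -3], [-23], [10], [], [], [],
    [2], [11], [5], [-2], [-3]]⟩,
  ⟨9, [7, 28, 41, 50, 74, 100, 208, 273, 416], 43, [160, 17], [(40, 32316346656)], [[0, 0, 0,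
    -4, 1, 4, 3, -1, -4, 1], [4, -1], [], [1]]⟩,
  ⟨9, [7, 28, 41, 50, 100, 138, 208, 328, 388], 37, [132, 72], [(10, 13495665936), (40,
    1367487606)], [[0, 0, 0, -4, 1, 4, 3, -1, -4, 1], [2], [], [1], [], [], [], [], [], [],
    [-1]]⟩,
  ⟨9, [7, 28, 41, 50, 138, 208, 356, 385], 37, [129, 100], [], [[0, 0, 0, -3, 1, 3, 2, -1, -3,
    1], [1]]⟩,
  ⟨9, [7, 41, 50, 156, 194, 356, 385], 45, [129, 100], [(46, 27719651856)], [[0, 0, 0, -4, 1, 4,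
    3, -1, -4, 1], [2], [], [1]]⟩,
  ⟨9, [7, 28, 50, 104, 161, 196], 31, [], [(96, 4414846596), (97, 14067192336), (86,
    14051340816), (79, 17203091571), (79, 5174876256), (96, 5424445056), (96, 18088265601),
    (6, 21816899586), (97, 27703923201), (96, 14618333316), (79, 30972127296), (10,
    34984064016), (6, 22572722226), (79, 1732401201), (96, 1985102721), (97, 30169113876), (10,
    23660271456), (96, 31728145536), (6, 34750215426), (5, 26427557136), (86, 27741340161), (79,
    18841151601), (79, 6177499236), (10, 22152492816), (86, 30107120916), (8, 23662457616),
    (98, 31516213776), (98, 659966001), (98, 13528143876), (98, 4904417376), (99,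
    31509977136), (98, 18581189121), (99, 18574936161), (98, 5646017076), (99, 13527685236)],
    [[0, 0, 0, 594, -525, -433, -90, 365, 454, -505, 160, -21, 1], [-48, 6], [69, -15, 1],
    [-12], [], [-1], [-3], [], [], [6], [], [-3], [-3]]⟩,
  ⟨9, [7, 28, 50, 104, 161, 196, 292], 31, [36], [(96, 4414846596), (97, 14067192336), (86,
    14051340816), (79, 17203091571), (79, 5174876256), (96, 5424445056), (96, 18088265601),
    (97, 27703923201), (96, 14618333316), (79, 30972127296), (10, 34984064016), (79,
    1732401201), (96, 1985102721), (97, 30169113876), (10, 23660271456), (96, 31728145536), (86,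
    27741340161), (79, 18841151601), (79, 6177499236), (10, 22152492816), (86, 30107120916),
    (8, 23662457616)], [[0, 0, 0, -140, 86, 124, 55, -70, -125, 85, -16, 1], [36, -6], [-16, 1],
    [9], [], [], [], [], [-1], [-6], [-3], [3], [3]]⟩,
  ⟨9, [7, 28, 41, 50, 74, 228, 336], 75, [80], [(46, 32215803156), (46, 32213717556)], [[0, 0,
    0, 20, -9, -19, -11, 8, 19, -9, 1], [-20, 9, -1], [], [-2]]⟩,
  ⟨9, [7, 41, 50, 100, 138, 208, 284], 37, [28], [(40, 595924086), (4, 18810873936), (4,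
    19145308176)], [[0, 0, 0, 19, -9, -18, -10, 8, 18, -9, 1], [-7, 1], [], [-1], [2]]⟩,
  ⟨9, [7, 28, 50, 73, 168, 194, 356], 30, [100], [(40, 642979956), (40, 17806997616), (40,
    31761569856)], [[0, 0, 0, 15, -8, -14, -7, 7, 14, -8, 1], [-3], [6, -1], [-3]]⟩,
  ⟨9, [7, 50, 100, 208, 284], 76, [28], [(102, 843147351), (103, 13009167381), (103,
    13159778391), (104, 14902714896), (103, 14870151696), (102, 30945989136)], [[0, 0, 0, 584,
    -488, -435, -116, 340, 455, -469, 148, -20, 1], [-136, 46, -4], [14, -2], [-10], [6]]⟩,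
  ⟨9, [19, 28, 37, 42, 70, 73, 496], 32, [240], [], [[], [6, -5, 1]]⟩,
  ⟨9, [7, 28, 41, 50, 228], 33, [], [(98, 32318374401), (98, 28040184321), (98, 32318435856),
    (98, 28040245776), (106, 31814992656), (99, 32315282736), (99, 28037092656), (99,
    32315213121), (99, 28037023041), (99, 32318435856), (99, 28040245776), (99, 32318227011),
    (99, 28040036931)], [[0, 0, 0, 680, -551, -517, -150, 389, 538, -531, 162, -21, 1], [-344,
    195, -35, 2], [], [-8]]⟩,
  ⟨9, [7, 28, 100], 34, [], [(49, 4414851171), (59, 392713266), (59, 4419245106), (74,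
    30945989136), (95, 14049374736), (74, 30090289731), (74, 30945989121), (95, 14049374721),
    (74, 30341947971), (49, 4414916691), (59, 391668786), (59, 4418200626), (74,
    31197647376), (95, 18075906576), (74, 30090289716), (74, 31197647361), (95, 18075906561),
    (74, 30341947956), (74, 30945927696), (95, 14065103376), (74, 30090351171), (74,
    31197585936), (95, 18091635216), (74, 30090351156), (59, 14082920706), (59, 18109452546),
    (49, 18105047136), (74, 30945927681), (95, 14065103361), (74, 30342009411), (74,
    31197585921), (95, 18091635201), (74, 30342009396), (59, 14081876226), (59, 18108408066),
    (49, 18105112656), (74, 31516275216), (95, 23140528656), (74, 30090150501), (74,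
    31516066371), (74, 30945579621), (95, 23087051331), (74, 31767933456), (95, 27167060496),
    (74, 30090150486), (100, 31767933456), (101, 31767933456), (74, 31767724611), (74,
    30945579606), (95, 27113583171), (100, 31516275216), (101, 31516275216), (74, 31516275201),
    (95, 23140528641), (74, 30341808741), (74, 31516004931), (74, 30945641061), (95,
    23102779971), (74, 31767933441), (95, 27167060481), (74, 30341808726), (100, 31197647376),
    (101, 31197647376), (74, 31767663171), (74, 30945641046), (95, 27129311811), (100,
    31197585936), (101, 31197585936), (74, 31516213776), (95, 23156257296), (74, 30090211941),
    (74, 31516066356), (74, 31197237861), (95, 23087051316), (74, 31767872016), (95,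
    27182789136), (74, 30090211926), (100, 31767872016), (101, 31767872016), (74, 31767724596),
    (74, 31197237846), (95, 27113583156), (100, 31516213776), (101, 31516213776), (59,
    23207620866), (59, 27234152706), (49, 27231721536), (74, 31516213761), (95, 23156257281),
    (74, 30341870181), (74, 31516004916), (74, 31197299301), (95, 23102779956), (74,
    31767872001), (95, 27182789121), (74, 30341870166), (100, 30945989136), (101, 30945989136),
    (74, 31767663156), (74, 31197299286), (95, 27129311796), (100, 30945927696), (101,
    30945927696), (59, 23206576386), (59, 27233108226), (49, 27231787056), (105, 27703923216),
    (105, 27650445891), (105, 27703923201), (105, 27666174531), (105, 27719651856), (105,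
    27650445876), (107, 31767872016), (105, 27719651841), (105, 27666174516), (107,
    31767933456), (105, 19149632016), (105, 19060503141), (105, 19149632001), (105,
    19076231781), (105, 19165360656), (105, 19060503126), (107, 31197585936), (105,
    19165360641), (105, 19076231766), (107, 31197647376), (105, 6264717891), (105,
    6229066341), (105, 6264717876), (105, 6244794981), (105, 6280446531), (105,
    6229066326), (107, 30341947971), (105, 6280446516), (105, 6244794966), (107,
    30342009411)], [[0, 0, 0, -351780, 422322, 141220, -13500, -220877, -197399, 374350,
    -202307, 56224, -9071, 862, -45, 1], [34164, -13266, 1788, -100, 2], [-3456, 480, -16],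
    [1080], [-864], [8], [72], [96], [-24], [-288], [-72], [], [24]]⟩,
  ⟨9, [7, 28, 100, 388], 34, [132], [(49, 4414851171), (95, 14049374736), (95, 14049374721),
    (49, 4414916691), (95, 18075906576), (95, 18075906561), (95, 14065103376), (95,
    18091635216), (49, 18105047136), (95, 14065103361), (95, 18091635201), (49, 18105112656),
    (95, 23140528656), (95, 23087051331), (95, 27167060496), (101, 31767933456), (95,
    27113583171), (101, 31516275216), (95, 23140528641), (95, 23102779971), (95, 27167060481),
    (101, 31197647376), (95, 27129311811), (101, 31197585936), (95, 23156257296), (95,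
    23087051316), (95, 27182789136), (101, 31767872016), (95, 27113583156), (101, 31516213776),
    (49, 27231721536), (95, 23156257281), (95, 23102779956), (95, 27182789121), (101,
    30945989136), (95, 27129311796), (101, 30945927696), (49, 27231787056)], [[0, 0, 0, 50672,
    -51368, -29446, -3951, 30711, 34056, -47289, 20694, -4611, 568, -37, 1], [-7872, 2608, -264,
    8], [832, -64], [-576], [288], [], [], [], [32], [192], [96], [], [-24]]⟩,
  ⟨9, [], 35, [], [(108, 4383455346), (108, 8678422641), (108, 8946858096), (108,
    4383520866), (108, 12973385841), (108, 13241821296), (108, 8678488161), (108,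
    12973451361), (108, 13510252656), (108, 8946923616), (108, 13241886816), (108,
    13510318176), (108, 4400167026), (108, 8695134321), (108, 8963569776), (108,
    4416944226), (108, 17267304561), (108, 17535740016), (108, 8711911521), (108,
    17267370081), (108, 17804171376), (108, 8980346976), (108, 17535805536), (108,
    17804236896), (108, 4400298066), (108, 12990097521), (108, 13258532976), (108,
    4417009746), (108, 17284016241), (108, 17552451696), (108, 13006874721), (108,
    17300793441), (108, 18071558256), (108, 13275310176), (108, 17569228896), (108,
    18071623776), (108, 8695265361), (108, 12990228561), (108, 13526964336), (108,
    8711977041), (108, 17284147281), (108, 17820883056), (108, 13006940241), (108,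
    17300858961), (108, 18088269936), (108, 13543741536), (108, 17837660256), (108,
    18105047136), (108, 8963700816), (108, 13258664016), (108, 13527095376), (108,
    8980412496), (108, 17552582736), (108, 17821014096), (108, 13275375696), (108,
    17569294416), (108, 18088400976), (108, 13543807056), (108, 17837725776), (108,
    18105112656), (108, 4401150066), (108, 8696117361), (108, 8964552816), (108,
    4417927266), (108, 21545494641), (108, 21813930096), (108, 8712894561), (108,
    21545560161), (108, 22082361456), (108, 8981330016), (108, 21813995616), (108,
    22082426976), (108, 4418975826), (108, 25840396401), (108, 26108831856), (108,
    30135363681), (109, 18071558256), (108, 30403799136), (109, 18071623776), (108,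
    8713943121), (108, 25840527441), (108, 26377263216), (108, 30135429201), (109,
    18088269936), (108, 30672230496), (109, 18105047136), (108, 8982378576), (108,
    26108962896), (108, 26377394256), (108, 30403864656), (109, 18088400976), (108,
    30672296016), (109, 18105112656), (108, 4401346626), (108, 12991080561), (108,
    13259516016), (108, 4418058306), (108, 21578918001), (108, 21847353456), (108,
    13007857761), (108, 21595695201), (108, 22349748336), (108, 13276293216), (108,
    21864130656), (108, 22349813856), (108, 4419041346), (108, 25857108081), (108,
    26125543536), (108, 30152075361), (109, 22349748336), (108, 30420510816), (109,
    22349813856), (108, 13008906321), (108, 25890662481), (108, 26644650096), (108,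
    30168852561), (109, 26644650096), (108, 30939617376), (109, 30939617376), (108,
    13277341776), (108, 26159097936), (108, 26644781136), (108, 30437288016), (109,
    26644781136), (108, 30939682896), (109, 30939682896), (108, 8696313921), (108,
    12991277121), (108, 13527947376), (108, 8713025601), (108, 21579114561), (108,
    22115784816), (108, 13007988801), (108, 21595826241), (108, 22383171696), (108,
    13544724576), (108, 22132562016), (108, 22399948896), (108, 8714008641), (108,
    25857304641), (108, 26393974896), (108, 30152206401), (109, 22383171696), (108,
    30688942176), (109, 22399948896), (108, 13008971841), (108, 25890728001), (108,
    26661361776), (108, 30168918081), (109, 26661361776), (108, 30956329056), (109,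
    30956329056), (108, 13545773136), (108, 26427529296), (108, 26694916176), (108,
    30705719376), (109, 26694916176), (108, 30973106256), (109, 30973106256), (108,
    8964749376), (108, 13259712576), (108, 13528143936), (108, 8981461056), (108,
    21847550016), (108, 22115981376), (108, 13276424256), (108, 21864261696), (108,
    22383368256), (108, 13544855616), (108, 22132693056), (108, 22400079936), (108,
    8982444096), (108, 26125740096), (108, 26394171456), (108, 30420641856), (109,
    22383368256), (108, 30689073216), (109, 22400079936), (108, 13277407296), (108,
    26159163456), (108, 26661558336), (108, 30437353536), (109, 26661558336), (108,
    30956460096), (109, 30956460096), (108, 13545838656), (108, 26427594816), (108,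
    26694981696), (108, 30705784896), (109, 26694981696), (108, 30973171776), (109,
    30973171776), (108, 4401350706), (108, 17285982321), (108, 17554417776), (108,
    4418062386), (108, 21579901041), (108, 21848336496), (108, 17302759521), (108,
    21596678241), (108, 22601406576), (108, 17571194976), (108, 21865113696), (108,
    22601472096), (108, 4419045426), (108, 25858091121), (108, 26126526576), (108,
    30153058401), (109, 22601406576), (108, 30421493856), (109, 22601472096), (108,
    17303808081), (108, 25891645521), (108, 26896308336), (108, 30169835601), (109,
    26896308336), (108, 31191275616), (109, 31191275616), (108, 17572243536), (108,
    26160080976), (108, 26896439376), (108, 30438271056), (109, 26896439376), (108,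
    31191341136), (109, 31191341136), (108, 21598775361), (108, 25892694081), (108,
    27164678256), (108, 30170884161), (109, 27164678256), (108, 31459645536), (109,
    31459645536), (108, 31728080976), (109, 31728080976), (108, 21867210816), (108,
    26161129536), (108, 27164874816), (108, 30439319616), (109, 27164874816), (108,
    31459776576), (109, 31459776576), (108, 31728146496), (109, 31728146496), (108,
    8696318001), (108, 17286244401), (108, 17822849136), (108, 8713029681), (108,
    21580163121), (108, 22116767856), (108, 17302956081), (108, 21596874801), (108,
    22651541616), (108, 17839626336), (108, 22133545056), (108, 22668318816), (108,
    8714012721), (108, 25858353201), (108, 26394957936), (108, 30153254961), (109,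
    22651541616), (108, 30689925216), (109, 22668318816), (108, 17303939121), (108,
    25891776561), (108, 26929731696), (108, 30169966641), (109, 26929731696), (108,
    31224698976), (109, 31224698976), (108, 17840674896), (108, 26428512336), (108,
    26963286096), (108, 30706702416), (109, 26963286096), (108, 31241476176), (109,
    31241476176), (108, 21598840881), (108, 25892759601), (108, 27181389936), (108,
    30170949681), (109, 27181389936), (108, 31476357216), (109, 31476357216), (108,
    31744792656), (109, 31744792656), (108, 22135642176), (108, 26429560896), (108,
    27231721536), (108, 30707750976), (109, 27231721536), (108, 31509911616), (109,
    31509911616), (108, 31761569856), (109, 31761569856), (108, 8964753456), (108,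
    17554679856), (108, 17823111216), (108, 8981465136), (108, 21848598576), (108,
    22117029936), (108, 17571391536), (108, 21865310256), (108, 22651803696), (108,
    17839822896), (108, 22133741616), (108, 22668515376), (108, 8982448176), (108,
    26126788656), (108, 26395220016), (108, 30421690416), (109, 22651803696), (108,
    30690121776), (109, 22668515376), (108, 17572374576), (108, 26160212016), (108,
    26929993776), (108, 30438402096), (109, 26929993776), (108, 31224895536), (109,
    31224895536), (108, 17840805936), (108, 26428643376), (108, 26963417136), (108,
    30706833456), (109, 26963417136), (108, 31241607216), (109, 31241607216), (108,
    21867276336), (108, 26161195056), (108, 27181652016), (108, 30439385136), (109,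
    27181652016), (108, 31476553776), (109, 31476553776), (108, 31744923696), (109,
    31744923696), (108, 22135707696), (108, 26429626416), (108, 27231787056), (108,
    30707816496), (109, 27231787056), (108, 31509977136), (109, 31509977136), (108,
    31761635376), (109, 31761635376), (108, 12991285281), (108, 17286248481), (108,
    18091219056), (108, 13007996961), (108, 21580167201), (108, 22385137776), (108,
    17302960161), (108, 21596878881), (108, 22652524656), (108, 18107996256), (108,
    22401914976), (108, 22669301856), (108, 13008980001), (108, 25858357281), (108,
    26663327856), (108, 30153259041), (109, 22652524656), (108, 30958295136), (109,
    22669301856), (108, 17303943201), (108, 25891780641), (108, 26930714736), (108,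
    30169970721), (109, 26930714736), (108, 31225682016), (109, 31225682016), (108,
    18109044816), (108, 26696882256), (108, 26964269136), (108, 30975072336), (109,
    26964269136), (108, 31242459216), (109, 31242459216), (108, 21598844961), (108,
    25892763681), (108, 27182372976), (108, 30170953761), (109, 27182372976), (108,
    31477340256), (109, 31477340256), (108, 31745775696), (109, 31745775696), (108,
    22404012096), (108, 26697930816), (108, 27232704576), (108, 30976120896), (109,
    27232704576), (108, 31510894656), (109, 31510894656), (108, 31762552896), (109,
    31762552896), (108, 22672447536), (108, 26966366256), (108, 27233753136), (108,
    31244556336), (109, 27233753136), (108, 31511943216), (109, 31511943216), (108,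
    31763601456), (109, 31763601456), (108, 13259720736), (108, 17554683936), (108,
    18091546656), (108, 13276432416), (108, 21848602656), (108, 22385465376), (108,
    17571395616), (108, 21865314336), (108, 22652852256), (108, 18108258336), (108,
    22402177056), (108, 22669563936), (108, 13277415456), (108, 26126792736), (108,
    26663655456), (108, 30421694496), (109, 22652852256), (108, 30958557216), (109,
    22669563936), (108, 17572378656), (108, 26160216096), (108, 26931042336), (108,
    30438406176), (109, 26931042336), (108, 31225944096), (109, 31225944096), (108,
    18109241376), (108, 26697078816), (108, 26964465696), (108, 30975268896), (109,
    26964465696), (108, 31242655776), (109, 31242655776), (108, 21867280416), (108,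
    26161199136), (108, 27182700576), (108, 30439389216), (109, 27182700576), (108,
    31477602336), (109, 31477602336), (108, 31745972256), (109, 31745972256), (108,
    22404143136), (108, 26698061856), (108, 27232835616), (108, 30976251936), (109,
    27232835616), (108, 31511025696), (109, 31511025696), (108, 31762683936), (109,
    31762683936), (108, 22672513056), (108, 26966431776), (108, 27233818656), (108,
    31244621856), (109, 27233818656), (108, 31512008736), (109, 31512008736), (108,
    31763666976), (109, 31763666976), (108, 13528156176), (108, 17823119376), (108,
    18091550736), (108, 13544867856), (108, 22117038096), (108, 22385469456), (108,
    17839831056), (108, 22133749776), (108, 22652856336), (108, 18108262416), (108,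
    22402181136), (108, 22669568016), (108, 13545850896), (108, 26395228176), (108,
    26663659536), (108, 30690129936), (109, 22652856336), (108, 30958561296), (109,
    22669568016), (108, 17840814096), (108, 26428651536), (108, 26931046416), (108,
    30706841616), (109, 26931046416), (108, 31225948176), (109, 31225948176), (108,
    18109245456), (108, 26697082896), (108, 26964469776), (108, 30975272976), (109,
    26964469776), (108, 31242659856), (109, 31242659856), (108, 22135715856), (108,
    26429634576), (108, 27182704656), (108, 30707824656), (109, 27182704656), (108,
    31477606416), (109, 31477606416), (108, 31745976336), (109, 31745976336), (108,
    22404147216), (108, 26698065936), (108, 27232839696), (108, 30976256016), (109,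
    27232839696), (108, 31511029776), (109, 31511029776), (108, 31762688016), (109,
    31762688016), (108, 22672517136), (108, 26966435856), (108, 27233822736), (108,
    31244625936), (109, 27233822736), (108, 31512012816), (109, 31512012816), (108,
    31763671056), (109, 31763671056)], [[0, 0, 0, 389304720, -588466080, -2811240, 52873326,
    237536370, 143263449, -477084077, 356715069, -141107418, 34956422, -5787888, 655284, -50392,
    2529, -75, 1], [-16193520, 6364440, -871560, 50760, -1080], [1383480, -204120, 7560],
    [-272160], [272160], [-3360], [-30240], [-40320], [], [60480], [], [], [-2520]]⟩]

theorem tableCheck_table : tableCheck 13 table := by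
  decide +kernel

section Coordinates

/-- The determinant of three vectors. -/
def det3 {R : Type*} [CommRing R] (x y z : Fin 3 → R) : R :=
  x 0 * (y 1 * z 2 - y 2 * z 1) - x 1 * (y 0 * z 2 - y 2 * z 0) + x 2 * (y 0 * z 1 - y 1 * z 0)

variable {F : Type} [Field F]

theorem det3_smul (a b c : F) (x y z : Fin 3 → F) :
    det3 (a • x) (b • y) (c • z) = a * b * c * det3 x y z := by
  simp only [det3, Pi.smul_apply, smul_eq_mul]; ring

theorem det3_swap_left (x y z : Fin 3 → F) : det3 y x z = - det3 x y z := by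
  simp only [det3]; ring

theorem det3_swap_right (x y z : Fin 3 → F) : det3 x z y = - det3 x y z := by
  simp only [det3]; ring

/-- Cramer's rule. -/
theorem det3_smul_eq (x y z w : Fin 3 → F) :
    det3 x y z • w = det3 w y z • x + det3 x w z • y + det3 x y w • z := by
  ext i
  simp only [det3, Pi.smul_apply, Pi.add_apply, smul_eq_mul]
  fin_cases i <;> simp only [Fin.zero_eta, Fin.mk_one, Fin.reduceFinMk, Fin.isValue] <;> ring

theorem linearIndependent_iff_det3 (x y z : Fin 3 → F) :
    LinearIndependent F ![x, y, z] ↔ det3 x y z ≠ 0 := by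
  have h := Matrix.linearIndependent_rows_iff_isUnit (A := Matrix.of ![x, y, z])
  rw [Matrix.isUnit_iff_isUnit_det, isUnit_iff_ne_zero, Matrix.det_fin_three] at h
  have e : (Matrix.of ![x, y, z]).row = ![x, y, z] := rfl
  rw [e] at h
  rw [h, det3]
  apply not_congr
  simp
  constructor <;> intro h <;> linear_combination h

theorem det3_map_eq_zero_iff (E : (Fin 3 → F) ≃ₗ[F] (Fin 3 → F)) (x y z : Fin 3 → F) :
    det3 (E x) (E y) (E z) = 0 ↔ det3 x y z = 0 := by
  rw [← not_iff_not, ← ne_eq, ← ne_eq, ← linearIndependent_iff_det3, ← linearIndependent_iff_det3]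
  have e : ![E x, E y, E z] = E.toLinearMap ∘ ![x, y, z] := by
    ext i; fin_cases i <;> rfl
  rw [e]
  exact E.toLinearMap.linearIndependent_iff E.ker

theorem independent_iff_det3 (p q r : ℙ F (Fin 3 → F)) :
    Projectivization.Independent ![p, q, r] ↔ det3 p.rep q.rep r.rep ≠ 0 := by
  have e : Projectivization.rep ∘ ![p, q, r] = ![p.rep, q.rep, r.rep] := by
    ext i; fin_cases i <;> rfl
  rw [Projectivization.independent_iff, e, linearIndependent_iff_det3]

theorem mem_iff_dotProduct (p l : ℙ F (Fin 3 → F)) : p ∈ l ↔ p.rep ⬝ᵥ l.rep = 0 := by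
  conv_lhs => rw [← p.mk_rep, ← l.mk_rep]
  exact Projectivization.orthogonal_mk p.rep_nonzero l.rep_nonzero

theorem col_iff_det3 (p q r : ℙ F (Fin 3 → F)) :
    Col (ℙ F (Fin 3 → F)) p q r ↔ det3 p.rep q.rep r.rep = 0 := by
  have hd : det3 p.rep q.rep r.rep = (Matrix.of ![p.rep, q.rep, r.rep]).det := by
    rw [Matrix.det_fin_three, det3]
    simp
    ring
  rw [hd, ← Matrix.exists_mulVec_eq_zero_iff]
  constructor
  · rintro ⟨l, hp, hq, hr⟩
    rw [mem_iff_dotProduct] at hp hq hr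
    refine ⟨l.rep, l.rep_nonzero, ?_⟩
    ext i
    fin_cases i
    exacts [hp, hq, hr]
  · rintro ⟨v, hv, h⟩
    obtain ⟨a, ha⟩ := Projectivization.exists_smul_eq_mk_rep F v hv
    refine ⟨Projectivization.mk F v hv, ?_, ?_, ?_⟩ <;> rw [mem_iff_dotProduct, ← ha,
      dotProduct_smul, smul_eq_zero_iff_eq]
    exacts [congrFun h 0, congrFun h 1, congrFun h 2]

theorem col_mk_iff_det3 {x y z : Fin 3 → F} (hx : x ≠ 0) (hy : y ≠ 0) (hz : z ≠ 0) :
    Col (ℙ F (Fin 3 → F)) (Projectivization.mk F x hx) (Projectivization.mk F y hy)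
      (Projectivization.mk F z hz) ↔ det3 x y z = 0 := by
  obtain ⟨a, ha⟩ := Projectivization.exists_smul_eq_mk_rep F x hx
  obtain ⟨b, hb⟩ := Projectivization.exists_smul_eq_mk_rep F y hy
  obtain ⟨c, hc⟩ := Projectivization.exists_smul_eq_mk_rep F z hz
  rw [col_iff_det3, ← ha, ← hb, ← hc]
  simp only [Units.smul_def, det3_smul]
  simp

/-- The collinear triples among the vectors `c 0, …, c (n - 1)` are those prescribed by `B`. -/
def IsPattern (n : ℕ) (B : List ℕ) (c : ℕ → Fin 3 → F) : Prop :=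
  ∀ i j k, i < n → j < n → k < n → i ≠ j → i ≠ k → j ≠ k →
    (det3 (c i) (c j) (c k) = 0 ↔ Rel B i j k)

/-- Any two of the `n` points span a line that misses a third one. -/
def Spreads (n : ℕ) (B : List ℕ) : Prop :=
  ∀ i j, i < n → j < n → i ≠ j → ∃ k < n, i ≠ k ∧ j ≠ k ∧ ¬ Rel B i j k

/-- Decides `Rel`. -/
def relB (B : List ℕ) (i j k : ℕ) : Bool :=
  B.any fun b => b.testBit i && (b.testBit j && b.testBit k)

theorem relB_iff {B : List ℕ} {i j k : ℕ} : relB B i j k = true ↔ Rel B i j k := by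
  simp [relB, Rel]

/-- Decides `Spreads`. -/
def spreadsCheck (n : ℕ) (B : List ℕ) : Bool :=
  (List.range n).all fun i => (List.range n).all fun j => Nat.beq i j ||
    (List.range n).any fun k => !Nat.beq i k && (!Nat.beq j k && !relB B i j k)

theorem spreads_of_spreadsCheck {n : ℕ} {B : List ℕ} (h : spreadsCheck n B) : Spreads n B := by
  intro i j hi hj hij
  simp only [spreadsCheck, List.all_eq_true, List.mem_range, Bool.or_eq_true, List.any_eq_true,
    Nat.beq_eq] at h
  obtain ⟨k, hk, h⟩ := (h i hi j hj).resolve_left hij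
  rw [Bool.and_eq_true, Bool.and_eq_true, not_beq_eq_true, not_beq_eq_true, Bool.not_eq_true',
    ← Bool.not_eq_true, relB_iff] at h
  exact ⟨k, hk, h⟩

theorem IsPattern.exists_det3_ne_zero {n : ℕ} {B : List ℕ} (hB : Spreads n B)
    {c : ℕ → Fin 3 → F} (hc : IsPattern n B c) {i j : ℕ} (hi : i < n) (hj : j < n) (hij : i ≠ j) :
    ∃ w, det3 (c i) (c j) w ≠ 0 := by
  obtain ⟨k, hk, hik, hjk, hr⟩ := hB i j hi hj hij
  exact ⟨c k, fun h => hr ((hc i j k hi hj hk hij hik hjk).1 h)⟩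

theorem IsPattern.ne_zero {n : ℕ} {B : List ℕ} (hn : 2 ≤ n) (hB : Spreads n B)
    {c : ℕ → Fin 3 → F} (hc : IsPattern n B c) {i : ℕ} (hi : i < n) : c i ≠ 0 := by
  obtain ⟨j, hj, hij⟩ : ∃ j < n, i ≠ j := by
    by_cases h : i = 0
    · exact ⟨1, by omega, by omega⟩
    · exact ⟨0, by omega, h⟩
  obtain ⟨w, hw⟩ := hc.exists_det3_ne_zero hB hi hj hij
  intro h
  apply hw
  simp [h, det3]

theorem isRealization_mk_iff {n : ℕ} {B : List ℕ} (hB : Spreads n B) {c : ℕ → Fin 3 → F}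
    (h0 : ∀ k, k < n → c k ≠ 0) :
    IsRealization (ℙ F (Fin 3 → F)) n B (fun k : Fin n => Projectivization.mk F (c k) (h0 k k.2)) ↔
      IsPattern n B c := by
  constructor
  · intro h i j k hi hj hk hij hik hjk
    have := h.2 ⟨i, hi⟩ ⟨j, hj⟩ ⟨k, hk⟩ (by simpa using hij) (by simpa using hik)
      (by simpa using hjk)
    rwa [col_mk_iff_det3] at this
  · intro h
    refine ⟨?_, ?_⟩
    · intro i j hij
      by_contra hne
      obtain ⟨w, hw⟩ := h.exists_det3_ne_zero hB i.2 j.2 (Fin.val_ne_of_ne hne)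
      rw [Projectivization.mk_eq_mk_iff'] at hij
      obtain ⟨a, ha⟩ := hij
      apply hw
      rw [← ha]
      simp only [det3, Pi.smul_apply, smul_eq_mul]
      ring
    · intro i j k hij hik hjk
      rw [col_mk_iff_det3]
      exact h i j k i.2 j.2 k.2 (Fin.val_ne_of_ne hij) (Fin.val_ne_of_ne hik)
        (Fin.val_ne_of_ne hjk)

theorem IsPattern.map_iff {n : ℕ} {B : List ℕ} {c : ℕ → Fin 3 → F}
    (E : (Fin 3 → F) ≃ₗ[F] (Fin 3 → F)) :
    IsPattern n B (fun k => E (c k)) ↔ IsPattern n B c := by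
  simp only [IsPattern, det3_map_eq_zero_iff]

theorem IsPattern.smul_iff {n : ℕ} {B : List ℕ} {c y : ℕ → Fin 3 → F}
    (h : ∀ k < n, ∃ a : F, a ≠ 0 ∧ y k = a • c k) : IsPattern n B y ↔ IsPattern n B c := by
  have key : ∀ i j k, i < n → j < n → k < n →
      (det3 (y i) (y j) (y k) = 0 ↔ det3 (c i) (c j) (c k) = 0) := by
    intro i j k hi hj hk
    obtain ⟨a, ha, ea⟩ := h i hi
    obtain ⟨b, hb, eb⟩ := h j hj
    obtain ⟨d, hd, ed⟩ := h k hk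
    rw [ea, eb, ed, det3_smul]
    simp [ha, hb, hd]
  constructor <;> intro hp i j k hi hj hk hij hik hjk
  · rw [← key i j k hi hj hk]; exact hp i j k hi hj hk hij hik hjk
  · rw [key i j k hi hj hk]; exact hp i j k hi hj hk hij hik hjk

theorem isPattern_of_lt {n : ℕ} {B : List ℕ} {c : ℕ → Fin 3 → F}
    (h : ∀ i j k, i < j → j < k → k < n → (det3 (c i) (c j) (c k) = 0 ↔ Rel B i j k)) :
    IsPattern n B c := by
  have sl : ∀ i j k, (det3 (c i) (c j) (c k) = 0 ↔ Rel B i j k) →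
      (det3 (c j) (c i) (c k) = 0 ↔ Rel B j i k) := fun i j k h => by
    rw [det3_swap_left, neg_eq_zero, h]
    exact ⟨Rel.swap_left, Rel.swap_left⟩
  have sr : ∀ i j k, (det3 (c i) (c j) (c k) = 0 ↔ Rel B i j k) →
      (det3 (c i) (c k) (c j) = 0 ↔ Rel B i k j) := fun i j k h => by
    rw [det3_swap_right, neg_eq_zero, h]
    exact ⟨Rel.swap_right, Rel.swap_right⟩
  intro i j k hi hj hk hij hik hjk
  rcases lt_or_gt_of_ne hij with h1 | h1 <;> rcases lt_or_gt_of_ne hik with h2 | h2 <;>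
    rcases lt_or_gt_of_ne hjk with h3 | h3
  · exact h _ _ _ h1 h3 hk
  · exact sr _ _ _ (h _ _ _ h2 h3 hj)
  · exact absurd (h1.trans h3) h2.asymm
  · exact sr _ _ _ (sl _ _ _ (h _ _ _ h2 h1 hj))
  · exact sl _ _ _ (h _ _ _ h1 h2 hk)
  · exact absurd (h3.trans h1) h2.asymm
  · exact sl _ _ _ (sr _ _ _ (h _ _ _ h3 h2 hi))
  · exact sl _ _ _ (sr _ _ _ (sl _ _ _ (h _ _ _ h3 h1 hi)))

/-- The vectors of the standard frame. -/
def stdFrame {R : Type*} [CommRing R] : ℕ → Fin 3 → R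
  | 0 => ![1, 0, 0]
  | 1 => ![0, 1, 0]
  | 2 => ![0, 0, 1]
  | _ => ![1, 1, 1]

theorem exists_linearEquiv_frame {f : Fin 4 → ℙ F (Fin 3 → F)}
    (hf : IsRealization (ℙ F (Fin 3 → F)) 4 [] f) :
    ∃ E : (Fin 3 → F) ≃ₗ[F] (Fin 3 → F), ∀ (i : Fin 4), ∃ a : F, a ≠ 0 ∧
      E (stdFrame i) = a • (f i).rep := by
  have hd : ∀ i j k : Fin 4, i ≠ j → i ≠ k → j ≠ k →
      det3 (f i).rep (f j).rep (f k).rep ≠ 0 := by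
    intro i j k hij hik hjk h
    have := (hf.2 i j k hij hik hjk).1 ((col_iff_det3 _ _ _).2 h)
    obtain ⟨b, hb, -⟩ := this
    simp at hb
  set α := det3 (f 3).rep (f 1).rep (f 2).rep with hα
  set β := det3 (f 0).rep (f 3).rep (f 2).rep with hβ
  set γ := det3 (f 0).rep (f 1).rep (f 3).rep with hγ
  have hα0 : α ≠ 0 := hd 3 1 2 (by decide) (by decide) (by decide)
  have hβ0 : β ≠ 0 := hd 0 3 2 (by decide) (by decide) (by decide)
  have hγ0 : γ ≠ 0 := hd 0 1 3 (by decide) (by decide) (by decide)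
  have h012 := hd 0 1 2 (by decide) (by decide) (by decide)
  have hli : LinearIndependent F ![α • (f 0).rep, β • (f 1).rep, γ • (f 2).rep] := by
    rw [linearIndependent_iff_det3, det3_smul]
    exact mul_ne_zero (mul_ne_zero (mul_ne_zero hα0 hβ0) hγ0) h012
  let E := (basisOfLinearIndependentOfCardEqFinrank hli (by simp)).equivFun.symm
  have hE : ∀ c, E c = c 0 • α • (f 0).rep + c 1 • β • (f 1).rep + c 2 • γ • (f 2).rep := by
    intro c
    simp only [E, Module.Basis.equivFun_symm_apply, Fin.sum_univ_three,
      coe_basisOfLinearIndependentOfCardEqFinrank]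
    rfl
  refine ⟨E, fun i => ?_⟩
  fin_cases i
  · exact ⟨α, hα0, by rw [hE]; simp [stdFrame]⟩
  · exact ⟨β, hβ0, by rw [hE]; simp [stdFrame]⟩
  · exact ⟨γ, hγ0, by rw [hE]; simp [stdFrame]⟩
  · refine ⟨_, h012, ?_⟩
    rw [hE]
    have := det3_smul_eq (f 0).rep (f 1).rep (f 2).rep (f 3).rep
    simp [stdFrame]
    rw [this]

theorem numReal_eq_mul_card {n : ℕ} (hn : 4 ≤ n) {B : List ℕ} (hB : Spreads n B)
    (h4 : ∀ i j k, i < 4 → j < 4 → k < 4 → i ≠ j → i ≠ k → j ≠ k → ¬ Rel B i j k)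
    {T : Type} (c : T → ℕ → Fin 3 → F) (hstd : ∀ t, ∀ k < 4, c t k = stdFrame k)
    (Q : T → Prop) (hQ : ∀ t, Q t → IsPattern n B (c t))
    (hinj : ∀ t t', Q t → Q t' → (∀ k < n, ∃ a : F, a ≠ 0 ∧ c t k = a • c t' k) → t = t')
    (hsurj : ∀ y : ℕ → Fin 3 → F, IsPattern n B y →
      (∀ k < 4, ∃ a : F, a ≠ 0 ∧ y k = a • stdFrame k) →
      ∃ t, Q t ∧ ∀ k < n, ∃ a : F, a ≠ 0 ∧ y k = a • c t k) :
    numReal (ℙ F (Fin 3 → F)) (ℙ F (Fin 3 → F)) n B =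
      numReal (ℙ F (Fin 3 → F)) (ℙ F (Fin 3 → F)) 4 [] * Nat.card {t // Q t} := by
  rw [numReal, numReal, ← Nat.card_prod]
  symm
  choose E hE using fun f : {f : Fin 4 → ℙ F (Fin 3 → F) //
    IsRealization (ℙ F (Fin 3 → F)) 4 [] f} => exists_linearEquiv_frame f.2
  have h0 : ∀ f t, Q t → ∀ k < n, E f (c t k) ≠ 0 := by
    intro f t ht k hk
    rw [ne_eq, LinearEquiv.map_eq_zero_iff]
    exact (hQ t ht).ne_zero (by omega) hB hk
  have hframe : ∀ f t (ht : Q t) (i : Fin 4),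
      Projectivization.mk F (E f (c t i)) (h0 f t ht i (by omega)) = f.1 i := by
    intro f t ht i
    obtain ⟨a, ha, e⟩ := hE f i
    conv_rhs => rw [← (f.1 i).mk_rep]
    rw [Projectivization.mk_eq_mk_iff']
    exact ⟨a, by rw [hstd t i i.2, e]⟩
  refine Nat.card_congr (Equiv.ofBijective (fun u =>
    ⟨fun k : Fin n => Projectivization.mk F (E u.1 (c u.2.1 k)) (h0 u.1 u.2.1 u.2.2 k k.2),
      (isRealization_mk_iff hB (c := fun k => E u.1 (c u.2.1 k)) (h0 u.1 u.2.1 u.2.2)).2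
        ((IsPattern.map_iff _).2 (hQ _ u.2.2))⟩) ⟨?_, ?_⟩)
  · rintro ⟨f, t, ht⟩ ⟨f', t', ht'⟩ h
    rw [Subtype.mk.injEq] at h
    have hk := fun k : Fin n => congrFun h k
    simp only at hk
    have hf : f = f' := by
      apply Subtype.ext
      funext i
      rw [← hframe f t ht i, ← hframe f' t' ht' i]
      exact hk ⟨i, by omega⟩
    subst hf
    have ht : t = t' := by
      refine hinj t t' ht ht' fun k hkn => ?_
      have := hk ⟨k, hkn⟩
      rw [Projectivization.mk_eq_mk_iff] at this
      obtain ⟨a, ha⟩ := this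
      refine ⟨a, a.ne_zero, (E f).injective ?_⟩
      rw [map_smul, ← ha]
      rfl
    subst ht
    rfl
  · rintro ⟨r, hr⟩
    let f : {f : Fin 4 → ℙ F (Fin 3 → F) // IsRealization (ℙ F (Fin 3 → F)) 4 [] f} :=
      ⟨fun i => r ⟨i, by omega⟩, by
        refine ⟨fun i j hij => ?_, fun i j k hij hik hjk => ?_⟩
        · have := hr.1 hij
          rw [Fin.mk.injEq] at this
          exact Fin.ext this
        · rw [hr.2 _ _ _ (by simpa [Fin.ext_iff] using hij) (by simpa [Fin.ext_iff] using hik)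
            (by simpa [Fin.ext_iff] using hjk)]
          refine iff_of_false (h4 i j k i.2 j.2 k.2 (Fin.val_ne_of_ne hij) (Fin.val_ne_of_ne hik)
            (Fin.val_ne_of_ne hjk)) ?_
          rintro ⟨b, hb, -⟩
          simp at hb⟩
    let y : ℕ → Fin 3 → F := fun k =>
      if h : k < n then (E f).symm (r ⟨k, h⟩).rep else 0
    have hy : ∀ k (h : k < n), y k = (E f).symm (r ⟨k, h⟩).rep := fun k h => dif_pos h
    have hEy : ∀ k (h : k < n), E f (y k) = (r ⟨k, h⟩).rep := fun k h => by
      rw [hy k h, LinearEquiv.apply_symm_apply]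
    have hyp : IsPattern n B y := by
      rw [← IsPattern.map_iff (E f)]
      have h0' : ∀ k < n, E f (y k) ≠ 0 := fun k hk => by
        rw [hEy k hk]; exact Projectivization.rep_nonzero _
      rw [← isRealization_mk_iff hB h0']
      convert hr using 2 with k
      conv_rhs => rw [← (r k).mk_rep]
      congr 1
      exact hEy k k.2
    obtain ⟨t, ht, hyt⟩ := hsurj y hyp (by
      intro k hk
      obtain ⟨a, ha, e⟩ := hE f ⟨k, hk⟩
      refine ⟨a⁻¹, inv_ne_zero ha, (E f).injective ?_⟩
      rw [hEy k (by omega), map_smul, e, smul_smul, inv_mul_cancel₀ ha, one_smul])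
    refine ⟨(f, ⟨t, ht⟩), Subtype.ext (funext fun k => ?_)⟩
    obtain ⟨a, ha, e⟩ := hyt k k.2
    simp only
    conv_rhs => rw [← (r k).mk_rep]
    rw [Projectivization.mk_eq_mk_iff']
    refine ⟨a⁻¹, ?_⟩
    have := hEy k k.2
    rw [e, map_smul] at this
    rw [← this, smul_smul, inv_mul_cancel₀ ha, one_smul]

end Coordinates

section BivariatePolynomials

/-- The product of two bivariate polynomials, lists of polynomials in the first variable. -/
def bmul : List (List ℤ) → List (List ℤ) → List (List ℤ)
  | [], _ => []
  | p :: P, Q => vadd (Q.map (pmul p)) ([] :: bmul P Q)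

/-- The difference of two bivariate polynomials. -/
def bsub (P Q : List (List ℤ)) : List (List ℤ) := vadd P (Q.map (List.map (-1 * ·)))

/-- The value of a bivariate polynomial. -/
def beval {R : Type*} [CommRing R] (s t : R) : List (List ℤ) → R
  | [] => 0
  | p :: P => peval s p + t * beval s t P

/-- Whether all coefficients vanish. -/
def bzero (P : List (List ℤ)) : Bool := P.all fun p => p.all fun a => decide (a = 0)

variable {R : Type*} [CommRing R] (s t : R)

theorem beval_vadd (P Q : List (List ℤ)) :
    beval s t (vadd P Q) = beval s t P + beval s t Q := by
  fun_induction vadd P Q with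
  | case1 Q => simp [beval]
  | case2 P => simp [beval]
  | case3 p P q Q ih => simp only [beval, peval_padd, ih]; ring

theorem beval_map_pmul (p : List ℤ) (Q : List (List ℤ)) :
    beval s t (Q.map (pmul p)) = peval s p * beval s t Q := by
  induction Q with
  | nil => simp [beval]
  | cons q Q ih => simp only [List.map_cons, beval, peval_pmul, ih]; ring

theorem beval_bmul (P Q : List (List ℤ)) :
    beval s t (bmul P Q) = beval s t P * beval s t Q := by
  induction P with
  | nil => simp [beval, bmul]
  | cons p P ih => simp only [bmul, beval_vadd, beval_map_pmul, beval, ih, peval]; ring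

theorem beval_bsub (P Q : List (List ℤ)) :
    beval s t (bsub P Q) = beval s t P - beval s t Q := by
  have h : beval s t (Q.map (List.map (-1 * ·))) = - beval s t Q := by
    induction Q with
    | nil => simp [beval]
    | cons q Q ih => simp only [List.map_cons, beval, peval_map_mul, ih]; push_cast; ring
  rw [bsub, beval_vadd, h, sub_eq_add_neg]

theorem beval_eq_zero {P : List (List ℤ)} (h : bzero P) : beval s t P = 0 := by
  induction P with
  | nil => rfl
  | cons p P ih =>
    simp only [bzero, List.all_cons, Bool.and_eq_true] at h
    rw [beval, peval_eq_zero s h.1, ih h.2]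
    ring

theorem beval_eq {P Q : List (List ℤ)} (h : bzero (bsub P Q)) : beval s t P = beval s t Q := by
  rw [← sub_eq_zero, ← beval_bsub, beval_eq_zero s t h]

end BivariatePolynomials

/-- A vector with bivariate polynomial entries. -/
abbrev PolyVec : Type := List (List ℤ) × List (List ℤ) × List (List ℤ)

section PolyVec

/-- The determinant of three vectors of bivariate polynomials. -/
def bdet (p q r : PolyVec) : List (List ℤ) :=
  vadd (bmul p.1 (bsub (bmul q.2.1 r.2.2) (bmul q.2.2 r.2.1)))
    (vadd (bmul p.2.1 (bsub (bmul q.2.2 r.1) (bmul q.1 r.2.2)))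
      (bmul p.2.2 (bsub (bmul q.1 r.2.1) (bmul q.2.1 r.1))))

/-- Whether `A • p = B • q + C • r`. -/
def combCheck (A B C : List (List ℤ)) (p q r : PolyVec) : Bool :=
  bzero (bsub (bmul A p.1) (vadd (bmul B q.1) (bmul C r.1))) &&
  (bzero (bsub (bmul A p.2.1) (vadd (bmul B q.2.1) (bmul C r.2.1))) &&
    bzero (bsub (bmul A p.2.2) (vadd (bmul B q.2.2) (bmul C r.2.2))))

variable {R : Type*} [CommRing R] (s t : R)

/-- The value of a vector of bivariate polynomials. -/
def veceval (p : PolyVec) : Fin 3 → R := ![beval s t p.1, beval s t p.2.1, beval s t p.2.2]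

theorem det3_veceval (p q r : PolyVec) :
    det3 (veceval s t p) (veceval s t q) (veceval s t r) = beval s t (bdet p q r) := by
  simp only [det3, veceval, bdet, beval_vadd, beval_bmul, beval_bsub]
  simp
  ring

theorem eq_of_combCheck {A B C : List (List ℤ)} {p q r : PolyVec} (h : combCheck A B C p q r) :
    beval s t A • veceval s t p = beval s t B • veceval s t q + beval s t C • veceval s t r := by
  simp only [combCheck, Bool.and_eq_true] at h
  have h1 := beval_eq s t h.1
  have h2 := beval_eq s t h.2.1
  have h3 := beval_eq s t h.2.2
  simp only [beval_vadd, beval_bmul] at h1 h2 h3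
  ext i
  fin_cases i
  exacts [h1, h2, h3]

end PolyVec

/-- The parametrized construction of a collinearity pattern from the standard frame.
First come one or two points chosen freely on lines joining frame points, then points of
intersection of two lines joining earlier points. -/
structure Construction where
  n : ℕ
  lines : List ℕ
  free : List (ℕ × ℕ)
  meets : List ((ℕ × ℕ) × (ℕ × ℕ) × List (List ℤ))
  pts : List PolyVec
  zeros : List (List (List ℤ))
  units : List (List (List ℤ))

namespace Construction

/-- The `k`-th point of a construction. -/
def pt (C : Construction) (k : ℕ) : PolyVec :=
  (([[1]], [], []) :: ([], [[1]], []) :: ([], [], [[1]]) :: ([[1]], [[1]], [[1]]) :: C.pts).getD k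
    ([], [], [])

/-- The coordinate of the `i`-th free point. -/
def param : ℕ → List (List ℤ)
  | 0 => [[0, 1]]
  | _ => [[], [1]]

/-- Whether no three points of the frame are related. -/
def frameCheck (C : Construction) : Bool :=
  (List.range 4).all fun i => (List.range 4).all fun j => (List.range 4).all fun k =>
    Nat.beq i j || (Nat.beq i k || (Nat.beq j k || !relB C.lines i j k))

/-- Whether the `i`-th free point lies on the line prescribed. -/
def freeCheck (C : Construction) (i : ℕ) : Bool :=
  let u := C.free.getD i (0, 0)
  Nat.blt u.1 4 && (Nat.blt u.2 4 && (!Nat.beq u.1 u.2 && (relB C.lines u.1 u.2 (4 + i) &&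
    ((List.range 4).any (fun e => !Nat.beq u.1 e && (!Nat.beq u.2 e &&
      !relB C.lines (4 + i) u.2 e)) &&
    combCheck [[1]] [[1]] (param i) (C.pt (4 + i)) (C.pt u.1) (C.pt u.2)))))

/-- Whether the `i`-th point of intersection is on the two lines prescribed. -/
def meetCheck (C : Construction) (i : ℕ) : Bool :=
  let u := C.meets.getD i ((0, 0), (0, 0), [])
  let k := 4 + C.free.length + i
  Nat.blt u.1.1 k && (Nat.blt u.1.2 k && (Nat.blt u.2.1.1 k && (Nat.blt u.2.1.2 k &&
    (!Nat.beq u.1.1 u.1.2 && (!Nat.beq u.1.1 u.2.1.1 && (!Nat.beq u.1.2 u.2.1.1 &&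
    (!Nat.beq u.1.1 u.2.1.2 && (!Nat.beq u.2.1.1 u.2.1.2 && (relB C.lines u.1.1 u.1.2 k &&
    (relB C.lines u.2.1.1 u.2.1.2 k && (!relB C.lines u.1.1 u.1.2 u.2.1.1 &&
    (!relB C.lines u.1.1 u.2.1.1 u.2.1.2 &&
    combCheck u.2.2 (bdet (C.pt u.1.1) (C.pt u.1.2) (C.pt u.2.1.1))
      (bsub [] (bdet (C.pt u.1.1) (C.pt u.1.2) (C.pt u.2.1.2))) (C.pt k) (C.pt u.2.1.2)
      (C.pt u.2.1.1)))))))))))))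

/-- Whether two polynomials agree up to sign. -/
def eqUpToSign (P Q : List (List ℤ)) : Bool := bzero (bsub P Q) || bzero (vadd P Q)

/-- Whether all determinants are among the conditions listed. -/
def detCheck (C : Construction) : Bool :=
  (List.range C.n).all fun k => (List.range k).all fun j => (List.range j).all fun i =>
    (cond (relB C.lines i j k) C.zeros C.units).any
      (eqUpToSign (bdet (C.pt i) (C.pt j) (C.pt k)))

/-- Whether the polynomial `P` is a determinant, of a related triple for `b = true`. -/
def condCheck (C : Construction) (b : Bool) (P : List (List ℤ)) : Bool :=
  (List.range C.n).any fun k => (List.range k).any fun j => (List.range j).any fun i =>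
    relB C.lines i j k == b && eqUpToSign (bdet (C.pt i) (C.pt j) (C.pt k)) P

/-- Whether a construction describes all realizations of its collinearity pattern. -/
def check (C : Construction) : Bool :=
  Nat.beq C.n (4 + C.free.length + C.meets.length) && (Nat.ble C.free.length 2 &&
    (spreadsCheck C.n C.lines && (C.frameCheck &&
    ((List.range C.free.length).all C.freeCheck && ((List.range C.meets.length).all C.meetCheck &&
    (C.detCheck && (C.zeros.all (C.condCheck true) && C.units.all (C.condCheck false))))))))

/-- The pairs of parameters for which the construction yields a realization. -/
def Admits {R : Type*} [CommRing R] (C : Construction) (v : R × R) : Prop :=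
  (C.free.length < 1 → v.1 = 0) ∧ (C.free.length < 2 → v.2 = 0) ∧
    (∀ P ∈ C.zeros, beval v.1 v.2 P = 0) ∧ ∀ P ∈ C.units, beval v.1 v.2 P ≠ 0

theorem eq_zero_iff_of_eqUpToSign {R : Type*} [CommRing R] (s t : R) {P Q : List (List ℤ)}
    (h : eqUpToSign P Q) : beval s t P = 0 ↔ beval s t Q = 0 := by
  rw [eqUpToSign, Bool.or_eq_true] at h
  rcases h with h | h
  · rw [beval_eq s t h]
  · have := beval_eq_zero s t h
    rw [beval_vadd] at this
    constructor <;> intro h0 <;> rw [h0] at this <;> simpa using this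

variable {F : Type} [Field F]

/-- The point of a construction given by values of the parameters. -/
def vec (C : Construction) (v : F × F) (k : ℕ) : Fin 3 → F := veceval v.1 v.2 (C.pt k)

theorem vec_eq_stdFrame (C : Construction) (v : F × F) {k : ℕ} (hk : k < 4) :
    C.vec v k = stdFrame k := by
  interval_cases k <;> simp [vec, pt, veceval, stdFrame, beval, peval]

theorem isPattern_iff (C : Construction) (h1 : C.detCheck)
    (h2 : C.zeros.all (C.condCheck true)) (h3 : C.units.all (C.condCheck false)) (v : F × F) :
    IsPattern C.n C.lines (C.vec v) ↔
      (∀ P ∈ C.zeros, beval v.1 v.2 P = 0) ∧ ∀ P ∈ C.units, beval v.1 v.2 P ≠ 0 := by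
  constructor
  · intro h
    have key : ∀ b P, C.condCheck b P → ((beval v.1 v.2 P = 0) ↔ b = true) := by
      intro b P hP
      simp only [condCheck, List.any_eq_true, List.mem_range, Bool.and_eq_true, beq_iff_eq] at hP
      obtain ⟨k, hk, j, hj, i, hi, rfl, e⟩ := hP
      rw [← eq_zero_iff_of_eqUpToSign v.1 v.2 e, ← det3_veceval, relB_iff]
      exact h i j k (by omega) (by omega) hk (by omega) (by omega) (by omega)
    rw [List.all_eq_true] at h2 h3
    exact ⟨fun P hP => (key _ P (h2 P hP)).2 rfl, fun P hP h0 => by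
      simpa using (key _ P (h3 P hP)).1 h0⟩
  · rintro ⟨hz, hu⟩
    apply isPattern_of_lt
    intro i j k hij hjk hk
    simp only [detCheck, List.all_eq_true, List.mem_range] at h1
    have h := h1 k hk j hjk i hij
    rw [List.any_eq_true] at h
    obtain ⟨P, hP, e⟩ := h
    rw [vec, vec, vec, det3_veceval, eq_zero_iff_of_eqUpToSign v.1 v.2 e, ← relB_iff]
    cases hr : relB C.lines i j k
    · rw [hr] at hP
      simpa using hu P hP
    · rw [hr] at hP
      simpa using hz P hP

theorem vec_free {C : Construction} {i : ℕ} (h : C.freeCheck i) :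
    ∃ a b e, a < 4 ∧ b < 4 ∧ e < 4 ∧ a ≠ b ∧ a ≠ e ∧ b ≠ e ∧ Rel C.lines a b (4 + i) ∧
      ¬ Rel C.lines (4 + i) b e ∧
      ∀ v : F × F, C.vec v (4 + i) = stdFrame a + beval v.1 v.2 (param i) • stdFrame b := by
  simp only [freeCheck, Bool.and_eq_true, List.any_eq_true, List.mem_range, relB_iff,
    Nat.beq_eq, Nat.blt_eq, Bool.not_eq_true', ← Bool.not_eq_true] at h
  obtain ⟨ha, hb, hab, hr, ⟨e, he, hae, hbe, hn⟩, hc⟩ := h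
  refine ⟨_, _, e, ha, hb, he, hab, hae, hbe, hr, hn, fun v => ?_⟩
  have := eq_of_combCheck v.1 v.2 hc
  have h1 : beval v.1 v.2 [[1]] = (1 : F) := by simp [beval, peval]
  rw [h1, one_smul, one_smul] at this
  rw [vec, this, ← vec_eq_stdFrame C v ha, ← vec_eq_stdFrame C v hb]
  rfl

theorem frame_not_rel {C : Construction} (h : C.frameCheck) {i j k : ℕ} (hi : i < 4) (hj : j < 4)
    (hk : k < 4) (hij : i ≠ j) (hik : i ≠ k) (hjk : j ≠ k) : ¬ Rel C.lines i j k := by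
  simp only [frameCheck, List.all_eq_true, List.mem_range, Bool.or_eq_true, Nat.beq_eq] at h
  have := ((h i hi j hj k hk).resolve_left hij).resolve_left hik
  rw [← relB_iff]
  simpa using this.resolve_left hjk

/-- A point on the line joining `x` and `y`, other than `y`. -/
theorem exists_smul_add {x y z w : Fin 3 → F} (h0 : det3 x y w = 0) (h1 : det3 w y z ≠ 0)
    (h2 : det3 x y z ≠ 0) {x' y' : Fin 3 → F} {a b : F} (ha : a ≠ 0) (hx : x = a • x')
    (hy : y = b • y') : ∃ τ μ : F, μ ≠ 0 ∧ w = μ • (x' + τ • y') := by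
  have h := det3_smul_eq x y z w
  rw [h0, zero_smul, add_zero] at h
  refine ⟨det3 x w z * b / (det3 w y z * a), det3 w y z * a / det3 x y z,
    div_ne_zero (mul_ne_zero h1 ha) h2, ?_⟩
  ext i
  have hi := congrFun h i
  simp only [hx, hy, Pi.add_apply, Pi.smul_apply, smul_eq_mul] at hi h1 h2 ⊢
  field_simp
  linear_combination hi

/-- The point of intersection of two lines. -/
theorem exists_smul_of_meet {x y z w u : Fin 3 → F} (h1 : det3 x y u = 0) (h2 : det3 z w u = 0)
    (h3 : det3 x y z ≠ 0) (h4 : det3 x z w ≠ 0) (hu : u ≠ 0) {x' y' z' w' u' : Fin 3 → F}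
    {a b c d e : F} (hx : x = a • x') (hy : y = b • y') (hz : z = c • z') (hw : w = d • w')
    (he : e • u' = det3 x' y' z' • w' + (- det3 x' y' w') • z') :
    ∃ μ : F, μ ≠ 0 ∧ u = μ • u' := by
  have key : ∀ i, det3 x y z * det3 x z w * u i = det3 x z u * (det3 x y z * w i -
      det3 x y w * z i) := by
    intro i
    have hi := congrFun (det3_smul_eq x z w u) i
    have hp : det3 x y z * det3 x u w + det3 x z u * det3 x y w = det3 x z w * det3 x y u := by
      simp only [det3]; ring
    have h2' : det3 u z w = 0 := by
      rw [← h2]; simp only [det3]; ring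
    simp only [h2', zero_smul, zero_add, Pi.add_apply, Pi.smul_apply, smul_eq_mul] at hi
    linear_combination det3 x y z * hi + z i * hp + z i * det3 x z w * h1
  have key' : (det3 x y z * det3 x z w) • u = (det3 x z u * (a * b * c * d * e)) • u' := by
    ext i
    have hi := congrFun he i
    have ki := key i
    have e1 : det3 x y z = a * b * c * det3 x' y' z' := by rw [hx, hy, hz, det3_smul]
    have e2 : det3 x y w = a * b * d * det3 x' y' w' := by rw [hx, hy, hw, det3_smul]
    have e3 : w i = d * w' i := by rw [hw]; rfl
    have e4 : z i = c * z' i := by rw [hz]; rfl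
    simp only [Pi.add_apply, Pi.smul_apply, smul_eq_mul] at hi ⊢
    rw [ki, e1, e2, e3, e4]
    linear_combination -(det3 x z u * (a * b * c * d)) * hi
  have hne : det3 x y z * det3 x z w ≠ 0 := mul_ne_zero h3 h4
  refine ⟨(det3 x y z * det3 x z w)⁻¹ * (det3 x z u * (a * b * c * d * e)), ?_, ?_⟩
  · intro h0
    rw [mul_eq_zero, or_iff_right (inv_ne_zero hne)] at h0
    rw [h0, zero_smul, smul_eq_zero, or_iff_right hne] at key'
    exact hu key'
  · rw [mul_smul, ← key', smul_smul, inv_mul_cancel₀ hne, one_smul]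

theorem vec_meet {C : Construction} {i : ℕ} (h : C.meetCheck i) (hi : i < C.meets.length)
    (hn : 4 + C.free.length + C.meets.length = C.n) (hs : Spreads C.n C.lines)
    {y : ℕ → Fin 3 → F} (hy : IsPattern C.n C.lines y) {v : F × F}
    (ih : ∀ k < 4 + C.free.length + i, ∃ a : F, a ≠ 0 ∧ y k = a • C.vec v k) :
    ∃ a : F, a ≠ 0 ∧ y (4 + C.free.length + i) = a • C.vec v (4 + C.free.length + i) := by
  simp only [meetCheck, Bool.and_eq_true, relB_iff, Nat.beq_eq, Nat.blt_eq, Bool.not_eq_true',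
    ← Bool.not_eq_true] at h
  obtain ⟨ha, hb, hc, hd, hab, hac, hbc, had, hcd, r1, r2, r3, r4, hcomb⟩ := h
  obtain ⟨a, -, ea⟩ := ih _ ha
  obtain ⟨b, -, eb⟩ := ih _ hb
  obtain ⟨c, -, ec⟩ := ih _ hc
  obtain ⟨d, -, ed⟩ := ih _ hd
  have he := eq_of_combCheck v.1 v.2 hcomb
  rw [beval_bsub, ← det3_veceval, ← det3_veceval, beval, zero_sub] at he
  refine exists_smul_of_meet ?_ ?_ ?_ ?_ ?_ ea eb ec ed he
  · exact (hy _ _ _ (by omega) (by omega) (by omega) hab (by omega) (by omega)).2 r1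
  · exact (hy _ _ _ (by omega) (by omega) (by omega) hcd (by omega) (by omega)).2 r2
  · exact fun h => r3 ((hy _ _ _ (by omega) (by omega) (by omega) hab hac hbc).1 h)
  · exact fun h => r4 ((hy _ _ _ (by omega) (by omega) (by omega) hac had hcd).1 h)
  · exact hy.ne_zero (by omega) hs (by omega)

theorem beval_param_zero (v : F × F) : beval v.1 v.2 (param 0) = v.1 := by
  simp [param, beval, peval]

theorem beval_param_one (v : F × F) : beval v.1 v.2 (param 1) = v.2 := by
  simp [param, beval, peval]

theorem numReal_eq {C : Construction} (h : C.check) :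
    numReal (ℙ F (Fin 3 → F)) (ℙ F (Fin 3 → F)) C.n C.lines =
      numReal (ℙ F (Fin 3 → F)) (ℙ F (Fin 3 → F)) 4 [] * Nat.card {v : F × F // C.Admits v} := by
  simp only [check, Bool.and_eq_true, Nat.beq_eq, Nat.ble_eq] at h
  obtain ⟨hn, hf2, hs, hframe, hfree, hmeet, hdet, hz, hu⟩ := h
  replace hs := spreads_of_spreadsCheck hs
  rw [List.all_eq_true] at hfree hmeet
  simp only [List.mem_range] at hfree hmeet
  refine numReal_eq_mul_card (by omega) hs (fun i j k => frame_not_rel hframe) C.vec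
    (fun v k hk => vec_eq_stdFrame C v hk) C.Admits
    (fun v hv => (C.isPattern_iff hdet hz hu v).2 hv.2.2) ?_ ?_
  · intro v v' hv hv' hvv'
    have key : ∀ i < C.free.length, beval v.1 v.2 (param i) = beval v'.1 v'.2 (param i) := by
      intro i hi
      obtain ⟨a, b, e, ha, hb, he, hab, hae, hbe, -, -, hvec⟩ := vec_free (F := F) (hfree i hi)
      obtain ⟨μ, -, h⟩ := hvv' (4 + i) (by omega)
      have hp := (C.isPattern_iff hdet hz hu v).2 hv.2.2
      have hd : det3 (stdFrame a) (stdFrame b) (stdFrame e : Fin 3 → F) ≠ 0 := by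
        rw [← vec_eq_stdFrame C v ha, ← vec_eq_stdFrame C v hb, ← vec_eq_stdFrame C v he]
        intro h0
        exact frame_not_rel hframe ha hb he hab hae hbe
          ((hp a b e (by omega) (by omega) (by omega) hab hae hbe).1 h0)
      rw [hvec, hvec] at h
      have h0 := congrFun h 0
      have h1 := congrFun h 1
      have h2 := congrFun h 2
      simp only [Pi.add_apply, Pi.smul_apply, smul_eq_mul] at h0 h1 h2
      set σ := beval v.1 v.2 (param i)
      set τ := beval v'.1 v'.2 (param i)
      generalize (stdFrame a : Fin 3 → F) = x at *
      generalize (stdFrame b : Fin 3 → F) = y at *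
      generalize (stdFrame e : Fin 3 → F) = z at *
      have e1 : det3 x y z * (1 - μ) = 0 := by
        simp only [det3]
        linear_combination h0 * (y 1 * z 2 - y 2 * z 1) - h1 * (y 0 * z 2 - y 2 * z 0) +
          h2 * (y 0 * z 1 - y 1 * z 0)
      have e2 : det3 x y z * (σ - μ * τ) = 0 := by
        simp only [det3]
        linear_combination -h0 * (x 1 * z 2 - x 2 * z 1) + h1 * (x 0 * z 2 - x 2 * z 0) -
          h2 * (x 0 * z 1 - x 1 * z 0)
      have e1 := (mul_eq_zero.1 e1).resolve_left hd
      have e2 := (mul_eq_zero.1 e2).resolve_left hd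
      linear_combination e2 - τ * e1
    refine Prod.ext ?_ ?_
    · by_cases h : C.free.length < 1
      · rw [hv.1 h, hv'.1 h]
      · simpa only [beval_param_zero] using key 0 (by omega)
    · by_cases h : C.free.length < 2
      · rw [hv.2.1 h, hv'.2.1 h]
      · simpa only [beval_param_one] using key 1 (by omega)
  · intro y hy hstd
    have hτ : ∀ i, ∃ τ : F, (C.free.length ≤ i → τ = 0) ∧ (i < C.free.length →
        ∀ v : F × F, beval v.1 v.2 (param i) = τ → ∃ a : F, a ≠ 0 ∧
          y (4 + i) = a • C.vec v (4 + i)) := by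
      intro i
      by_cases hi : i < C.free.length
      swap
      · exact ⟨0, fun _ => rfl, fun h => absurd h hi⟩
      obtain ⟨a, b, e, ha, hb, he, hab, hae, hbe, hr, hr', hvec⟩ := vec_free (F := F) (hfree i hi)
      obtain ⟨α, hα, ea⟩ := hstd a ha
      obtain ⟨β, -, eb⟩ := hstd b hb
      obtain ⟨τ, μ, hμ, h⟩ := exists_smul_add (w := y (4 + i)) (z := y e)
        ((hy a b (4 + i) (by omega) (by omega) (by omega) hab (by omega) (by omega)).2 hr)
        (fun h => hr' ((hy (4 + i) b e (by omega) (by omega) (by omega) (by omega) (by omega)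
          hbe).1 h))
        (fun h => frame_not_rel hframe ha hb he hab hae hbe
          ((hy a b e (by omega) (by omega) (by omega) hab hae hbe).1 h)) hα ea eb
      refine ⟨τ, fun h => absurd hi (by omega), fun _ v hv => ⟨μ, hμ, ?_⟩⟩
      rw [hvec, hv, h]
    obtain ⟨s, hs0, hs1⟩ := hτ 0
    obtain ⟨t, ht0, ht1⟩ := hτ 1
    have key : ∀ k < C.n, ∃ a : F, a ≠ 0 ∧ y k = a • C.vec (s, t) k := by
      intro k
      induction k using Nat.strong_induction_on with
      | _ k ih =>
        intro hk
        by_cases h4 : k < 4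
        · rw [vec_eq_stdFrame C _ h4]
          exact hstd k h4
        by_cases hkf : k < 4 + C.free.length
        · obtain rfl | rfl : k = 4 + 0 ∨ k = 4 + 1 := by omega
          · exact hs1 (by omega) _ (beval_param_zero _)
          · exact ht1 (by omega) _ (beval_param_one _)
        · obtain ⟨i, rfl⟩ : ∃ i, k = 4 + C.free.length + i := ⟨k - (4 + C.free.length), by omega⟩
          exact vec_meet (hmeet i (by omega)) (by omega) hn.symm hs hy
            fun j hj => ih j hj (by omega)
    refine ⟨(s, t), ⟨fun h => hs0 (by omega), fun h => ht0 (by omega), ?_⟩, key⟩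
    rw [← C.isPattern_iff hdet hz hu, ← IsPattern.smul_iff key]
    exact hy

/-- The Fano plane. -/
def fano : Construction where
  n := 7
  lines := [19, 28, 37, 42, 70, 73, 112]
  free := []
  meets := [((0, 1), (2, 3), [[-1]]), ((0, 2), (1, 3), [[-1]]), ((1, 2), (4, 5), [[-1]])]
  pts := [([[-1]], [[-1]], []), ([[1]], [], [[1]]), ([], [[-1]], [[1]])]
  zeros := [[], [[2]]]
  units := [[[1]]]

/-- The Möbius–Kantor configuration. -/
def moebiusKantor : Construction where
  n := 8
  lines := [28, 37, 42, 67, 112, 134, 145, 200]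
  free := [(3, 2)]
  meets := [((0, 2), (1, 3), [[-1]]), ((0, 1), (4, 5), [[-1]]), ((1, 2), (0, 4), [[-1]])]
  pts := [([[1]], [[1]], [[1, 1]]), ([[1]], [], [[1]]), ([[0, -1]], [[1]], []), ([], [[-1]], [[-1,
    -1]])]
  zeros := [[], [[1, 1, 1]]]
  units := [[[1]], [[1, 1]], [[0, 1]], [[0, 1, 1]]]

/-- A configuration realizable in characteristic three. -/
def ternary : Construction where
  n := 9
  lines := [21, 26, 41, 67, 166, 200, 268, 368, 385]
  free := []
  meets := [((1, 3), (0, 2), [[-1]]), ((0, 3), (1, 2), [[-1]]), ((0, 1), (4, 5), [[-1]]), ((3, 6),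
    (1, 2), [[-1]]), ((2, 3), (4, 5), [[-1]])]
  pts := [([[-1]], [], [[-1]]), ([], [[1]], [[1]]), ([[-1]], [[1]], []), ([], [[2]], [[1]]),
    ([[-1]], [[-1]], [[-2]])]
  zeros := [[], [[3]]]
  units := [[[1]], [[2]]]

/-- A configuration related to the golden ratio. -/
def golden : Construction where
  n := 9
  lines := [21, 35, 73, 112, 138, 196, 300, 322, 400]
  free := [(0, 2)]
  meets := [((0, 1), (2, 3), [[-1]]), ((4, 5), (0, 3), [[-1]]), ((2, 6), (1, 3), [[-1]]), ((4, 7),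
    (2, 3), [[-1]])]
  pts := [([[1]], [], [[0, 1]]), ([[-1]], [[-1]], []), ([[-1, -1]], [[0, -1]], [[0, -1]]), ([[1,
    1]], [[0, 1]], [[1, 1]]), ([[0, -1]], [[0, -1]], [[-1]])]
  zeros := [[], [[-1, -1, 1]]]
  units := [[[1]], [[0, 1]], [[1, 1]], [[-1, 1]], [[0, 0, 1]], [[0, -1, 1]], [[-1, 0, 1]]]

/-- The Pappus configuration. -/
def pappus : Construction where
  n := 9
  lines := [22, 41, 69, 88, 131, 176, 266, 292, 448]
  free := [(2, 1), (3, 0)]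
  meets := [((0, 2), (3, 4), [[-1]]), ((0, 1), (4, 5), [[-1]]), ((1, 3), (6, 7), [[1, -1]])]
  pts := [([], [[0, 1]], [[1]]), ([[1], [1]], [[1]], [[1]]), ([[0, -1]], [], [[1, -1]]), ([[-1],
    [-1]], [[-1, 1]], []), ([[1], [1]], [[1]], [[1], [1]])]
  zeros := [[]]
  units := [[[1]], [[-1, 1]], [[1], [1]], [[0, 1]], [[], [1]], [[0, -1, 1]], [[-1, 1], [0, 1]],
    [[1, -2, 1]], [[-1, 1], [-1, 1]], [[-1], [-1, 1]], [[], [1], [1]], [[1], [2], [1]], [[0, 1],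
    [1]], [[0, 1], [0, 1]], [[0, 0, 1]], [[], [-1, 1]], [[], [], [1]], [[], [0, -1, 1]], [[], [0,
    1], [0, 1]], [[], [0, 1]]]

/-- A configuration with nine lines. -/
def nonPappusOne : Construction where
  n := 9
  lines := [28, 41, 70, 81, 131, 164, 266, 304, 448]
  free := [(2, 3), (0, 3)]
  meets := [((0, 4), (1, 2), [[-1]]), ((0, 1), (2, 5), [[-1]]), ((6, 7), (4, 5), [[], [0, 1]])]
  pts := [([[0, 1]], [[0, 1]], [[1, 1]]), ([[1], [1]], [[], [1]], [[], [1]]), ([], [[0, 1]], [[1,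
    1]]), ([[-1], [-1]], [[], [-1]], []), ([[1], [1]], [[0, -1], [1]], [[-1, -1]])]
  zeros := [[], [[2, 1], [1]]]
  units := [[[1]], [[1, 1]], [[], [1]], [[0, 1]], [[0, 1], [-1]], [[1], [1]], [[], [1, 1]], [[],
    [], [1]], [[], [1], [1]], [[1, 1], [1]], [[0, 1, 1]], [[1, 1], [1, 1]], [[1, 2, 1], [1, 1]],
    [[1, 1], [2, 1], [1]], [[0, 0, 1]], [[0, 1], [0, 1]], [[-1], [0, 1]], [[], [0, 1]], [[], [0,
    1, 1]], [[], [0, 1], [0, 1]]]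

/-- Another configuration with nine lines. -/
def nonPappusTwo : Construction where
  n := 9
  lines := [19, 44, 70, 73, 133, 176, 280, 352, 386]
  free := [(1, 0), (3, 2)]
  meets := [((1, 2), (0, 3), [[-1]]), ((0, 2), (4, 5), [[-1]]), ((1, 7), (5, 6), [[-1]])]
  pts := [([[0, 1]], [[1]], []), ([[1]], [[1]], [[1], [1]]), ([], [[-1]], [[-1]]), ([[1, -1]], [],
    [[1], [1]]), ([[1, -1]], [[1], [0, 1]], [[1], [1]])]
  zeros := [[], [[0, 1], [1, -1, 1]]]
  units := [[[1]], [[1], [1]], [[1], [0, 1]], [[], [1]], [[], [-1, 1]], [[], [0, 1], [0, 1]],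
    [[1], [1, 1], [0, 1]], [[0, 1]], [[-1, 1]], [[0, 1], [1]], [[0, 1], [0, 1]], [[-1, 2], [0, 0,
    1]], [[-1, 1], [0, -1, 1]], [[0, 1], [1, 0, 1], [0, 1]], [[0, 1], [0, 1, 1], [0, 0, 1]]]

/-- A configuration related to the square roots of minus one. -/
def gaussian : Construction where
  n := 9
  lines := [19, 37, 42, 73, 112, 140, 194, 280, 324, 416]
  free := [(0, 1)]
  meets := [((0, 2), (1, 3), [[-1]]), ((4, 5), (0, 3), [[-1]]), ((1, 6), (2, 3), [[-1]]), ((5, 7),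
    (3, 4), [[-1]])]
  pts := [([[1]], [[0, 1]], []), ([[1]], [], [[1]]), ([[-1, -1]], [[0, -1]], [[0, -1]]), ([[-1,
    -1]], [[-1, -1]], [[0, -1]]), ([[2]], [[1, 1]], [[1]])]
  zeros := [[], [[1, 0, 1]]]
  units := [[[1]], [[0, 1]], [[1, 1]], [[0, 0, 1]], [[-1, 0, 1]], [[2]], [[-1, 1]]]

/-- The affine plane of order three. -/
def affinePlane : Construction where
  n := 9
  lines := [25, 35, 44, 70, 112, 133, 146, 200, 266, 276, 321, 416]
  free := [(3, 0)]
  meets := [((0, 1), (2, 3), [[-1]]), ((1, 2), (4, 5), [[-1]]), ((0, 2), (1, 4), [[-1]]), ((5, 7),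
    (0, 6), [[-1]])]
  pts := [([[1, 1]], [[1]], [[1]]), ([[-1]], [[-1]], []), ([], [[0, 1]], [[-1]]), ([[1, 1]], [],
    [[1]]), ([[-1]], [[0, 1]], [[-1]])]
  zeros := [[], [[1, 1, 1]]]
  units := [[[1]], [[0, 1]], [[1, 1]], [[0, 1, 1]]]

theorem check_fano : fano.check = true := by decide +kernel

theorem check_moebiusKantor : moebiusKantor.check = true := by decide +kernel

theorem check_ternary : ternary.check = true := by decide +kernel

theorem check_golden : golden.check = true := by decide +kernel

theorem check_pappus : pappus.check = true := by decide +kernel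

theorem check_nonPappusOne : nonPappusOne.check = true := by decide +kernel

theorem check_nonPappusTwo : nonPappusTwo.check = true := by decide +kernel

theorem check_gaussian : gaussian.check = true := by decide +kernel

theorem check_affinePlane : affinePlane.check = true := by decide +kernel

end Construction

section Counts

variable {F : Type} [Field F]

theorem prime_dvd_card_iff [Fintype F] {p : ℕ} (hp : p.Prime) :
    p ∣ Fintype.card F ↔ (p : F) = 0 := by
  have := Fact.mk hp
  constructor
  · intro h
    obtain ⟨x, hx⟩ := exists_prime_addOrderOf_dvd_card p h
    have h1 := addOrderOf_nsmul_eq_zero x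
    rw [hx, nsmul_eq_mul] at h1
    refine (mul_eq_zero.1 h1).resolve_right fun h0 => ?_
    rw [h0, addOrderOf_zero] at hx
    exact hp.one_lt.ne hx
  · intro h
    rw [← addOrderOf_eq_prime (x := (1 : F)) (p := p) (by simpa using h) one_ne_zero]
    exact addOrderOf_dvd_card

theorem card_fst (P : F → Prop) :
    Nat.card {v : F × F // v.2 = 0 ∧ P v.1} = Nat.card {x // P x} :=
  Nat.card_congr
    { toFun := fun v => ⟨v.1.1, v.2.2⟩
      invFun := fun x => ⟨(x.1, 0), rfl, x.2⟩
      left_inv := by rintro ⟨⟨x, y⟩, h, h'⟩; simp only at h; subst h; rfl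
      right_inv := fun _ => rfl }

theorem card_neg (P : F → Prop) : Nat.card {x // P (-x)} = Nat.card {x // P x} :=
  Nat.card_congr ((Equiv.neg F).subtypeEquiv fun _ => Iff.rfl)

open Classical in
theorem card_subtype {F : Type*} [Fintype F] (P : F → Prop) : Nat.card {x // P x} = #{x | P x} := by
  rw [Nat.card_eq_fintype_card, Fintype.card_subtype]

theorem card_prod_subtype {F : Type*} [Fintype F] (P : F × F → Prop) :
    Nat.card {v // P v} = ∑ s, Nat.card {t // P (s, t)} := by
  rw [← Nat.card_sigma]
  exact Nat.card_congr
    { toFun := fun v => ⟨v.1.1, v.1.2, v.2⟩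
      invFun := fun v => ⟨(v.1, v.2.1), v.2.2⟩
      left_inv := fun _ => rfl
      right_inv := fun _ => rfl }

theorem card_const (p : Prop) [Decidable p] :
    Nat.card {v : F × F // v.1 = 0 ∧ v.2 = 0 ∧ p} = if p then 1 else 0 := by
  split_ifs with h
  · rw [Nat.card_eq_one_iff_unique]
    refine ⟨⟨?_⟩, ⟨⟨0, rfl, rfl, h⟩⟩⟩
    rintro ⟨⟨x, y⟩, hx, hy, -⟩ ⟨⟨x', y'⟩, hx', hy', -⟩
    simp only at hx hy hx' hy'
    subst hx hy hx' hy'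
    rfl
  · have : IsEmpty {v : F × F // v.1 = 0 ∧ v.2 = 0 ∧ p} := ⟨fun v => h v.2.2.2⟩
    exact Nat.card_of_isEmpty

namespace Construction

theorem card_fano [Decidable ((2 : F) = 0)] :
    Nat.card {v : F × F // fano.Admits v} = if (2 : F) = 0 then 1 else 0 := by
  rw [← card_const (F := F)]
  refine Nat.card_congr (Equiv.subtypeEquivRight fun v => ?_)
  simp [Admits, fano, beval, peval]
theorem card_ternary [Decidable ((3 : F) = 0)] :
    Nat.card {v : F × F // ternary.Admits v} = if (3 : F) = 0 then 1 else 0 := by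
  rw [← card_const (F := F)]
  refine Nat.card_congr (Equiv.subtypeEquivRight fun v => ?_)
  simp [Admits, ternary, beval, peval]
  intro _ _ h3 h2
  exact one_ne_zero (α := F) (by linear_combination h3 - h2)

theorem admits_moebiusKantor (s t : F) :
    moebiusKantor.Admits (s, t) ↔ t = 0 ∧ s ^ 2 + s + 1 = 0 := by
  simp [Admits, moebiusKantor, beval, peval]
  grind

theorem admits_affinePlane (s t : F) :
    affinePlane.Admits (s, t) ↔ t = 0 ∧ s ^ 2 + s + 1 = 0 := by
  simp [Admits, affinePlane, beval, peval]
  grind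

theorem admits_golden (s t : F) : golden.Admits (s, t) ↔ t = 0 ∧ (-s) ^ 2 + (-s) - 1 = 0 := by
  simp [Admits, golden, beval, peval]
  grind

theorem admits_gaussian (s t : F) :
    gaussian.Admits (s, t) ↔ t = 0 ∧ s ^ 2 + 1 = 0 ∧ (2 : F) ≠ 0 := by
  simp [Admits, gaussian, beval, peval]
  grind

theorem admits_nonPappusOne (s t : F) : nonPappusOne.Admits (s, t) ↔
    t = - 2 - s ∧ (2 : F) ≠ 0 ∧ s ≠ 0 ∧ s ≠ -1 ∧ s ≠ -2 := by
  simp [Admits, nonPappusOne, beval, peval]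
  constructor
  · grind
  · rintro ⟨rfl, h2, h0, h1, h3⟩
    have h1' : s + 1 ≠ 0 := by grind
    have h3' : s + 2 ≠ 0 := by grind
    have := mul_ne_zero h0 h1'
    have := mul_ne_zero h2 h1'
    have := mul_ne_zero h1' h1'
    have := mul_ne_zero h0 h0
    have := mul_ne_zero h3' h3'
    have := mul_ne_zero h1' h3'
    have := mul_ne_zero h0 h3'
    repeat' apply And.intro
    all_goals grind

theorem admits_nonPappusTwo (s t : F) : nonPappusTwo.Admits (s, t) ↔
    t * (s ^ 2 - s + 1) = - s ∧ s ^ 2 - s + 1 ≠ 0 ∧ s ≠ 0 ∧ s ≠ 1 := by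
  simp [Admits, nonPappusTwo, beval, peval]
  constructor
  · rintro ⟨h, H⟩
    have h0 : s ≠ 0 := by tauto
    have h1 : -1 + s ≠ 0 := by tauto
    have h' : t * (s ^ 2 - s + 1) = - s := by linear_combination h
    refine ⟨h', fun hD => h0 ?_, h0, fun e => h1 ?_⟩
    · linear_combination h' - t * hD
    · linear_combination e
  · rintro ⟨h, hD, h0, h1⟩
    have h1' : s - 1 ≠ 0 := sub_ne_zero.2 h1
    have ht : t ≠ 0 := fun ht => h0 (by linear_combination h - (s ^ 2 - s + 1) * ht)
    have u1 : 1 + t ≠ 0 := fun e => mul_ne_zero h1' h1' (by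
      linear_combination (s ^ 2 - s + 1) * e - h)
    have u2 : 1 + t * s ≠ 0 := fun e => h1' (by
      linear_combination s * h - (s ^ 2 - s + 1) * e)
    have u3 : s + t ≠ 0 := fun e => mul_ne_zero (mul_ne_zero h0 h0) h1' (by
      linear_combination (s ^ 2 - s + 1) * e - h)
    have u4 : -1 + s * 2 + t * (s * s) ≠ 0 := fun e => mul_ne_zero (mul_ne_zero h1' h1') h1' (by
      linear_combination (s ^ 2 - s + 1) * e - s ^ 2 * h)
    have h' : s + t * (1 + s * (-1 + s)) = 0 := by linear_combination h
    have v1 := mul_ne_zero h0 u1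
    have v2 := mul_ne_zero u1 u2
    have v3 := mul_ne_zero h1' u2
    have v4 := mul_ne_zero u3 u2
    have v5 := mul_ne_zero v1 u2
    ring_nf at *
    tauto

theorem admits_pappus (s t : F) : pappus.Admits (s, t) ↔
    s ≠ 0 ∧ s ≠ 1 ∧ t ≠ 0 ∧ t ≠ -1 ∧ t ≠ -s ∧ s * t ≠ 1 - s ∧ t * (s - 1) ≠ 1 := by
  have e1 : s ≠ 1 ↔ -1 + s ≠ 0 := by grind
  have e2 : t ≠ -1 ↔ 1 + t ≠ 0 := by grind
  have e3 : t ≠ -s ↔ s + t ≠ 0 := by grind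
  have e4 : s * t ≠ 1 - s ↔ -1 + s + t * s ≠ 0 := by grind
  have e5 : t * (s - 1) ≠ 1 ↔ -1 + t * (-1 + s) ≠ 0 := by grind
  rw [e1, e2, e3, e4, e5]
  simp [Admits, pappus, beval, peval]
  constructor
  · tauto
  · rintro ⟨h0, h1, ht, h3, h4, h5, h6⟩
    have v1 := mul_ne_zero h1 h1
    have v2 := mul_ne_zero h1 h3
    have v3 := mul_ne_zero h3 h3
    have v4 := mul_ne_zero h0 h3
    ring_nf at *
    tauto

theorem card_moebiusKantor : Nat.card {v : F × F // moebiusKantor.Admits v} =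
    Nat.card {x : F // x ^ 2 + x + 1 = 0} := by
  rw [← card_fst fun x : F => x ^ 2 + x + 1 = 0]
  exact Nat.card_congr (Equiv.subtypeEquivRight fun v : F × F => admits_moebiusKantor v.1 v.2)

theorem card_affinePlane : Nat.card {v : F × F // affinePlane.Admits v} =
    Nat.card {x : F // x ^ 2 + x + 1 = 0} := by
  rw [← card_fst fun x : F => x ^ 2 + x + 1 = 0]
  exact Nat.card_congr (Equiv.subtypeEquivRight fun v : F × F => admits_affinePlane v.1 v.2)

theorem card_golden : Nat.card {v : F × F // golden.Admits v} =
    Nat.card {x : F // x ^ 2 + x - 1 = 0} := by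
  rw [← card_neg fun x : F => x ^ 2 + x - 1 = 0,
    ← card_fst fun x : F => (-x) ^ 2 + -x - 1 = 0]
  exact Nat.card_congr (Equiv.subtypeEquivRight fun v : F × F => admits_golden v.1 v.2)

theorem card_gaussian [Decidable ((2 : F) = 0)] :
    (Nat.card {v : F × F // gaussian.Admits v} : ℤ) =
      Nat.card {x : F // x ^ 2 + 1 = 0} - if (2 : F) = 0 then 1 else 0 := by
  rw [Nat.card_congr (Equiv.subtypeEquivRight fun v : F × F => admits_gaussian v.1 v.2),
    card_fst fun x : F => x ^ 2 + 1 = 0 ∧ (2 : F) ≠ 0]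
  split_ifs with h
  · have h1 : Nat.card {x : F // x ^ 2 + 1 = 0 ∧ (2 : F) ≠ 0} = 0 := by simp [h]
    have h2 : Nat.card {x : F // x ^ 2 + 1 = 0} = 1 := by
      refine Nat.card_eq_one_iff_unique.2 ⟨⟨?_⟩, ⟨⟨1, by linear_combination h⟩⟩⟩
      have key : ∀ x : F, x ^ 2 + 1 = 0 → x = 1 := fun x hx => by
        have : (x - 1) ^ 2 = 0 := by linear_combination hx - x * h
        exact sub_eq_zero.1 (pow_eq_zero_iff two_ne_zero |>.1 this)
      rintro ⟨x, hx⟩ ⟨y, hy⟩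
      rw [Subtype.mk.injEq, key x hx, key y hy]
    rw [h1, h2]
    rfl
  · simp [h]

open Classical in
theorem card_notMem {F : Type*} [Fintype F] (S : Finset F) :
    (Nat.card {x // x ∉ S} : ℤ) = Fintype.card F - #S := by
  have : #S + Nat.card {x // x ∉ S} = Fintype.card F := by
    rw [card_subtype, ← card_compl_add_card S, add_comm]
    congr 2
    ext
    simp
  omega

open Classical in
theorem card_nonPappusOne [Fintype F] : (Nat.card {v : F × F // nonPappusOne.Admits v} : ℤ) =
    (1 - if (2 : F) = 0 then 1 else 0) * (Fintype.card F - 3) := by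
  have e : {v : F × F // nonPappusOne.Admits v} ≃
      {s : F // (2 : F) ≠ 0 ∧ s ∉ ({0, -1, -2} : Finset F)} :=
    { toFun := fun v => ⟨v.1.1, by
        have := (admits_nonPappusOne v.1.1 v.1.2).1 v.2
        simpa using this.2⟩
      invFun := fun s => ⟨(s, - 2 - s), (admits_nonPappusOne _ _).2 ⟨rfl, by simpa using s.2⟩⟩
      left_inv := fun v => by
        have := (admits_nonPappusOne v.1.1 v.1.2).1 v.2
        ext
        · rfl
        · exact this.1.symm
      right_inv := fun _ => rfl }
  rw [Nat.card_congr e]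
  split_ifs with h
  · simp [h]
  · simp only [ne_eq, h, not_false_eq_true, true_and]
    rw [card_notMem, card_eq_three.2 ⟨0, -1, -2, ?_, ?_, ?_, rfl⟩]
    · simp
    · simp
    · simpa [eq_comm] using h
    · grind

open Classical in
theorem card_nonPappusTwo [Fintype F] : (Nat.card {v : F × F // nonPappusTwo.Admits v} : ℤ) =
    Fintype.card F - 2 - Nat.card {x : F // x ^ 2 + x + 1 = 0} := by
  have e : {v : F × F // nonPappusTwo.Admits v} ≃
      {s : F // s ∉ ({0, 1} : Finset F) ∪ univ.filter fun s => s ^ 2 - s + 1 = 0} :=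
    { toFun := fun v => ⟨v.1.1, by
        have := (admits_nonPappusTwo v.1.1 v.1.2).1 v.2
        simp
        tauto⟩
      invFun := fun s => ⟨(s, - s / (s ^ 2 - s + 1)), (admits_nonPappusTwo _ _).2 <| by
        have := s.2
        simp at this
        refine ⟨div_mul_cancel₀ _ ?_, ?_⟩ <;> tauto⟩
      left_inv := fun v => by
        have := (admits_nonPappusTwo v.1.1 v.1.2).1 v.2
        ext
        · rfl
        · exact (eq_div_of_mul_eq this.2.1 this.1).symm
      right_inv := fun _ => rfl }
  rw [Nat.card_congr e, card_notMem, card_union_of_disjoint, card_pair zero_ne_one,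
    ← card_subtype, ← card_neg fun x : F => x ^ 2 + x + 1 = 0]
  · have : ∀ x : F, (-x) ^ 2 + -x + 1 = x ^ 2 - x + 1 := fun x => by ring
    simp only [this]
    push_cast
    ring
  · rw [disjoint_left]
    intro x hx
    simp at hx ⊢
    rcases hx with rfl | rfl <;> simp

theorem sum_ite_const {F : Type*} [Fintype F] (P : F → Prop) [DecidablePred P] (c : ℤ) :
    ∑ s, (if P s then c else 0) = Nat.card {s // P s} * c := by
  rw [← sum_filter, sum_const, nsmul_eq_mul, Nat.card_eq_fintype_card, Fintype.card_subtype]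

open Classical in
theorem card_pappus [Fintype F] : (Nat.card {v : F × F // pappus.Admits v} : ℤ) =
    (Fintype.card F - 2) * (Fintype.card F - 5) +
      2 * Nat.card {x : F // x ^ 2 + x + 1 = 0} := by
  have key : ∀ s : F, (Nat.card {t // pappus.Admits (s, t)} : ℤ) =
      (if s ∉ ({0, 1} : Finset F) then (Fintype.card F - 5 : ℤ) else 0) +
        if s ^ 2 - s + 1 = 0 then 2 else 0 := by
    intro s
    simp only [admits_pappus]
    by_cases h : s = 0 ∨ s = 1
    · rcases h with rfl | rfl <;> simp
    · rw [not_or] at h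
      obtain ⟨h0, h1⟩ := h
      have h1' : s - 1 ≠ 0 := sub_ne_zero.2 h1
      rw [if_pos (by simp [h0, h1])]
      have : ∀ t, (s ≠ 0 ∧ s ≠ 1 ∧ t ≠ 0 ∧ t ≠ -1 ∧ t ≠ -s ∧ s * t ≠ 1 - s ∧ t * (s - 1) ≠ 1) ↔
          t ∉ ({0, -1, -s, (1 - s) / s, 1 / (s - 1)} : Finset F) := by
        intro t
        simp only [mem_insert, mem_singleton, not_or, eq_div_iff h0, eq_div_iff h1', mul_comm s t]
        tauto
      simp only [this]
      rw [card_notMem]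
      split_ifs with hs
      · have e1 : (1 - s) / s = -s := by
          rw [div_eq_iff h0]; linear_combination hs
        have e2 : 1 / (s - 1) = -s := by
          rw [div_eq_iff h1']; linear_combination hs
        have : ({0, -1, -s, (1 - s) / s, 1 / (s - 1)} : Finset F) = {0, -1, -s} := by
          rw [e1, e2]; simp
        rw [this, card_eq_three.2 ⟨0, -1, -s, ?_, ?_, ?_, rfl⟩]
        · push_cast; ring
        · simp
        · simpa [eq_comm] using h0
        · simpa [eq_comm] using h1
      · have : #({0, -1, -s, (1 - s) / s, 1 / (s - 1)} : Finset F) = 5 := by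
          rw [card_insert_of_notMem, card_insert_of_notMem, card_insert_of_notMem, card_pair]
          · rw [Ne, div_eq_div_iff h0 h1']
            grind
          · simp only [mem_insert, mem_singleton, eq_div_iff h0, eq_div_iff h1']
            grind
          · simp only [mem_insert, mem_singleton, eq_div_iff h0, eq_div_iff h1']
            grind
          · simp only [mem_insert, mem_singleton, eq_div_iff h0, eq_div_iff h1']
            grind
        rw [this]
        push_cast; ring
  rw [card_prod_subtype, Nat.cast_sum, sum_congr rfl fun s _ => key s, sum_add_distrib,
    sum_ite_const, sum_ite_const, card_notMem, card_pair zero_ne_one,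
    ← card_neg fun x : F => x ^ 2 + x + 1 = 0]
  have : ∀ x : F, (-x) ^ 2 + -x + 1 = x ^ 2 - x + 1 := fun x => by ring
  simp only [this]
  push_cast
  ring

end Construction

end Counts

theorem table_four_arcs : (table[16]?.map fun r => (r.n, r.lines, r.vec)) =
    some (4, [], [[0, 0, 0, 1, 0, -1, -1, 0, 1]]) := by
  decide +kernel

theorem table_nine_arcs : (table[110]?.map fun r => (r.n, r.lines, r.vec)) =
    some (9, [], [[0, 0, 0, 389304720, -588466080, -2811240, 52873326, 237536370, 143263449,
      -477084077, 356715069, -141107418, 34956422, -5787888, 655284, -50392, 2529, -75, 1],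
      [-16193520, 6364440, -871560, 50760, -1080], [1383480, -204120, 7560], [-272160], [272160],
      [-3360], [-30240], [-40320], [], [60480], [], [], [-2520]]) := by
  decide +kernel

theorem table_take : (table.take 13).map (fun r => (r.n, r.lines)) =
    [(0, []), (Construction.fano.n, Construction.fano.lines),
      (Construction.moebiusKantor.n, Construction.moebiusKantor.lines),
      (Construction.ternary.n, Construction.ternary.lines),
      (Construction.golden.n, Construction.golden.lines),
      (Construction.pappus.n, Construction.pappus.lines),
      (Construction.nonPappusOne.n, Construction.nonPappusOne.lines),
      (Construction.nonPappusTwo.n, Construction.nonPappusTwo.lines),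
      (9, [67, 84, 104, 133, 152, 162, 265, 274, 292, 448]),
      (Construction.gaussian.n, Construction.gaussian.lines),
      (9, [70, 73, 112, 131, 152, 164, 261, 274, 296, 448]),
      (9, [25, 42, 76, 112, 148, 161, 194, 274, 292, 321, 392]),
      (Construction.affinePlane.n, Construction.affinePlane.lines)] := by
  decide +kernel

theorem numReal_of_table (P L : Type*) [Membership P L] [ProjectivePlane P L] [Fintype P]
    [Finite L] {i n : ℕ} {B : List ℕ} {v : List (List ℤ)}
    (h : (table[i]?.map fun r => (r.n, r.lines, r.vec)) = some (n, B, v)) :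
    (numReal P L n B : ℤ) = veval (order P L : ℤ)
      (((table.take 13).map fun r => (r.n, r.lines)).map
        fun z => (numReal P L z.1 z.2 : ℤ)) v := by
  obtain ⟨r, hr, e⟩ := Option.map_eq_some_iff.1 h
  have := tableCheck_sound P L tableCheck_table i r hr
  simp only [Prod.mk.injEq] at e
  obtain ⟨rfl, rfl, rfl⟩ := e
  rw [this, List.map_map]
  rfl

theorem numReal_zero (P L : Type*) [Membership P L] : numReal P L 0 [] = 1 := by
  rw [numReal, Nat.card_eq_one_iff_unique]
  exact ⟨⟨fun x y => Subtype.ext (Subsingleton.elim _ _)⟩,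
    ⟨⟨Fin.elim0, fun i => i.elim0, fun i => i.elim0⟩⟩⟩

section Field

variable (F : Type) [Field F]

theorem numReal_nil (n : ℕ) : numReal (ℙ F (Fin 3 → F)) (ℙ F (Fin 3 → F)) n [] = P2nArcs F n := by
  refine Nat.card_congr (Equiv.subtypeEquivRight fun p => and_congr_right fun _ => ?_)
  refine forall_congr' fun i => forall_congr' fun j => forall_congr' fun k => ?_
  refine imp_congr_right fun _ => imp_congr_right fun _ => imp_congr_right fun _ => ?_
  rw [col_iff_det3, P2Collinear, not_not, independent_iff_det3]
  simp [Rel]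

theorem order_projectivization [Fintype F] [DecidableEq F] :
    order (ℙ F (Fin 3 → F)) (ℙ F (Fin 3 → F)) = Fintype.card F := by
  have := Fintype.ofFinite (ℙ F (Fin 3 → F))
  have h1 := card_points (ℙ F (Fin 3 → F)) (ℙ F (Fin 3 → F))
  rw [← Nat.card_eq_fintype_card, Projectivization.card_of_finrank F (Fin 3 → F) (n := 3) (by simp),
    Nat.card_eq_fintype_card] at h1
  simp only [sum_range_succ, sum_range_zero] at h1
  generalize order (ℙ F (Fin 3 → F)) (ℙ F (Fin 3 → F)) = m at *
  rcases lt_trichotomy m (Fintype.card F) with h | h | h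
  · nlinarith
  · exact h
  · nlinarith

end Field

end ArcCount

open ArcCount Construction Configuration.ProjectivePlane in
/-- Iampolskaia, Skorobogatov and Sorokin's formula for the number of ordered
9-arcs in `ℙ²(F_q)`. -/
theorem count_nine_arcs_desarguesian (F : Type) [Field F] [Fintype F]
    (q a b c d e : ℤ)
    (hq : q = Fintype.card F)
    (ha : a = if 2 ∣ Fintype.card F then 1 else 0)
    (hb : b = Nat.card {x : F // x ^ 2 + x + 1 = 0})
    (hc : c = if 3 ∣ Fintype.card F then 1 else 0)
    (hd : d = Nat.card {x : F // x ^ 2 + x - 1 = 0})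
    (he : e = Nat.card {x : F // x ^ 2 + 1 = 0}) :
    (P2nArcs F 9 : ℤ) =
      (q ^ 2 + q + 1) * (q ^ 2 + q) * q ^ 2 * (q - 1) ^ 2 *
        (q ^ 10 - 75 * q ^ 9 + 2530 * q ^ 8 - 50466 * q ^ 7 + 657739 * q ^ 6
          - 5835825 * q ^ 5 + 35563770 * q ^ 4 - 146288034 * q ^ 3
          + 386490120 * q ^ 2 - 588513120 * q + 389442480
          - 1080 * (q ^ 4 - 47 * q ^ 3 + 807 * q ^ 2 - 5921 * q + 15134) * a
          + 840 * (9 * q ^ 2 - 243 * q + 1684) * b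
          + 30240 * (-9 * c + 9 * d + 2 * e)) := by
  classical
  have hfin := Fintype.ofFinite (Projectivization F (Fin 3 → F))
  have h9 := numReal_of_table (Projectivization F (Fin 3 → F))
    (Projectivization F (Fin 3 → F)) table_nine_arcs
  have h4 := numReal_of_table (Projectivization F (Fin 3 → F))
    (Projectivization F (Fin 3 → F)) table_four_arcs
  rw [numReal_nil, table_take, order_projectivization] at h9
  rw [table_take, order_projectivization] at h4
  have ha' : (if (2 : F) = 0 then 1 else 0 : ℤ) = a := by
    rw [ha]; simp only [prime_dvd_card_iff Nat.prime_two, Nat.cast_ofNat]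
  have hc' : (if (3 : F) = 0 then 1 else 0 : ℤ) = c := by
    rw [hc]; simp only [prime_dvd_card_iff Nat.prime_three, Nat.cast_ofNat]
  simp only [List.map_cons, List.map_nil, veval, peval, numReal_zero, numReal_eq check_fano,
    numReal_eq check_moebiusKantor, numReal_eq check_ternary, numReal_eq check_golden,
    numReal_eq check_pappus, numReal_eq check_nonPappusOne, numReal_eq check_nonPappusTwo,
    numReal_eq check_gaussian, numReal_eq check_affinePlane, Nat.cast_mul, card_fano,
    card_moebiusKantor, card_ternary, card_golden, card_pappus, card_nonPappusOne,
    card_nonPappusTwo, card_gaussian, card_affinePlane, Nat.cast_ite, Nat.cast_one, Nat.cast_zero,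
    ha', hc', ← hq, ← hb, ← hd, ← he] at h9 h4
  rw [h9, h4]
  push_cast
  ring
end

section
/- Let q be a prime power. The number A_7(q) of ordered strong realizations of the Fano plane in ℙ²(F_q) equals 30·a(q)·(q^2+q+1)(q^2+q)q^2(q-1)^2; that is, A_7(q) = 0 when q is odd and A_7(q) = 30(q^2+q+1)(q^2+q)q^2(q-1)^2 when q is even. -/
/-- The number of ordered strong realizations of the Fano plane in `ℙ²(F)`. -/
noncomputable def P2A7 (F : Type) [Field F] : ℕ :=
  Nat.card {p : ZMod 7 → Projectivization F (Fin 3 → F) // Function.Injective p ∧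
    ∃ σ : Equiv.Perm (ZMod 7), ∀ i j k : ZMod 7, i ≠ j → i ≠ k → j ≠ k →
      (P2Collinear F (p (σ i)) (p (σ j)) (p (σ k)) ↔
        ∃ a : ZMod 7, ({i, j, k} : Set (ZMod 7)) = {a, a + 1, a + 3})}

/-- The third point on the line of the Fano plane `{a, a + 1, a + 3}`, `a ∈ ℤ/7`, through the
distinct points `i` and `j`. -/
abbrev fanoThird (i j : ZMod 7) : ZMod 7 := i + 4 * (j - i) - (j - i) ^ 4

theorem exists_line_eq_iff_eq_fanoThird {i j k : ZMod 7} (hij : i ≠ j) (hik : i ≠ k)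
    (hjk : j ≠ k) :
    (∃ a : ZMod 7, ({i, j, k} : Set (ZMod 7)) = {a, a + 1, a + 3}) ↔ k = fanoThird i j := by
  have key : ∀ i j k : ZMod 7, i ≠ j → i ≠ k → j ≠ k →
      ((∃ a : ZMod 7, ({i, j, k} : Finset (ZMod 7)) = {a, a + 1, a + 3}) ↔
        k = fanoThird i j) := by
    decide +kernel
  rw [← key i j k hij hik hjk]
  simp only [← Finset.coe_inj, Finset.coe_insert, Finset.coe_singleton]

/-- A permutation of `ℤ/7` that preserves the lines of the Fano plane. -/
def IsFanoAut (σ : Equiv.Perm (ZMod 7)) : Prop :=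
  ∀ i j, i ≠ j → σ (fanoThird i j) = fanoThird (σ i) (σ j)

/-- The map of the Fano plane to itself determined by the images of the points `0, 1, 2`. -/
def fanoMap (a b c : ZMod 7) : ZMod 7 → ZMod 7 := fun i =>
  (![a, b, c, fanoThird a b, fanoThird b c, fanoThird c (fanoThird a b), fanoThird a c] :
    Fin 7 → ZMod 7) i

theorem fanoMap_injective_and_map_third : ∀ a b c : ZMod 7, a ≠ b → a ≠ c → b ≠ c →
    c ≠ fanoThird a b → (∀ i j, fanoMap a b c i = fanoMap a b c j → i = j) ∧
      ∀ i j, i ≠ j → fanoMap a b c (fanoThird i j) =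
        fanoThird (fanoMap a b c i) (fanoMap a b c j) := by
  decide +kernel

theorem IsFanoAut.eq_fanoMap {σ : Equiv.Perm (ZMod 7)} (h : IsFanoAut σ) :
    (σ : ZMod 7 → ZMod 7) = fanoMap (σ 0) (σ 1) (σ 2) := by
  have h3 : σ 3 = fanoThird (σ 0) (σ 1) := h 0 1 (by decide)
  have h4 : σ 4 = fanoThird (σ 1) (σ 2) := h 1 2 (by decide)
  have h5 : σ 5 = fanoThird (σ 2) (σ 3) := h 2 3 (by decide)
  have h6 : σ 6 = fanoThird (σ 0) (σ 2) := h 0 2 (by decide)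
  rw [h3] at h5
  funext i
  change Fin 7 at i
  fin_cases i
  exacts [rfl, rfl, rfl, h3, h4, h5, h6]

theorem card_isFanoAut : Nat.card {σ // IsFanoAut σ} = 168 := by
  let X := {x : ZMod 7 × ZMod 7 × ZMod 7 // x.1 ≠ x.2.1 ∧ x.1 ≠ x.2.2 ∧ x.2.1 ≠ x.2.2 ∧
    x.2.2 ≠ fanoThird x.1 x.2.1}
  let f : {σ // IsFanoAut σ} → X := fun σ => ⟨(σ.1 0, σ.1 1, σ.1 2),
    σ.1.injective.ne (by decide), σ.1.injective.ne (by decide), σ.1.injective.ne (by decide), by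
      rw [← σ.2 0 1 (by decide)]
      exact σ.1.injective.ne (by decide)⟩
  have hf : Function.Bijective f := by
    refine ⟨fun σ τ h => ?_, fun ⟨⟨a, b, c⟩, hab, hac, hbc, h⟩ => ?_⟩
    · obtain ⟨h0 : σ.1 0 = τ.1 0, h12⟩ := Prod.mk.inj (congrArg Subtype.val h)
      obtain ⟨h1, h2⟩ := Prod.mk.inj h12
      exact Subtype.ext (DFunLike.coe_injective (by
        rw [σ.2.eq_fanoMap, τ.2.eq_fanoMap, h0, h1, h2]))
    · obtain ⟨hi, ht⟩ := fanoMap_injective_and_map_third a b c hab hac hbc h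
      exact ⟨⟨Equiv.ofBijective (fanoMap a b c)
        (Finite.injective_iff_bijective.1 fun i j => hi i j), ht⟩, rfl⟩
  rw [Nat.card_congr (Equiv.ofBijective f hf), Nat.card_eq_fintype_card]
  decide +kernel

section Projective

variable {F : Type} [Field F]

theorem p2Collinear_iff_det_rep (x y z : Projectivization F (Fin 3 → F)) :
    P2Collinear F x y z ↔ (Matrix.of ![x.rep, y.rep, z.rep]).det = 0 := by
  have h : Projectivization.rep ∘ ![x, y, z] = (Matrix.of ![x.rep, y.rep, z.rep]).row := by
    funext i
    fin_cases i <;> rfl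
  rw [P2Collinear, Projectivization.independent_iff, h, Matrix.linearIndependent_rows_iff_isUnit,
    Matrix.isUnit_iff_isUnit_det, isUnit_iff_ne_zero, not_not]

theorem p2Collinear_mk_iff {u v w : Fin 3 → F} (hu : u ≠ 0) (hv : v ≠ 0) (hw : w ≠ 0) :
    P2Collinear F (.mk F u hu) (.mk F v hv) (.mk F w hw) ↔
      (Matrix.of ![u, v, w]).det = 0 := by
  obtain ⟨a, ha⟩ := Projectivization.exists_smul_eq_mk_rep F u hu
  obtain ⟨b, hb⟩ := Projectivization.exists_smul_eq_mk_rep F v hv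
  obtain ⟨c, hc⟩ := Projectivization.exists_smul_eq_mk_rep F w hw
  have h : (Matrix.of ![a • u, b • v, c • w]).det =
      (a * b * c : F) * (Matrix.of ![u, v, w]).det := by
    simp [Matrix.det_fin_three, Units.smul_def]
    ring
  rw [p2Collinear_iff_det_rep, ← ha, ← hb, ← hc, h]
  simp

theorem det_of_vecMul (M : Matrix (Fin 3) (Fin 3) F) (u v w : Fin 3 → F) :
    (Matrix.of ![Matrix.vecMul u M, Matrix.vecMul v M, Matrix.vecMul w M]).det =
      (Matrix.of ![u, v, w]).det * M.det := by
  rw [← Matrix.det_mul]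
  congr 1
  ext i j
  fin_cases i <;> rfl

theorem p2Collinear_of_eq {x y : Projectivization F (Fin 3 → F)} (h : x = y)
    (z : Projectivization F (Fin 3 → F)) : P2Collinear F x y z := by
  rw [p2Collinear_iff_det_rep, h]
  exact Matrix.det_zero_of_row_eq (i := 0) (j := 1) (by decide) rfl

/-- A labelled strong realization of the Fano plane: point `i` of the plane carries label `i`. -/
def IsFanoRealization (p : ZMod 7 → Projectivization F (Fin 3 → F)) : Prop :=
  ∀ i j k, i ≠ j → i ≠ k → j ≠ k → (P2Collinear F (p i) (p j) (p k) ↔ k = fanoThird i j)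

theorem IsFanoRealization.injective {p : ZMod 7 → Projectivization F (Fin 3 → F)}
    (hp : IsFanoRealization p) : Function.Injective p := by
  intro i j h
  by_contra hij
  have key : ∀ i j : ZMod 7, i ≠ j → ∃ k, i ≠ k ∧ j ≠ k ∧ k ≠ fanoThird i j := by
    decide +kernel
  obtain ⟨k, hik, hjk, hk⟩ := key i j hij
  exact hk ((hp i j k hij hik hjk).1 (p2Collinear_of_eq h _))

theorem IsFanoRealization.isFanoAut {p : ZMod 7 → Projectivization F (Fin 3 → F)}
    (hp : IsFanoRealization p) {σ : Equiv.Perm (ZMod 7)} (h : IsFanoRealization (p ∘ σ)) :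
    IsFanoAut σ := by
  intro i j hij
  have key : ∀ i j : ZMod 7, i ≠ j → i ≠ fanoThird i j ∧ j ≠ fanoThird i j := by
    decide +kernel
  obtain ⟨hi, hj⟩ := key i j hij
  exact (hp _ _ _ (σ.injective.ne hij) (σ.injective.ne hi) (σ.injective.ne hj)).1
    ((h i j _ hij hi hj).2 rfl)

theorem IsFanoRealization.comp {p : ZMod 7 → Projectivization F (Fin 3 → F)}
    (hp : IsFanoRealization p) {σ : Equiv.Perm (ZMod 7)} (h : IsFanoAut σ) :
    IsFanoRealization (p ∘ σ) := by
  intro i j k hij hik hjk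
  refine (hp _ _ _ (σ.injective.ne hij) (σ.injective.ne hik) (σ.injective.ne hjk)).trans ?_
  rw [← h i j hij, σ.injective.eq_iff]

/-- The points of the projective plane over `𝔽₂`, as integer vectors, labelled so that the lines
are `{a, a + 1, a + 3}`. -/
def fanoVecInt : ZMod 7 → Fin 3 → ℤ := fun i =>
  (![![1, 0, 0], ![0, 1, 0], ![0, 0, 1], ![1, 1, 0], ![0, 1, 1], ![1, 1, 1], ![1, 0, 1]] :
    Fin 7 → Fin 3 → ℤ) i

variable (F) in
/-- The vectors `fanoVecInt` over a field. -/
def fanoVec (i : ZMod 7) : Fin 3 → F := fun j => (fanoVecInt i j : F)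

theorem fanoVec_eq (i : ZMod 7) : fanoVec F i =
    (![![1, 0, 0], ![0, 1, 0], ![0, 0, 1], ![1, 1, 0], ![0, 1, 1], ![1, 1, 1], ![1, 0, 1]] :
      Fin 7 → Fin 3 → F) i := by
  change Fin 7 at i
  funext j
  change ((fanoVecInt i j : ℤ) : F) = _
  fin_cases i <;> fin_cases j <;> first | exact Int.cast_one | exact Int.cast_zero

theorem fanoVec_zero : fanoVec F 0 = ![1, 0, 0] := fanoVec_eq 0

theorem fanoVec_one : fanoVec F 1 = ![0, 1, 0] := fanoVec_eq 1

theorem fanoVec_two : fanoVec F 2 = ![0, 0, 1] := fanoVec_eq 2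

theorem fanoVec_three : fanoVec F 3 = ![1, 1, 0] := fanoVec_eq 3

theorem fanoVec_four : fanoVec F 4 = ![0, 1, 1] := fanoVec_eq 4

theorem fanoVec_five : fanoVec F 5 = ![1, 1, 1] := fanoVec_eq 5

theorem fanoVec_six : fanoVec F 6 = ![1, 0, 1] := fanoVec_eq 6

theorem two_dvd_det_fanoVecInt_iff : ∀ i j k : ZMod 7, i ≠ j → i ≠ k → j ≠ k →
    ((2 : ℤ) ∣ (Matrix.of ![fanoVecInt i, fanoVecInt j, fanoVecInt k]).det ↔
      k = fanoThird i j) := by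
  simp only [Matrix.det_fin_three]
  decide +kernel

theorem det_fanoVec (i j k : ZMod 7) :
    (Matrix.of ![fanoVec F i, fanoVec F j, fanoVec F k]).det =
      ((Matrix.of ![fanoVecInt i, fanoVecInt j, fanoVecInt k]).det : F) := by
  simp [Matrix.det_fin_three, fanoVec]

theorem fanoVec_ne_zero (i : ZMod 7) : fanoVec F i ≠ 0 := by
  have key : ∀ i : ZMod 7, ∃ j, fanoVecInt i j = 1 := by decide +kernel
  obtain ⟨j, hj⟩ := key i
  intro h
  have := congrFun h j
  simp [fanoVec, hj] at this

theorem fanoVec_vecMul_ne_zero (M : GL (Fin 3) F) (i : ZMod 7) :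
    Matrix.vecMul (fanoVec F i) (M : Matrix (Fin 3) (Fin 3) F) ≠ 0 := fun h =>
  fanoVec_ne_zero i (Matrix.vecMul_injective_of_isUnit M.isUnit
    (h.trans (Matrix.zero_vecMul _).symm))

/-- The image of the standard Fano configuration under an invertible matrix. -/
def fanoPoints (M : GL (Fin 3) F) (i : ZMod 7) : Projectivization F (Fin 3 → F) :=
  .mk F _ (fanoVec_vecMul_ne_zero M i)

theorem isFanoRealization_fanoPoints [CharP F 2] (M : GL (Fin 3) F) :
    IsFanoRealization (fanoPoints M) := by
  intro i j k hij hik hjk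
  have hM : (M : Matrix (Fin 3) (Fin 3) F).det ≠ 0 := M.isUnit.map Matrix.detMonoidHom |>.ne_zero
  rw [fanoPoints, fanoPoints, fanoPoints, p2Collinear_mk_iff, det_of_vecMul, mul_eq_zero,
    or_iff_left hM, det_fanoVec, CharP.intCast_eq_zero_iff F 2,
    ← two_dvd_det_fanoVecInt_iff i j k hij hik hjk]
  rfl

theorem fanoPoints_smul (u : Fˣ) (M : GL (Fin 3) F) : fanoPoints (u • M) = fanoPoints M := by
  funext i
  rw [fanoPoints, fanoPoints, Projectivization.mk_eq_mk_iff]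
  exact ⟨u, by rw [Units.val_smul, Matrix.vecMul_smul]⟩

theorem exists_smul_eq_of_fanoPoints_eq {M N : GL (Fin 3) F} (h : fanoPoints M = fanoPoints N) :
    ∃ u : Fˣ, u • N = M := by
  have h' (i : ZMod 7) : ∃ u : Fˣ, Matrix.vecMul (u • fanoVec F i)
      (N : Matrix (Fin 3) (Fin 3) F) = Matrix.vecMul (fanoVec F i) M := by
    obtain ⟨u, hu⟩ := (Projectivization.mk_eq_mk_iff F _ _ _ _).1 (congrFun h i)
    exact ⟨u, by rw [Matrix.smul_vecMul, hu]⟩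
  choose u hu using h'
  have hrow : u 5 • fanoVec F 5 = u 0 • fanoVec F 0 + u 1 • fanoVec F 1 + u 2 • fanoVec F 2 := by
    apply Matrix.vecMul_injective_of_isUnit N.isUnit
    simp only [Matrix.add_vecMul, hu]
    rw [← Matrix.add_vecMul, ← Matrix.add_vecMul, fanoVec_zero, fanoVec_one, fanoVec_two,
      fanoVec_five]
    simp
  rw [fanoVec_zero, fanoVec_one, fanoVec_two, fanoVec_five] at hrow
  have e0 : u 5 = u 0 := Units.ext (by simpa [Units.smul_def] using congrFun hrow 0)
  have e1 : u 5 = u 1 := Units.ext (by simpa [Units.smul_def] using congrFun hrow 1)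
  have e2 : u 5 = u 2 := Units.ext (by simpa [Units.smul_def] using congrFun hrow 2)
  have h0 := hu 0
  have h1 := hu 1
  have h2 := hu 2
  rw [← e0, fanoVec_zero] at h0
  rw [← e1, fanoVec_one] at h1
  rw [← e2, fanoVec_two] at h2
  refine ⟨u 5, Units.ext (Matrix.ext fun i j => ?_)⟩
  fin_cases i
  · simpa [Units.smul_def, Matrix.vecMul, dotProduct, Fin.sum_univ_three] using congrFun h0 j
  · simpa [Units.smul_def, Matrix.vecMul, dotProduct, Fin.sum_univ_three] using congrFun h1 j
  · simpa [Units.smul_def, Matrix.vecMul, dotProduct, Fin.sum_univ_three] using congrFun h2 j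

/-- A realization of the Fano plane exists only in characteristic two, and then it is projectively
equivalent to the standard one. -/
theorem IsFanoRealization.exists_fanoPoints_eq {p : ZMod 7 → Projectivization F (Fin 3 → F)}
    (hp : IsFanoRealization p) : (2 : F) = 0 ∧ ∃ M : GL (Fin 3) F, fanoPoints M = p := by
  let G : Matrix (Fin 3) (Fin 3) F := Matrix.of ![(p 0).rep, (p 1).rep, (p 2).rep]
  have hG : G.det ≠ 0 := by
    rw [Ne, ← p2Collinear_iff_det_rep, hp 0 1 2 (by decide) (by decide) (by decide)]
    decide
  have hGu : IsUnit G.det := isUnit_iff_ne_zero.2 hG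
  let c (i : ZMod 7) : Fin 3 → F := Matrix.vecMul (p i).rep G⁻¹
  have hc (i : ZMod 7) : Matrix.vecMul (c i) G = (p i).rep := by
    simp [c, Matrix.vecMul_vecMul, Matrix.nonsing_inv_mul G hGu]
  have hdet (i j k : ZMod 7) (hij : i ≠ j) (hik : i ≠ k) (hjk : j ≠ k) :
      (Matrix.of ![c i, c j, c k]).det = 0 ↔ k = fanoThird i j := by
    rw [← hp i j k hij hik hjk, p2Collinear_iff_det_rep, ← hc i, ← hc j, ← hc k,
      det_of_vecMul (M := G), mul_eq_zero (b := G.det), or_iff_left hG]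
  have hinj := Matrix.vecMul_injective_of_isUnit ((Matrix.isUnit_iff_isUnit_det G).2 hGu)
  have c0 : c 0 = ![1, 0, 0] := hinj ((hc 0).trans (by simp [G]))
  have c1 : c 1 = ![0, 1, 0] := hinj ((hc 1).trans (by
    simp [G, Matrix.vecMul_cons]))
  have c2 : c 2 = ![0, 0, 1] := hinj ((hc 2).trans (by simp [G]))
  have on (i j k : ZMod 7) (hij : i ≠ j) (hik : i ≠ k) (hjk : j ≠ k) (h : k = fanoThird i j) :=
    (hdet i j k hij hik hjk).2 h
  have off (i j k : ZMod 7) (hij : i ≠ j) (hik : i ≠ k) (hjk : j ≠ k) (h : k ≠ fanoThird i j) :=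
    (hdet i j k hij hik hjk).not.2 h
  have a0 := off 1 2 5 (by decide) (by decide) (by decide) (by decide)
  have b0 := off 0 2 5 (by decide) (by decide) (by decide) (by decide)
  have d0 := off 0 1 5 (by decide) (by decide) (by decide) (by decide)
  have z3 := on 0 1 3 (by decide) (by decide) (by decide) (by decide)
  have r3 := on 2 5 3 (by decide) (by decide) (by decide) (by decide)
  have n3 := off 1 2 3 (by decide) (by decide) (by decide) (by decide)
  have z4 := on 1 2 4 (by decide) (by decide) (by decide) (by decide)
  have r4 := on 0 5 4 (by decide) (by decide) (by decide) (by decide)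
  have n4 := off 0 2 4 (by decide) (by decide) (by decide) (by decide)
  have z6 := on 0 2 6 (by decide) (by decide) (by decide) (by decide)
  have r6 := on 1 5 6 (by decide) (by decide) (by decide) (by decide)
  have n6 := off 1 2 6 (by decide) (by decide) (by decide) (by decide)
  have l := on 3 4 6 (by decide) (by decide) (by decide) (by decide)
  simp [Matrix.det_fin_three, c0, c1, c2] at a0 b0 d0 z3 r3 n3 z4 r4 n4 z6 r6 n6 l
  constructor
  · have h : (2 : F) * (c 5 1 * c 3 0 * (c 5 2 * c 4 1) * (c 5 2 * c 6 0)) = 0 := by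
      rw [z3, z4, z6] at l
      linear_combination c 5 0 * c 5 1 * c 5 2 * l - c 5 1 * c 5 2 * c 4 2 * c 6 0 * r3
        - c 5 1 * c 3 0 * c 5 2 * c 6 0 * r4 + c 5 1 * c 3 0 * c 5 2 * c 4 1 * r6
    simpa [a0, b0, d0, n3, n4, n6] using h
  have hM : (Matrix.diagonal (c 5) * G).det ≠ 0 := by
    rw [Matrix.det_mul, Matrix.det_diagonal, Fin.prod_univ_three]
    exact mul_ne_zero (mul_ne_zero (mul_ne_zero a0 b0) d0) hG
  refine ⟨Matrix.GeneralLinearGroup.mkOfDetNeZero _ hM, ?_⟩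
  have scaled (i : ZMod 7) (a : F) (h : ∀ j, a * (fanoVec F i j * c 5 j) = c i j) :
      fanoPoints (Matrix.GeneralLinearGroup.mkOfDetNeZero _ hM) i = p i := by
    rw [← (p i).mk_rep, eq_comm, fanoPoints, Projectivization.mk_eq_mk_iff']
    refine ⟨a, ?_⟩
    change a • Matrix.vecMul (fanoVec F i) (Matrix.diagonal (c 5) * G) = _
    rw [← hc i, ← Matrix.vecMul_vecMul, ← Matrix.smul_vecMul]
    congr 1
    funext j
    rw [← h j, Pi.smul_apply, Matrix.vecMul_diagonal, smul_eq_mul]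
  funext i
  change Fin 7 at i
  fin_cases i
  · refine scaled 0 (c 5 0)⁻¹ fun j => ?_
    fin_cases j <;> simp [fanoVec_zero, c0, a0]
  · refine scaled 1 (c 5 1)⁻¹ fun j => ?_
    fin_cases j <;> simp [fanoVec_one, c1, b0]
  · refine scaled 2 (c 5 2)⁻¹ fun j => ?_
    fin_cases j <;> simp [fanoVec_two, c2, d0]
  · refine scaled 3 (c 3 0 / c 5 0) fun j => ?_
    fin_cases j <;> simp [fanoVec_three, z3] <;> field_simp
    linear_combination -r3
  · refine scaled 4 (c 4 1 / c 5 1) fun j => ?_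
    fin_cases j <;> simp [fanoVec_four, z4] <;> field_simp
    linear_combination -r4
  · refine scaled 5 1 fun j => ?_
    fin_cases j <;> simp [fanoVec_five]
  · refine scaled 6 (c 6 0 / c 5 0) fun j => ?_
    fin_cases j <;> simp [fanoVec_six, z6] <;> field_simp
    linear_combination r6

variable (F) in
theorem card_isFanoRealization_mul [CharP F 2] :
    Nat.card {p : ZMod 7 → Projectivization F (Fin 3 → F) // IsFanoRealization p} *
      Nat.card Fˣ = Nat.card (GL (Fin 3) F) := by
  choose g hg using
    fun p : {p : ZMod 7 → Projectivization F (Fin 3 → F) // IsFanoRealization p} =>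
      p.2.exists_fanoPoints_eq.2
  rw [← Nat.card_prod]
  refine Nat.card_congr (Equiv.ofBijective (fun x => x.2 • g x.1) ⟨?_, fun M => ?_⟩)
  · rintro ⟨p, u⟩ ⟨p', u'⟩ h
    dsimp only at h
    have hp : p = p' := Subtype.ext (by
      rw [← hg p, ← hg p', ← fanoPoints_smul u, h, fanoPoints_smul])
    subst hp
    rw [Prod.mk.injEq]
    exact ⟨rfl, Units.ext (smul_left_injective F (g p).isUnit.ne_zero (congrArg Units.val h))⟩
  · obtain ⟨u, hu⟩ := exists_smul_eq_of_fanoPoints_eq (hg ⟨_, isFanoRealization_fanoPoints M⟩).symm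
    exact ⟨(⟨_, isFanoRealization_fanoPoints M⟩, u), hu⟩

variable (F) in
theorem card_exists_isFanoRealization_comp_mul :
    Nat.card {p : ZMod 7 → Projectivization F (Fin 3 → F) //
      ∃ σ : Equiv.Perm (ZMod 7), IsFanoRealization (p ∘ σ)} * Nat.card {σ // IsFanoAut σ} =
    Nat.card {p : ZMod 7 → Projectivization F (Fin 3 → F) // IsFanoRealization p} *
      Nat.card (Equiv.Perm (ZMod 7)) := by
  choose s hs using fun p : {p : ZMod 7 → Projectivization F (Fin 3 → F) //
    ∃ σ : Equiv.Perm (ZMod 7), IsFanoRealization (p ∘ σ)} => p.2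
  rw [← Nat.card_prod, ← Nat.card_prod]
  refine Nat.card_congr (Equiv.ofBijective
    (fun x => (⟨(x.1.1 ∘ s x.1) ∘ x.2.1, (hs x.1).comp x.2.2⟩, s x.1 * x.2.1)) ⟨?_, ?_⟩)
  · rintro ⟨p, σ⟩ ⟨p', σ'⟩ h
    obtain ⟨h1, h2⟩ := Prod.mk.inj h
    have h1' : p.1 ∘ ⇑(s p * σ.1) = p'.1 ∘ ⇑(s p' * σ'.1) := congrArg Subtype.val h1
    rw [← h2] at h1'
    have hp : p = p' := Subtype.ext ((s p * σ.1).surjective.injective_comp_right h1')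
    subst hp
    rw [Prod.mk.injEq]
    exact ⟨rfl, Subtype.ext (mul_left_cancel h2)⟩
  · rintro ⟨⟨r, hr⟩, σ⟩
    have hσ : (r ∘ ⇑σ⁻¹) ∘ σ = r := by
      funext i
      simp
    let p : {p : ZMod 7 → Projectivization F (Fin 3 → F) //
      ∃ σ : Equiv.Perm (ZMod 7), IsFanoRealization (p ∘ σ)} := ⟨r ∘ ⇑σ⁻¹, σ, hσ.symm ▸ hr⟩
    have hcomp : (p.1 ∘ s p) ∘ ⇑((s p)⁻¹ * σ) = r := by
      funext i
      simp [p]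
    refine ⟨(p, ⟨(s p)⁻¹ * σ, (hs p).isFanoAut (hcomp.symm ▸ hr)⟩), ?_⟩
    rw [Prod.mk.injEq]
    exact ⟨Subtype.ext hcomp, mul_inv_cancel_left _ _⟩

variable (F) in
theorem p2A7_eq_card : P2A7 F = Nat.card {p : ZMod 7 → Projectivization F (Fin 3 → F) //
    ∃ σ : Equiv.Perm (ZMod 7), IsFanoRealization (p ∘ σ)} := by
  have iff_real (p : ZMod 7 → Projectivization F (Fin 3 → F)) (σ : Equiv.Perm (ZMod 7)) :
      (∀ i j k : ZMod 7, i ≠ j → i ≠ k → j ≠ k → (P2Collinear F (p (σ i)) (p (σ j)) (p (σ k)) ↔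
        ∃ a : ZMod 7, ({i, j, k} : Set (ZMod 7)) = {a, a + 1, a + 3})) ↔
      IsFanoRealization (p ∘ σ) := by
    refine forall_congr' fun i => forall_congr' fun j => forall_congr' fun k =>
      forall_congr' fun hij => forall_congr' fun hik => forall_congr' fun hjk => ?_
    rw [exists_line_eq_iff_eq_fanoThird hij hik hjk]
    rfl
  refine Nat.card_congr (Equiv.subtypeEquivRight fun p => ?_)
  simp only [iff_real]
  exact and_iff_right_of_imp fun ⟨σ, h⟩ =>
    (Equiv.injective_comp σ p).1 h.injective

end Projective

/-- The number of ordered strong realizations of the Fano plane in `ℙ²(F_q)`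
is `30·a(q)·(q²+q+1)(q²+q)q²(q-1)²`, where `a(q) = 1` if `q` is even and
`a(q) = 0` if `q` is odd. -/
theorem count_fano_realizations (F : Type) [Field F] [Fintype F]
    (q : ℤ) (hq : q = Fintype.card F) :
    (P2A7 F : ℤ) =
      30 * (if 2 ∣ Fintype.card F then 1 else 0) *
        ((q ^ 2 + q + 1) * (q ^ 2 + q) * q ^ 2 * (q - 1) ^ 2) := by
  have h_mul := card_exists_isFanoRealization_comp_mul F
  rw [← p2A7_eq_card, card_isFanoAut, Nat.card_perm, Nat.card_zmod] at h_mul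
  split_ifs with h2
  · have h20 : (2 : F) = 0 := by
      obtain ⟨m, hm⟩ := h2
      have hchar : ringChar F = 2 := FiniteField.even_card_iff_char_two.2 (by omega)
      exact_mod_cast (ringChar.spec F 2).2 hchar.dvd
    have : CharP F 2 := CharTwo.of_one_ne_zero_of_two_eq_zero one_ne_zero h20
    have h_GL := card_isFanoRealization_mul F
    have hq1 : 1 < Fintype.card F := Fintype.one_lt_card
    rw [Matrix.card_GL_field, Nat.card_units, Nat.card_eq_fintype_card (α := F),
      Fin.prod_univ_three] at h_GL
    zify at h_GL h_mul
    rw [Nat.cast_sub hq1.le, Nat.cast_sub (Nat.pow_le_pow_right hq1.le (by decide)),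
      Nat.cast_sub (Nat.pow_le_pow_right hq1.le (by decide)),
      Nat.cast_sub (Nat.pow_le_pow_right hq1.le (by decide))] at h_GL
    push_cast at h_GL
    rw [← hq] at h_GL
    have hq0 : (q - 1) * 168 ≠ 0 := by omega
    norm_num [Nat.factorial] at h_mul h_GL
    apply mul_right_cancel₀ hq0
    linear_combination (q - 1) * h_mul + 5040 * h_GL
  · have : IsEmpty {p : ZMod 7 → Projectivization F (Fin 3 → F) // IsFanoRealization p} := by
      refine ⟨fun p => h2 ?_⟩
      have hchar : ringChar F ∣ 2 := (ringChar.spec F 2).1 (by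
        exact_mod_cast p.2.exists_fanoPoints_eq.1)
      have := FiniteField.even_card_iff_char_two.1
        ((Nat.prime_dvd_prime_iff_eq (CharP.char_is_prime F _) Nat.prime_two).1 hchar)
      omega
    rw [Nat.card_of_isEmpty] at h_mul
    omega
end
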